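/- arXiv:math/0410522 — 2 statements merged into one kernel-verified Lean document; each statement's English description precedes it below -/
import Mathlib

section
/- Tsang's two-sided omega result for the sphere: limsup_{x→∞} P₃(x)/( x^{1/2} (log x)^{1/2} ) > 0 and liminf_{x→∞} P₃(x)/( x^{1/2} (log x)^{1/2} ) < 0. -/
open Real Filter

/-- The number of integer lattice points in the closed origin-centered ball of radius `√x`
in `ℝ³`. -/
noncomputable def latticeA3 (x : ℝ) : ℕ :=
  {p : ℤ × ℤ × ℤ | (p.1 : ℝ) ^ 2 + (p.2.1 : ℝ) ^ 2 + (p.2.2 : ℝ) ^ 2 ≤ x}.ncard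

/-- The lattice point discrepancy of the ball in `ℝ³`. -/
noncomputable def latticeP3 (x : ℝ) : ℝ :=
  (latticeA3 x : ℝ) - (4 * Real.pi / 3) * x ^ ((3 : ℝ) / 2)

/-! ### Lattice points in shifted balls -/

/-- The volume of the ball of radius `√x` in `ℝ³`. -/
noncomputable def ballVol (x : ℝ) : ℝ := (4 * Real.pi / 3) * x ^ ((3 : ℝ) / 2)

/-- The number of points of the shifted lattice `ℤ³ + u` in the ball of radius `√t`. -/
noncomputable def shiftCount (u : Fin 3 → ℝ) (t : ℝ) : ℕ :=
  {v : Fin 3 → ℤ | ∑ i, ((v i : ℝ) + u i) ^ 2 ≤ t}.ncard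

/-- The half-open unit cube. -/
def unitCube : Set (Fin 3 → ℝ) := Set.univ.pi fun _ => Set.Ico 0 1

/-- The lattice points with coordinates at most `L` in absolute value. -/
noncomputable def latticeBox (L : ℕ) : Finset (Fin 3 → ℤ) :=
  Fintype.piFinset fun _ => Finset.Icc (-(L : ℤ)) L

lemma mem_latticeBox {L : ℕ} {v : Fin 3 → ℤ} : v ∈ latticeBox L ↔ ∀ i, |v i| ≤ L := by
  simp [latticeBox, abs_le]

lemma neg_mem_latticeBox {L : ℕ} {v : Fin 3 → ℤ} (h : v ∈ latticeBox L) :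
    -v ∈ latticeBox L := by
  simpa [mem_latticeBox] using h

lemma mem_latticeBox_of_sum_sq_le {L : ℕ} {t : ℝ} {u : Fin 3 → ℝ} {v : Fin 3 → ℤ}
    (hu : ∀ i, |u i| ≤ 1) (hL : √t + 1 ≤ L) (h : ∑ i, ((v i : ℝ) + u i) ^ 2 ≤ t) :
    v ∈ latticeBox L := by
  rw [mem_latticeBox]
  intro i
  have h1 : ((v i : ℝ) + u i) ^ 2 ≤ t :=
    (Finset.single_le_sum (f := fun i => ((v i : ℝ) + u i) ^ 2)
      (fun i _ => sq_nonneg _) (Finset.mem_univ i)).trans h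
  have h2 := Real.abs_le_sqrt h1
  have h3 := hu i
  have h4 : |(v i : ℝ)| ≤ L := by
    rw [abs_le] at *
    constructor <;> linarith
  exact_mod_cast h4

open Classical in
lemma shiftCount_eq_card {L : ℕ} {t : ℝ} {u : Fin 3 → ℝ}
    (hu : ∀ i, |u i| ≤ 1) (hL : √t + 1 ≤ L) :
    shiftCount u t
      = ((latticeBox L).filter fun v => ∑ i, ((v i : ℝ) + u i) ^ 2 ≤ t).card := by
  rw [shiftCount, ← Set.ncard_coe_finset]
  congr 1
  ext v
  simp only [Set.mem_ofPred_eq, Finset.coe_filter]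
  exact ⟨fun h => ⟨mem_latticeBox_of_sum_sq_le hu hL h, h⟩, fun h => h.2⟩

open Classical in
lemma shiftCount_eq_sum {L : ℕ} {t : ℝ} {u : Fin 3 → ℝ}
    (hu : ∀ i, |u i| ≤ 1) (hL : √t + 1 ≤ L) :
    (shiftCount u t : ℝ)
      = ∑ v ∈ latticeBox L, if ∑ i, ((v i : ℝ) + u i) ^ 2 ≤ t then (1 : ℝ) else 0 := by
  rw [shiftCount_eq_card hu hL, Finset.card_filter]
  push_cast
  rfl

lemma abs_le_one_of_mem_unitCube {u : Fin 3 → ℝ} (hu : u ∈ unitCube) (i : Fin 3) :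
    |u i| ≤ 1 := by
  have := hu i trivial
  rw [abs_of_nonneg this.1]
  exact this.2.le

lemma measurableSet_unitCube : MeasurableSet unitCube :=
  MeasurableSet.univ_pi fun _ => measurableSet_Ico

lemma volume_unitCube : MeasureTheory.volume unitCube = 1 := by
  simp [unitCube, Real.volume_pi_Ico]

lemma volume_sum_sq_le {t : ℝ} (ht : 0 ≤ t) :
    MeasureTheory.volume {x : Fin 3 → ℝ | ∑ i, x i ^ 2 ≤ t} = ENNReal.ofReal (ballVol t) := by
  have h1 := (EuclideanSpace.volume_preserving_symm_measurableEquiv_toLp (Fin 3))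
  have h2 : {x : Fin 3 → ℝ | ∑ i, x i ^ 2 ≤ t} =
      (MeasurableEquiv.toLp 2 (Fin 3 → ℝ)) ⁻¹' (Metric.closedBall 0 (√t)) := by
    ext x
    simp only [Set.mem_ofPred_eq, Set.mem_preimage, Metric.mem_closedBall, dist_zero_right]
    rw [EuclideanSpace.norm_eq, Real.sqrt_le_sqrt_iff ht]
    simp
  have h3 := (h1.symm).measure_preimage_equiv (Metric.closedBall 0 (√t))
  rw [h2]
  refine h3.trans ?_
  rw [EuclideanSpace.volume_closedBall_fin_three, ← ENNReal.ofReal_pow (by positivity),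
    ← ENNReal.ofReal_mul (by positivity), ballVol]
  congr 1
  have : √t ^ 3 = t ^ ((3 : ℝ) / 2) := by
    rw [Real.sqrt_eq_rpow, ← Real.rpow_natCast, ← Real.rpow_mul ht]
    norm_num
  rw [this]; ring

lemma lintegral_eq_tsum_unitCube (f : (Fin 3 → ℝ) → ENNReal) :
    ∫⁻ x, f x = ∑' v : Fin 3 → ℤ, ∫⁻ u in unitCube, f (fun i => (v i : ℝ) + u i) := by
  have hU : (⋃ v : Fin 3 → ℤ, (fun x : Fin 3 → ℝ => x - fun i => (v i : ℝ)) ⁻¹' unitCube)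
      = Set.univ := by
    rw [Set.eq_univ_iff_forall]
    intro x
    simp only [Set.mem_iUnion, Set.mem_preimage]
    refine ⟨fun i => ⌊x i⌋, fun i _ => ?_⟩
    simp only [Pi.sub_apply, Set.mem_Ico]
    exact ⟨sub_nonneg.2 (Int.floor_le _), by linarith [Int.lt_floor_add_one (x i)]⟩
  rw [← MeasureTheory.setLIntegral_univ, ← hU, MeasureTheory.lintegral_iUnion]
  · refine tsum_congr fun v => ?_
    have hp := MeasureTheory.measurePreserving_sub_right
      (MeasureTheory.volume : MeasureTheory.Measure (Fin 3 → ℝ)) (fun i => (v i : ℝ))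
    have he : MeasurableEmbedding (fun x : Fin 3 → ℝ => x - fun i => (v i : ℝ)) :=
      (MeasurableEquiv.subRight _).measurableEmbedding
    rw [← hp.setLIntegral_comp_preimage_emb he (fun u => f fun i => (v i : ℝ) + u i) unitCube]
    refine MeasureTheory.lintegral_congr fun x => ?_
    exact congrArg f (funext fun i => by simp)
  · intro v
    exact (measurable_id.sub_const _) measurableSet_unitCube
  · intro v w hvw
    rw [Function.onFun, Set.disjoint_left]
    intro x hx hy
    apply hvw
    ext i
    have h1 := hx i trivial
    have h2 := hy i trivial
    simp only [Pi.sub_apply, Set.mem_Ico, sub_nonneg, sub_lt_iff_lt_add] at h1 h2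
    have h3 : ⌊x i⌋ = v i := Int.floor_eq_iff.2 ⟨h1.1, by linarith⟩
    have h4 : ⌊x i⌋ = w i := Int.floor_eq_iff.2 ⟨h2.1, by linarith⟩
    rw [← h3, h4]

open Classical in
lemma shiftCount_eq_tsum {t : ℝ} {u : Fin 3 → ℝ} (hu : ∀ i, |u i| ≤ 1) :
    (shiftCount u t : ENNReal)
      = ∑' v : Fin 3 → ℤ, {x : Fin 3 → ℝ | ∑ i, x i ^ 2 ≤ t}.indicator (fun _ => (1 : ENNReal))
          (fun i => (v i : ℝ) + u i) := by
  obtain ⟨L, hL⟩ := exists_nat_ge (√t + 1)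
  rw [shiftCount_eq_card hu hL, Finset.card_filter]
  rw [tsum_eq_sum (s := latticeBox L)]
  · push_cast
    refine Finset.sum_congr rfl fun v _ => ?_
    simp [Set.indicator_apply]
  · intro v hv
    rw [Set.indicator_of_notMem]
    intro h
    exact hv (mem_latticeBox_of_sum_sq_le hu hL h)

lemma measurableSet_sum_sq_le (t : ℝ) :
    MeasurableSet {x : Fin 3 → ℝ | ∑ i, x i ^ 2 ≤ t} :=
  measurableSet_le (by fun_prop) measurable_const

lemma lintegral_shiftCount {t : ℝ} (ht : 0 ≤ t) :
    ∫⁻ u in unitCube, (shiftCount u t : ENNReal) = ENNReal.ofReal (ballVol t) := by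
  rw [MeasureTheory.setLIntegral_congr_fun measurableSet_unitCube
    (fun u hu => shiftCount_eq_tsum (abs_le_one_of_mem_unitCube hu)),
    MeasureTheory.lintegral_tsum, ← lintegral_eq_tsum_unitCube,
    MeasureTheory.lintegral_indicator_const (measurableSet_sum_sq_le t), one_mul,
    volume_sum_sq_le ht]
  intro v
  exact ((measurable_const.indicator (measurableSet_sum_sq_le t)).comp
    (by fun_prop)).aemeasurable

lemma ballVol_nonneg {t : ℝ} (ht : 0 ≤ t) : 0 ≤ ballVol t := by
  unfold ballVol; positivity

lemma aemeasurable_shiftCount (t : ℝ) :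
    AEMeasurable (fun u => (shiftCount u t : ENNReal))
      (MeasureTheory.volume.restrict unitCube) := by
  refine AEMeasurable.congr (f := fun u => ∑' v : Fin 3 → ℤ,
    {x : Fin 3 → ℝ | ∑ i, x i ^ 2 ≤ t}.indicator (fun _ => (1 : ENNReal))
          (fun i => (v i : ℝ) + u i)) ?_ ?_
  · refine AEMeasurable.tsum fun v => ?_
    exact ((measurable_const.indicator (measurableSet_sum_sq_le t)).comp
      (by fun_prop)).aemeasurable
  · refine (MeasureTheory.ae_restrict_iff' measurableSet_unitCube).2 (.of_forall fun u hu => ?_)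
    exact (shiftCount_eq_tsum (abs_le_one_of_mem_unitCube hu)).symm

lemma integrableOn_shiftCount {t : ℝ} (ht : 0 ≤ t) :
    MeasureTheory.IntegrableOn (fun u => (shiftCount u t : ℝ)) unitCube := by
  have h := MeasureTheory.integrable_toReal_of_lintegral_ne_top (aemeasurable_shiftCount t)
    (by rw [lintegral_shiftCount ht]; exact ENNReal.ofReal_ne_top)
  simpa [MeasureTheory.IntegrableOn] using h

lemma integral_shiftCount {t : ℝ} (ht : 0 ≤ t) :
    ∫ u in unitCube, (shiftCount u t : ℝ) = ballVol t := by
  have h := MeasureTheory.integral_toReal (aemeasurable_shiftCount t)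
    (.of_forall fun u => ENNReal.natCast_lt_top _)
  rw [lintegral_shiftCount ht, ENNReal.toReal_ofReal (ballVol_nonneg ht)] at h
  simpa using h

lemma setIntegral_unitCube_le {f : (Fin 3 → ℝ) → ℝ} {c : ℝ}
    (hf : MeasureTheory.IntegrableOn f unitCube) (h : ∀ u ∈ unitCube, f u ≤ c) :
    ∫ u in unitCube, f u ≤ c := by
  have := MeasureTheory.setIntegral_mono_on (g := fun _ => c) hf
    (MeasureTheory.integrableOn_const (by simp [volume_unitCube])) measurableSet_unitCube h
  simpa [MeasureTheory.measureReal_def, volume_unitCube] using this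

lemma le_setIntegral_unitCube {f : (Fin 3 → ℝ) → ℝ} {c : ℝ}
    (hf : MeasureTheory.IntegrableOn f unitCube) (h : ∀ u ∈ unitCube, c ≤ f u) :
    c ≤ ∫ u in unitCube, f u := by
  have := MeasureTheory.setIntegral_mono_on (f := fun _ => c)
    (MeasureTheory.integrableOn_const (by simp [volume_unitCube])) hf measurableSet_unitCube h
  simpa [MeasureTheory.measureReal_def, volume_unitCube] using this

lemma ballVol_eq {t : ℝ} (ht : 0 ≤ t) : ballVol t = 4 * π / 3 * √t ^ 3 := by
  rw [ballVol, Real.sqrt_eq_rpow, ← Real.rpow_natCast, ← Real.rpow_mul ht]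
  norm_num

lemma ballVol_sq {r : ℝ} (hr : 0 ≤ r) : ballVol (r ^ 2) = 4 * π / 3 * r ^ 3 := by
  rw [ballVol_eq (sq_nonneg r), Real.sqrt_sq hr]

lemma sum_add_sq_le {x y : Fin 3 → ℝ} {r s : ℝ} (hr : 0 ≤ r) (hs : 0 ≤ s)
    (hx : ∑ i, x i ^ 2 ≤ r ^ 2) (hy : ∑ i, y i ^ 2 ≤ s ^ 2) :
    ∑ i, (x i + y i) ^ 2 ≤ (r + s) ^ 2 := by
  have h1 := Finset.sum_mul_sq_le_sq_mul_sq Finset.univ x y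
  have h2 : (∑ i, x i * y i) ^ 2 ≤ (r * s) ^ 2 := by
    rw [mul_pow]
    exact h1.trans (mul_le_mul hx hy (Finset.sum_nonneg fun i _ => sq_nonneg _) (sq_nonneg r))
  have h3 := abs_le_of_sq_le_sq' h2 (by positivity)
  have h4 : ∑ i, (x i + y i) ^ 2 = ∑ i, x i ^ 2 + 2 * ∑ i, x i * y i + ∑ i, y i ^ 2 := by
    simp only [Fin.sum_univ_three]; ring
  rw [h4]; nlinarith [h3.2]

lemma finite_sum_sq_le (u : Fin 3 → ℝ) (hu : ∀ i, |u i| ≤ 1) (t : ℝ) :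
    {v : Fin 3 → ℤ | ∑ i, ((v i : ℝ) + u i) ^ 2 ≤ t}.Finite := by
  obtain ⟨L, hL⟩ := exists_nat_ge (√t + 1)
  exact (latticeBox L).finite_toSet.subset fun v hv => mem_latticeBox_of_sum_sq_le hu hL hv

lemma shiftCount_le_shiftCount {u w : Fin 3 → ℝ} (hu : ∀ i, |u i| ≤ 1) (hw : ∀ i, |w i| ≤ 1)
    {r : ℝ} (hr : 0 ≤ r) : shiftCount u (r ^ 2) ≤ shiftCount w ((r + 4) ^ 2) := by
  refine Set.ncard_le_ncard (fun v hv => ?_) (finite_sum_sq_le w hw _)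
  have h := sum_add_sq_le (y := fun i => w i - u i) hr (by norm_num : (0 : ℝ) ≤ 4) hv ?_
  · simpa using h
  · have : ∀ i, (w i - u i) ^ 2 ≤ 4 := fun i => by
      have h1 := abs_le.1 (hu i)
      have h2 := abs_le.1 (hw i)
      nlinarith
    simp only [Fin.sum_univ_three]
    linarith [this 0, this 1, this 2]

lemma shiftCount_le_ballVol {u : Fin 3 → ℝ} (hu : ∀ i, |u i| ≤ 1) {r : ℝ} (hr : 0 ≤ r) :
    (shiftCount u (r ^ 2) : ℝ) ≤ ballVol ((r + 4) ^ 2) := by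
  rw [← integral_shiftCount (sq_nonneg _)]
  refine le_setIntegral_unitCube (integrableOn_shiftCount (sq_nonneg _)) fun w hw => ?_
  exact_mod_cast shiftCount_le_shiftCount hu (abs_le_one_of_mem_unitCube hw) hr

lemma ballVol_le_shiftCount {u : Fin 3 → ℝ} (hu : ∀ i, |u i| ≤ 1) {r : ℝ} (hr : 0 ≤ r) :
    ballVol (r ^ 2) ≤ shiftCount u ((r + 4) ^ 2) := by
  rw [← integral_shiftCount (sq_nonneg _)]
  refine setIntegral_unitCube_le (integrableOn_shiftCount (sq_nonneg _)) fun w hw => ?_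
  exact_mod_cast shiftCount_le_shiftCount (abs_le_one_of_mem_unitCube hw) hu hr

lemma abs_shiftCount_sub_ballVol_le {u : Fin 3 → ℝ} (hu : ∀ i, |u i| ≤ 1) {r : ℝ}
    (hr : 1 ≤ r) : |(shiftCount u (r ^ 2) : ℝ) - ballVol (r ^ 2)| ≤ 600 * r ^ 2 := by
  have hπ := Real.pi_lt_d2
  have hπ0 := Real.pi_pos
  have h1 := shiftCount_le_ballVol hu (by linarith : 0 ≤ r)
  rw [ballVol_sq (by linarith)] at h1 ⊢
  rw [abs_le]
  constructor
  · rcases le_total 4 r with h4 | h4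
    · have h2 := ballVol_le_shiftCount hu (by linarith : 0 ≤ r - 4)
      rw [ballVol_sq (by linarith), sub_add_cancel] at h2
      have : r ^ 3 - (r - 4) ^ 3 ≤ 124 * r ^ 2 := by nlinarith
      have h3 : 4 * π / 3 * (r ^ 3 - (r - 4) ^ 3) ≤ 4 * π / 3 * (124 * r ^ 2) := by gcongr
      nlinarith [sq_nonneg r]
    · have : r ^ 3 ≤ 4 * r ^ 2 := by nlinarith
      have h3 : 4 * π / 3 * r ^ 3 ≤ 4 * π / 3 * (4 * r ^ 2) := by gcongr
      have h5 : (0 : ℝ) ≤ shiftCount u (r ^ 2) := Nat.cast_nonneg _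
      nlinarith [sq_nonneg r]
  · have : (r + 4) ^ 3 - r ^ 3 ≤ 124 * r ^ 2 := by nlinarith
    have h3 : 4 * π / 3 * ((r + 4) ^ 3 - r ^ 3) ≤ 4 * π / 3 * (124 * r ^ 2) := by gcongr
    nlinarith [sq_nonneg r]

/-! ### The mean of the discrepancy -/

lemma abs_card_filter_le_sub_le (N : ℕ) {s : ℝ} (hs : 0 ≤ s) :
    |(∑ n ∈ Finset.range N, if s ≤ (n : ℝ) then (1 : ℝ) else 0) - max (N - s) 0|
      ≤ if s ≤ N then 1 else 0 := by
  have h1 : (∑ n ∈ Finset.range N, if s ≤ (n : ℝ) then (1 : ℝ) else 0) = ((N - ⌈s⌉₊ : ℕ) : ℝ) := by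
    rw [← Finset.sum_filter, Finset.sum_const, nsmul_eq_mul, mul_one, ← Nat.card_Ico]
    congr 2
    ext n
    simp [Nat.ceil_le, and_comm]
  rw [h1]
  have h2 := Nat.le_ceil s
  have h3 := Nat.ceil_lt_add_one hs
  split_ifs with h
  · have : ⌈s⌉₊ ≤ N := Nat.ceil_le.2 h
    rw [Nat.cast_sub this, max_eq_left (by linarith), abs_le]
    constructor <;> linarith
  · push Not at h
    have : N ≤ ⌈s⌉₊ := by
      have : (N : ℝ) ≤ ⌈s⌉₊ := by linarith
      exact_mod_cast this
    rw [Nat.sub_eq_zero_of_le this, max_eq_right (by linarith)]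
    simp

open Classical in
lemma abs_sum_shiftCount_sub_le {u : Fin 3 → ℝ} (hu : ∀ i, |u i| ≤ 1) {N L : ℕ}
    (hL : √N + 1 ≤ L) :
    |∑ n ∈ Finset.range N, (shiftCount u n : ℝ)
      - ∑ v ∈ latticeBox L, max ((N : ℝ) - ∑ i, ((v i : ℝ) + u i) ^ 2) 0|
      ≤ shiftCount u N := by
  have h1 : ∀ n ∈ Finset.range N, (shiftCount u n : ℝ)
      = ∑ v ∈ latticeBox L, if ∑ i, ((v i : ℝ) + u i) ^ 2 ≤ (n : ℝ) then (1 : ℝ) else 0 := by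
    intro n hn
    refine shiftCount_eq_sum hu (le_trans ?_ hL)
    have : (n : ℝ) ≤ N := by exact_mod_cast (Finset.mem_range.1 hn).le
    gcongr
  rw [Finset.sum_congr rfl h1, Finset.sum_comm, ← Finset.sum_sub_distrib,
    shiftCount_eq_sum hu hL]
  refine (Finset.abs_sum_le_sum_abs _ _).trans (Finset.sum_le_sum fun v _ => ?_)
  exact abs_card_filter_le_sub_le N (Finset.sum_nonneg fun i _ => sq_nonneg _)

open Classical in
lemma abs_cone_second_difference_le {x u : Fin 3 → ℝ} (hu : ∀ i, |u i| ≤ 1) {r : ℝ} (hr : 4 ≤ r) :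
    |max (r ^ 2 - ∑ i, (x i + u i) ^ 2) 0 + max (r ^ 2 - ∑ i, (x i - u i) ^ 2) 0
        - 2 * max (r ^ 2 - ∑ i, x i ^ 2) 0|
      ≤ 8 * (if ∑ i, x i ^ 2 ≤ r ^ 2 then 1 else 0)
        + 32 * r * ((if ∑ i, x i ^ 2 ≤ (r + 2) ^ 2 then 1 else 0)
            - if ∑ i, x i ^ 2 ≤ (r - 2) ^ 2 then 1 else 0) := by
  have hu2 : ∑ i, u i ^ 2 ≤ 2 ^ 2 := by
    have : ∀ i, u i ^ 2 ≤ 1 := fun i => by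
      have h1 := abs_le.1 (hu i)
      nlinarith
    simp only [Fin.sum_univ_three]
    linarith [this 0, this 1, this 2]
  have hu3 : ∑ i, (- u i) ^ 2 ≤ 2 ^ 2 := by simpa using hu2
  have huv : 0 ≤ ∑ i, u i ^ 2 := Finset.sum_nonneg fun i _ => sq_nonneg _
  have hadd : ∑ i, (x i + u i) ^ 2 + ∑ i, (x i - u i) ^ 2
      = 2 * ∑ i, x i ^ 2 + 2 * ∑ i, u i ^ 2 := by
    simp only [Fin.sum_univ_three]; ring
  have key : ∀ (y w : Fin 3 → ℝ) (s : ℝ), 0 ≤ s → ∑ i, w i ^ 2 ≤ 2 ^ 2 → ∑ i, y i ^ 2 ≤ s ^ 2 →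
      ∑ i, (y i + w i) ^ 2 ≤ (s + 2) ^ 2 := fun y w s hs hw hy =>
    sum_add_sq_le hs (by norm_num) hy hw
  have hr3 : r ^ 2 - (r - 2) ^ 2 ≤ 8 * r := by nlinarith
  have hr4 : r ^ 2 - (r - 4) ^ 2 ≤ 8 * r := by nlinarith
  by_cases h1 : ∑ i, x i ^ 2 ≤ (r - 2) ^ 2
  · have h2 : ∑ i, x i ^ 2 ≤ r ^ 2 := h1.trans (by nlinarith)
    have h3 : ∑ i, x i ^ 2 ≤ (r + 2) ^ 2 := h1.trans (by nlinarith)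
    have h4 := key x u (r - 2) (by linarith) hu2 h1
    have h5 := key x (fun i => - u i) (r - 2) (by linarith) hu3 h1
    simp only [← sub_eq_add_neg, sub_add_cancel] at h4 h5
    rw [if_pos h1, if_pos h2, if_pos h3, max_eq_left (by linarith), max_eq_left (by linarith),
      max_eq_left (by linarith), abs_le]
    constructor <;> linarith
  · rw [if_neg h1]
    have hA : (0 : ℝ) ≤ 8 * (if ∑ i, x i ^ 2 ≤ r ^ 2 then 1 else 0) := by positivity
    by_cases h3 : ∑ i, x i ^ 2 ≤ (r + 2) ^ 2
    · rw [if_pos h3]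
      have b1 : r ^ 2 - ∑ i, (x i + u i) ^ 2 ≤ 8 * r := by
        by_contra hc
        have h4 := key (fun i => x i + u i) (fun i => - u i) (r - 4) (by linarith) hu3
          (by linarith)
        simp only [add_neg_cancel_right] at h4
        exact h1 (h4.trans_eq (by ring))
      have b2 : r ^ 2 - ∑ i, (x i - u i) ^ 2 ≤ 8 * r := by
        by_contra hc
        have h4 := key (fun i => x i - u i) u (r - 4) (by linarith) hu2
          (by linarith)
        simp only [sub_add_cancel] at h4
        exact h1 (h4.trans_eq (by ring))
      have b3 : r ^ 2 - ∑ i, x i ^ 2 ≤ 8 * r := by linarith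
      have c1 := max_le b1 (by linarith : 0 ≤ 8 * r)
      have c2 := max_le b2 (by linarith : 0 ≤ 8 * r)
      have c3 := max_le b3 (by linarith : 0 ≤ 8 * r)
      have d1 := le_max_right (r ^ 2 - ∑ i, (x i + u i) ^ 2) 0
      have d2 := le_max_right (r ^ 2 - ∑ i, (x i - u i) ^ 2) 0
      have d3 := le_max_right (r ^ 2 - ∑ i, x i ^ 2) 0
      rw [abs_le]
      constructor <;> linarith
    · rw [if_neg h3]
      have b1 : r ^ 2 - ∑ i, (x i + u i) ^ 2 ≤ 0 := by
        by_contra hc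
        have h4 := key (fun i => x i + u i) (fun i => - u i) r (by linarith) hu3
          (by linarith)
        simp only [add_neg_cancel_right] at h4
        exact h3 h4
      have b2 : r ^ 2 - ∑ i, (x i - u i) ^ 2 ≤ 0 := by
        by_contra hc
        have h4 := key (fun i => x i - u i) u r (by linarith) hu2 (by linarith)
        simp only [sub_add_cancel] at h4
        exact h3 h4
      have b3 : r ^ 2 - ∑ i, x i ^ 2 ≤ 0 := by
        have : r ^ 2 ≤ (r + 2) ^ 2 := by nlinarith
        linarith [not_le.1 h3]
      rw [max_eq_right b1, max_eq_right b2, max_eq_right b3]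
      simp only [sub_self, add_zero, mul_zero, abs_zero]
      exact hA

open Classical in
lemma abs_sum_cone_sub_le {u : Fin 3 → ℝ} (hu : ∀ i, |u i| ≤ 1) {r : ℝ} (hr : 4 ≤ r) {L : ℕ}
    (hL : r + 3 ≤ L) :
    |∑ v ∈ latticeBox L, max (r ^ 2 - ∑ i, ((v i : ℝ) + u i) ^ 2) 0
      - ∑ v ∈ latticeBox L, max (r ^ 2 - ∑ i, (v i : ℝ) ^ 2) 0| ≤ 60000 * r ^ 3 := by
  have hneg : ∑ v ∈ latticeBox L, max (r ^ 2 - ∑ i, ((v i : ℝ) + u i) ^ 2) 0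
      = ∑ v ∈ latticeBox L, max (r ^ 2 - ∑ i, ((v i : ℝ) - u i) ^ 2) 0 := by
    refine Finset.sum_nbij' (fun v => -v) (fun v => -v) (fun v => neg_mem_latticeBox)
      (fun v => neg_mem_latticeBox) (by simp) (by simp) fun v _ => ?_
    congr 2
    refine Finset.sum_congr rfl fun i _ => ?_
    simp only [Pi.neg_apply, Int.cast_neg]
    ring
  have h2 := Finset.sum_le_sum fun v (_ : v ∈ latticeBox L) =>
    abs_cone_second_difference_le (x := fun i => (v i : ℝ)) hu hr
  have h1 := (Finset.abs_sum_le_sum_abs (fun v : Fin 3 → ℤ =>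
    max (r ^ 2 - ∑ i, ((v i : ℝ) + u i) ^ 2) 0 + max (r ^ 2 - ∑ i, ((v i : ℝ) - u i) ^ 2) 0
        - 2 * max (r ^ 2 - ∑ i, (v i : ℝ) ^ 2) 0) (latticeBox L)).trans h2
  have h0 : ∀ s : ℝ, 0 ≤ s → s ≤ r + 2 → (shiftCount 0 (s ^ 2) : ℝ)
      = ∑ v ∈ latticeBox L, if ∑ i, (v i : ℝ) ^ 2 ≤ s ^ 2 then (1 : ℝ) else 0 := by
    intro s hs hs2
    rw [shiftCount_eq_sum (L := L) (by simp) (by rw [Real.sqrt_sq hs]; linarith)]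
    simp
  simp only [Finset.sum_sub_distrib, Finset.sum_add_distrib, ← Finset.mul_sum, ← hneg] at h1
  rw [← h0 r (by linarith) (by linarith), ← h0 (r + 2) (by linarith) (by linarith),
    ← h0 (r - 2) (by linarith) (by linarith)] at h1
  have a1 := abs_le.1 (abs_shiftCount_sub_ballVol_le (u := 0) (by simp) (by linarith : 1 ≤ r))
  have a2 := abs_le.1 (abs_shiftCount_sub_ballVol_le (u := 0) (by simp) (by linarith : 1 ≤ r + 2))
  have a3 := abs_le.1 (abs_shiftCount_sub_ballVol_le (u := 0) (by simp) (by linarith : 1 ≤ r - 2))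
  rw [ballVol_sq (by linarith)] at a1 a2 a3
  have hπ := Real.pi_lt_d2
  have hπ0 := Real.pi_pos
  have e1 : (shiftCount 0 (r ^ 2) : ℝ) ≤ 700 * r ^ 3 := by
    have : 4 * π / 3 * r ^ 3 ≤ 5 * r ^ 3 := by
      have : 0 ≤ r ^ 3 := by positivity
      nlinarith
    nlinarith [sq_nonneg r]
  have e2 : (shiftCount 0 ((r + 2) ^ 2) : ℝ) - shiftCount 0 ((r - 2) ^ 2) ≤ 3400 * r ^ 2 := by
    have : (r + 2) ^ 3 - (r - 2) ^ 3 ≤ 13 * r ^ 2 := by nlinarith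
    have h3 : 4 * π / 3 * ((r + 2) ^ 3 - (r - 2) ^ 3) ≤ 5 * (13 * r ^ 2) := by
      apply mul_le_mul (by linarith) this _ (by norm_num)
      nlinarith [sq_nonneg r]
    nlinarith [sq_nonneg r]
  have e3 : 32 * r * ((shiftCount 0 ((r + 2) ^ 2) : ℝ) - shiftCount 0 ((r - 2) ^ 2))
      ≤ 32 * r * (3400 * r ^ 2) := by gcongr
  rw [abs_le] at h1 ⊢
  have : 0 ≤ r ^ 3 := by positivity
  constructor <;> nlinarith

lemma abs_sum_shiftCount_sub_sum_le {u : Fin 3 → ℝ} (hu : ∀ i, |u i| ≤ 1) {N : ℕ}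
    (hN : 16 ≤ N) :
    |∑ n ∈ Finset.range N, (shiftCount u n : ℝ) - ∑ n ∈ Finset.range N, (shiftCount 0 n : ℝ)|
      ≤ 62000 * √N ^ 3 := by
  have hr : 4 ≤ √(N : ℝ) := Real.le_sqrt_of_sq_le (by norm_num; exact_mod_cast hN)
  obtain ⟨L, hL⟩ := exists_nat_ge (√(N : ℝ) + 3)
  have h1 := abs_le.1 (abs_sum_cone_sub_le hu hr hL)
  have h2 := abs_le.1 (abs_sum_shiftCount_sub_le hu (N := N) (L := L) (by linarith))
  have h3 := abs_le.1 (abs_sum_shiftCount_sub_le (u := 0) (by simp) (N := N) (L := L)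
    (by linarith))
  simp only [Pi.zero_apply, add_zero] at h3
  have hs : √(N : ℝ) ^ 2 = N := Real.sq_sqrt (Nat.cast_nonneg _)
  rw [hs] at h1
  have h4 : ∀ w : Fin 3 → ℝ, (∀ i, |w i| ≤ 1) → (shiftCount w N : ℝ) ≤ 700 * √(N : ℝ) ^ 3 := by
    intro w hw
    have a1 := abs_le.1 (abs_shiftCount_sub_ballVol_le hw (by linarith : 1 ≤ √(N : ℝ)))
    rw [ballVol_sq (by linarith), hs] at a1
    have hπ := Real.pi_lt_d2
    have : 4 * π / 3 * √(N : ℝ) ^ 3 ≤ 5 * √(N : ℝ) ^ 3 := by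
      gcongr; linarith
    have : (N : ℝ) ≤ √(N : ℝ) ^ 3 := by
      calc (N : ℝ) = √(N : ℝ) ^ 2 := hs.symm
        _ ≤ √(N : ℝ) ^ 3 := pow_le_pow_right₀ (by linarith) (by norm_num)
    linarith
  have h5 := h4 u hu
  have h6 := h4 0 (by simp)
  rw [abs_le]
  constructor <;> linarith

lemma abs_sum_shiftCount_sub_ballVol_le {N : ℕ} (hN : 16 ≤ N) :
    |∑ n ∈ Finset.range N, ((shiftCount 0 n : ℝ) - ballVol n)| ≤ 62000 * √N ^ 3 := by
  have hint : ∫ u in unitCube, ∑ n ∈ Finset.range N, (shiftCount u n : ℝ)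
      = ∑ n ∈ Finset.range N, ballVol n := by
    rw [MeasureTheory.integral_finsetSum _ fun n _ => integrableOn_shiftCount n.cast_nonneg]
    exact Finset.sum_congr rfl fun n _ => integral_shiftCount n.cast_nonneg
  have hi : MeasureTheory.IntegrableOn (fun u => ∑ n ∈ Finset.range N, (shiftCount u n : ℝ))
      unitCube :=
    MeasureTheory.integrable_finsetSum _ fun n _ => integrableOn_shiftCount n.cast_nonneg
  rw [Finset.sum_sub_distrib, ← hint]
  have h1 : ∀ u ∈ unitCube, _ := fun u hu =>
    abs_le.1 (abs_sum_shiftCount_sub_sum_le (abs_le_one_of_mem_unitCube hu) hN)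
  have h2 := setIntegral_unitCube_le
    (c := ∑ n ∈ Finset.range N, (shiftCount 0 n : ℝ) + 62000 * √N ^ 3) hi
    fun u hu => by linarith [(h1 u hu).2]
  have h3 := le_setIntegral_unitCube
    (c := ∑ n ∈ Finset.range N, (shiftCount 0 n : ℝ) - 62000 * √N ^ 3) hi
    fun u hu => by linarith [(h1 u hu).1]
  rw [abs_le]
  constructor <;> linarith

lemma latticeA3_eq_shiftCount (x : ℝ) : latticeA3 x = shiftCount 0 x := by
  let e : (Fin 3 → ℤ) ≃ ℤ × ℤ × ℤ :=
    { toFun := fun v => (v 0, v 1, v 2)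
      invFun := fun p => ![p.1, p.2.1, p.2.2]
      left_inv := fun v => by ext i; fin_cases i <;> rfl
      right_inv := fun p => rfl }
  rw [latticeA3, shiftCount, ← Set.ncard_image_of_injective _ e.injective]
  congr 1
  ext p
  simp only [Set.mem_ofPred_eq, Set.mem_image, Pi.zero_apply, add_zero, Fin.sum_univ_three]
  constructor
  · intro h
    refine ⟨![p.1, p.2.1, p.2.2], ?_, rfl⟩
    change (p.1 : ℝ) ^ 2 + (p.2.1 : ℝ) ^ 2 + (p.2.2 : ℝ) ^ 2 ≤ x
    linarith
  · rintro ⟨v, h, rfl⟩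
    change (v 0 : ℝ) ^ 2 + (v 1 : ℝ) ^ 2 + (v 2 : ℝ) ^ 2 ≤ x
    linarith

lemma latticeP3_eq (x : ℝ) : latticeP3 x = shiftCount 0 x - ballVol x := by
  rw [latticeP3, latticeA3_eq_shiftCount, ballVol]

/-- The mean over integers `n < N` of the discrepancy is `O(√N)`. -/
lemma abs_sum_latticeP3_le {N : ℕ} (hN : 16 ≤ N) :
    |∑ n ∈ Finset.range N, latticeP3 n| ≤ 62000 * √N ^ 3 := by
  simp only [latticeP3_eq]
  exact abs_sum_shiftCount_sub_ballVol_le hN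

/-! ### Sums of three squares in residue classes -/

/-- The sum of the squares of the coordinates of a lattice point. -/
def sumSq (v : Fin 3 → ℤ) : ℕ := ∑ i, (v i).natAbs ^ 2

lemma cast_sumSq_int (v : Fin 3 → ℤ) : (sumSq v : ℤ) = ∑ i, v i ^ 2 := by
  simp [sumSq]

lemma cast_sumSq_real (v : Fin 3 → ℤ) : (sumSq v : ℝ) = ∑ i, (v i : ℝ) ^ 2 := by
  exact_mod_cast congrArg (Int.cast : ℤ → ℝ) (cast_sumSq_int v)

lemma cast_sumSq_zmod (M : ℕ) (v : Fin 3 → ℤ) :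
    (sumSq v : ZMod M) = ∑ i, (v i : ZMod M) ^ 2 := by
  exact_mod_cast congrArg (Int.cast : ℤ → ZMod M) (cast_sumSq_int v)

lemma finite_sumSq_le (X : ℕ) : {v : Fin 3 → ℤ | sumSq v ≤ X}.Finite := by
  refine (finite_sum_sq_le 0 (by simp) X).subset fun v (hv : sumSq v ≤ X) => ?_
  simp only [Set.mem_ofPred_eq, Pi.zero_apply, add_zero]
  rw [← cast_sumSq_real]
  exact_mod_cast hv

/-- The lattice points in the ball of radius `√X`. -/
noncomputable def latticeBall (X : ℕ) : Finset (Fin 3 → ℤ) := (finite_sumSq_le X).toFinset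

lemma mem_latticeBall {X : ℕ} {v : Fin 3 → ℤ} : v ∈ latticeBall X ↔ sumSq v ≤ X := by
  simp [latticeBall]

lemma shiftCount_zero_eq_card (X : ℕ) : shiftCount 0 X = (latticeBall X).card := by
  rw [shiftCount, ← Set.ncard_coe_finset]
  congr 1
  ext v
  simp only [Set.mem_ofPred_eq, Pi.zero_apply, add_zero, Finset.mem_coe, mem_latticeBall]
  rw [← cast_sumSq_real]
  exact_mod_cast Iff.rfl

/-- The number of representations as a sum of three squares. -/
noncomputable def repCount (n : ℕ) : ℕ := ((latticeBall n).filter fun v => sumSq v = n).card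

lemma repCount_eq {n X : ℕ} (h : n ≤ X) :
    repCount n = ((latticeBall X).filter fun v => sumSq v = n).card := by
  rw [repCount]
  congr 1
  ext v
  simp only [Finset.mem_filter, mem_latticeBall]
  omega

lemma shiftCount_zero_succ (n : ℕ) :
    shiftCount 0 ((n + 1 : ℕ) : ℝ) = shiftCount 0 (n : ℝ) + repCount (n + 1) := by
  rw [shiftCount_zero_eq_card, shiftCount_zero_eq_card, repCount,
    ← Finset.card_filter_add_card_filter_not (s := latticeBall (n + 1)) fun v => sumSq v = n + 1,
    add_comm]
  congr 2
  ext v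
  simp only [Finset.mem_filter, mem_latticeBall]
  omega

/-- The number of solutions of `a² + b² + c² = n` modulo `M`. -/
noncomputable def modCount (M : ℕ) [NeZero M] (n : ZMod M) : ℕ :=
  (Finset.univ.filter fun a : Fin 3 → ZMod M => ∑ i, a i ^ 2 = n).card

lemma sum_modCount (M : ℕ) [NeZero M] : ∑ n : ZMod M, modCount M n = M ^ 3 := by
  have := Finset.card_eq_sum_card_fiberwise (s := (Finset.univ : Finset (Fin 3 → ZMod M)))
    (t := Finset.univ) (f := fun a => ∑ i, a i ^ 2) (fun _ _ => Finset.mem_coe.2 (Finset.mem_univ _))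
  simp only [Finset.card_univ, Fintype.card_fun, ZMod.card, Fintype.card_fin] at this
  exact this.symm

lemma sum_range_natCast_zmod {A : Type*} [AddCommMonoid A] (M : ℕ) [NeZero M] (f : ZMod M → A) :
    ∑ n ∈ Finset.range M, f n = ∑ n : ZMod M, f n := by
  refine Finset.sum_bij' (fun n _ => (n : ZMod M)) (fun n _ => n.val) (by simp)
    (fun n _ => Finset.mem_range.2 (ZMod.val_lt n)) ?_ (by simp) (by simp)
  intro n hn
  exact ZMod.val_cast_of_lt (Finset.mem_range.1 hn)

lemma sum_Icc_natCast_zmod {A : Type*} [AddCommMonoid A] (M : ℕ) [NeZero M] (f : ZMod M → A) :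
    ∑ n ∈ Finset.Icc 1 M, f n = ∑ n : ZMod M, f n := by
  rw [← Finset.Ico_add_one_right_eq_Icc, Finset.sum_Ico_eq_sum_range, Nat.add_sub_cancel,
    ← Equiv.sum_comp (Equiv.addLeft 1) f, ← sum_range_natCast_zmod]
  simp

lemma card_latticeBall_residue (M X : ℕ) [NeZero M] (a : Fin 3 → ZMod M) :
    ((latticeBall X).filter fun v => (fun i => (v i : ZMod M)) = a).card
      = shiftCount (fun i => ((a i).val : ℝ) / M) (X / M ^ 2) := by
  have hM : (M : ℝ) ≠ 0 := Nat.cast_ne_zero.2 (NeZero.ne M)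
  rw [shiftCount, ← Set.ncard_coe_finset]
  let g : (Fin 3 → ℤ) → (Fin 3 → ℤ) := fun w i => M * w i + (a i).val
  have hg : Function.Injective g := by
    intro w w' h
    ext i
    have := congrFun h i
    simpa [g, NeZero.ne M] using this
  refine Eq.trans ?_ (Set.ncard_image_of_injective _ hg)
  congr 1
  have hq : ∀ w, sumSq (g w) ≤ X ↔
      ∑ i, ((w i : ℝ) + ((a i).val : ℝ) / M) ^ 2 ≤ (X : ℝ) / M ^ 2 := by
    intro w
    rw [le_div_iff₀ (by positivity), Finset.sum_mul, ← Nat.cast_le (α := ℝ), cast_sumSq_real]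
    refine iff_of_eq (congrArg (· ≤ (X : ℝ)) (Finset.sum_congr rfl fun i _ => ?_))
    simp only [g]
    push_cast
    field_simp
  ext v
  simp only [Finset.mem_coe, Finset.mem_filter, mem_latticeBall, Set.mem_image,
    Set.mem_ofPred_eq]
  constructor
  · rintro ⟨h1, h2⟩
    have : g (fun i => v i / M) = v := by
      ext i
      have h3 : ((a i).val : ℤ) = v i % M := by
        rw [← h2]; exact ZMod.val_intCast (v i)
      simp only [g, h3]
      exact Int.mul_ediv_add_emod (v i) M
    exact ⟨fun i => v i / M, (hq _).1 (by rwa [this]), this⟩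
  · rintro ⟨w, hw, rfl⟩
    refine ⟨(hq w).2 hw, ?_⟩
    ext i
    simp [g]

lemma card_latticeBall_sumSq_residue (M X : ℕ) [NeZero M] (n : ZMod M) :
    ((latticeBall X).filter fun v => (sumSq v : ZMod M) = n).card
      = ∑ a ∈ Finset.univ.filter (fun a : Fin 3 → ZMod M => ∑ i, a i ^ 2 = n),
          shiftCount (fun i => ((a i).val : ℝ) / M) (X / M ^ 2) := by
  rw [Finset.card_eq_sum_card_fiberwise (f := fun v i => (v i : ZMod M))
    (t := Finset.univ.filter fun a : Fin 3 → ZMod M => ∑ i, a i ^ 2 = n)]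
  · refine Finset.sum_congr rfl fun a ha => ?_
    rw [← card_latticeBall_residue, Finset.filter_filter]
    congr 1
    refine Finset.filter_congr fun v _ => ?_
    simp only [and_iff_right_iff_imp]
    rintro rfl
    rw [cast_sumSq_zmod]
    exact (Finset.mem_filter.1 ha).2
  · intro v hv
    simp only [Finset.coe_filter, Set.mem_ofPred_eq, Finset.mem_univ, true_and] at hv ⊢
    rw [← hv.2, cast_sumSq_zmod]

lemma abs_card_sumSq_residue_sub_le {M X : ℕ} [NeZero M] (hX : M ^ 2 ≤ X) (n : ZMod M) :
    |(((latticeBall X).filter fun v => (sumSq v : ZMod M) = n).card : ℝ)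
      - modCount M n * (ballVol X / M ^ 3)| ≤ modCount M n * (600 * (X / M ^ 2)) := by
  have hM : (0 : ℝ) < M := Nat.cast_pos.2 (NeZero.pos M)
  have h1 : ∀ a : Fin 3 → ZMod M,
      |(shiftCount (fun i => ((a i).val : ℝ) / M) (X / M ^ 2) : ℝ) - ballVol X / M ^ 3|
        ≤ 600 * (X / M ^ 2) := by
    intro a
    have hs : (√X / M) ^ 2 = (X : ℝ) / M ^ 2 := by
      rw [div_pow, Real.sq_sqrt X.cast_nonneg]
    have h := abs_shiftCount_sub_ballVol_le (u := fun i => ((a i).val : ℝ) / M) (r := √X / M) ?_ ?_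
    · rw [ballVol_sq (by positivity), hs] at h
      rw [ballVol_eq X.cast_nonneg]
      convert h using 3
      ring
    · intro i
      rw [abs_of_nonneg (by positivity), div_le_one hM]
      exact_mod_cast (ZMod.val_lt (a i)).le
    · rw [one_le_div hM]
      apply Real.le_sqrt_of_sq_le
      exact_mod_cast hX
  rw [card_latticeBall_sumSq_residue, modCount]
  push_cast
  rw [← nsmul_eq_mul, ← nsmul_eq_mul, ← Finset.sum_const, ← Finset.sum_const,
    ← Finset.sum_sub_distrib]
  exact (Finset.abs_sum_le_sum_abs _ _).trans (Finset.sum_le_sum fun a _ => h1 a)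

/-- The number of representations of the integers `kM + j`, `k < K`. -/
lemma sum_repCount_mem_Icc {M K j : ℕ} [NeZero M] (hj : j ∈ Finset.Icc 1 M) :
    ∑ k ∈ Finset.range K, repCount (k * M + j) ≤
        ((latticeBall (K * M)).filter fun v => (sumSq v : ZMod M) = j).card ∧
      ((latticeBall (K * M)).filter fun v => (sumSq v : ZMod M) = j).card ≤
        ∑ k ∈ Finset.range K, repCount (k * M + j) + 1 := by
  obtain ⟨hj1, hj2⟩ := Finset.mem_Icc.1 hj
  have hM := NeZero.pos M
  set S := (latticeBall (K * M)).filter fun v => (sumSq v : ZMod M) = j with hS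
  let U := S.erase 0
  have hU : ∑ k ∈ Finset.range K, repCount (k * M + j) ≤ S.card ∧
      U.card ≤ ∑ k ∈ Finset.range K, repCount (k * M + j) := by
    have hle : ∀ k ∈ Finset.range K, k * M + j ≤ K * M := by
      intro k hk
      have := Nat.mul_le_mul_right M (Nat.succ_le_of_lt (Finset.mem_range.1 hk))
      rw [Nat.succ_mul] at this
      omega
    rw [Finset.sum_congr rfl fun k hk => repCount_eq (hle k hk), ← Finset.card_biUnion]
    · constructor
      · apply Finset.card_le_card
        intro v hv
        simp only [Finset.mem_biUnion, Finset.mem_filter] at hv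
        obtain ⟨k, hk, h1, h2⟩ := hv
        simp [hS, h1, h2]
      · apply Finset.card_le_card
        intro v hv
        simp only [U, hS, Finset.mem_erase, Finset.mem_filter, mem_latticeBall] at hv
        obtain ⟨h0, h1, h2⟩ := hv
        have hpos : 0 < sumSq v := by
          by_contra hc
          apply h0
          have h3 : sumSq v = 0 := by omega
          simp only [sumSq, Finset.sum_eq_zero_iff, Finset.mem_univ, true_imp_iff] at h3
          ext i
          simpa using h3 i
        rw [ZMod.natCast_eq_natCast_iff] at h2
        have hge : j ≤ sumSq v := by
          by_contra hc
          have h3 := (Nat.modEq_iff_dvd' (by omega)).1 h2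
          have := Nat.le_of_dvd (by omega) h3
          omega
        obtain ⟨k, hk⟩ := (Nat.modEq_iff_dvd' hge).1 h2.symm
        have hk' : sumSq v = k * M + j := by rw [mul_comm k M]; omega
        simp only [Finset.mem_biUnion, Finset.mem_filter, mem_latticeBall, Finset.mem_range]
        refine ⟨k, ?_, h1, hk'⟩
        by_contra hc
        have := Nat.mul_le_mul_right M (not_lt.1 hc)
        omega
    · intro k _ k' _ hkk
      rw [Function.onFun, Finset.disjoint_left]
      intro v hv hv'
      simp only [Finset.mem_filter] at hv hv'
      apply hkk
      have : k * M = k' * M := by omega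
      exact Nat.eq_of_mul_eq_mul_right hM this
  refine ⟨hU.1, ?_⟩
  have := Finset.pred_card_le_card_erase (s := S) (a := 0)
  have h2 := hU.2
  simp only [U] at h2
  omega

/-! ### The discrepancy along residue classes -/

lemma ballVol_sub_mem_Icc {a b : ℝ} (ha : 0 ≤ a) (hab : a ≤ b) :
    (b - a) * (2 * π * √a) ≤ ballVol b - ballVol a ∧
      ballVol b - ballVol a ≤ (b - a) * (2 * π * √b) := by
  have hb := ha.trans hab
  rw [ballVol_eq ha, ballVol_eq hb]
  have hs := Real.sqrt_nonneg a
  have hst := Real.sqrt_le_sqrt hab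
  have h1 := Real.sq_sqrt ha
  have h2 := Real.sq_sqrt hb
  set s := √a
  set t := √b
  rw [← h1, ← h2]
  have hπ := Real.pi_pos
  constructor
  · have : 0 ≤ (t - s) ^ 2 * (2 * t + s) := by
      have : 0 ≤ 2 * t + s := by linarith
      positivity
    have := mul_nonneg hπ.le this
    nlinarith
  · have : 0 ≤ (t - s) ^ 2 * (t + 2 * s) := by
      have : 0 ≤ t + 2 * s := by linarith
      positivity
    have := mul_nonneg hπ.le this
    nlinarith

lemma abs_sum_ballVol_sub_le {M K j : ℕ} (hM : 0 < M) (hj : j ≤ M) :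
    |∑ k ∈ Finset.range K, (ballVol ((k * M + j : ℕ) : ℝ) - ballVol ((k * M : ℕ) : ℝ))
      - j * (ballVol ((K * M : ℕ) : ℝ) / M)| ≤ j * (2 * π * √((K * M : ℕ) : ℝ)) := by
  have hM' : (0 : ℝ) < M := Nat.cast_pos.2 hM
  let w : ℕ → ℝ := fun k => 2 * π * √((k * M : ℕ) : ℝ)
  have hw0 : w 0 = 0 := by simp [w]
  have hw : ∑ k ∈ Finset.range K, w (k + 1) = ∑ k ∈ Finset.range K, w k + w K := by
    rw [← Finset.sum_range_succ, Finset.sum_range_succ', hw0, add_zero]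
  have hmono : ∀ k, w k ≤ w (k + 1) := fun k => by
    simp only [w]; gcongr; omega
  have hstep : ∀ i ≤ M, ∀ k, (i : ℝ) * w k ≤
      ballVol ((k * M + i : ℕ) : ℝ) - ballVol ((k * M : ℕ) : ℝ) ∧
      ballVol ((k * M + i : ℕ) : ℝ) - ballVol ((k * M : ℕ) : ℝ) ≤ i * w (k + 1) := by
    intro i hi k
    have h := ballVol_sub_mem_Icc (Nat.cast_nonneg (k * M))
      (Nat.cast_le.2 (Nat.le_add_right (k * M) i))
    have h2 : ((k * M + i : ℕ) : ℝ) - ((k * M : ℕ) : ℝ) = i := by push_cast; ring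
    rw [h2] at h
    refine ⟨h.1, h.2.trans ?_⟩
    simp only [w]
    gcongr
    rw [Nat.succ_mul]; omega
  have htel : ∑ k ∈ Finset.range K, (ballVol ((k * M + M : ℕ) : ℝ) - ballVol ((k * M : ℕ) : ℝ))
      = ballVol ((K * M : ℕ) : ℝ) := by
    have := Finset.sum_range_sub (fun k => ballVol ((k * M : ℕ) : ℝ)) K
    simp only [Nat.succ_mul] at this
    rw [this]
    simp [ballVol]
  have hl : ∀ i ≤ M, (i : ℝ) * ∑ k ∈ Finset.range K, w k ≤
      ∑ k ∈ Finset.range K, (ballVol ((k * M + i : ℕ) : ℝ) - ballVol ((k * M : ℕ) : ℝ)) := by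
    intro i hi
    rw [Finset.mul_sum]
    exact Finset.sum_le_sum fun k _ => (hstep i hi k).1
  have hu : ∀ i ≤ M,
      ∑ k ∈ Finset.range K, (ballVol ((k * M + i : ℕ) : ℝ) - ballVol ((k * M : ℕ) : ℝ)) ≤
      (i : ℝ) * (∑ k ∈ Finset.range K, w k + w K) := by
    intro i hi
    rw [← hw, Finset.mul_sum]
    exact Finset.sum_le_sum fun k _ => (hstep i hi k).2
  have h1 := hl j hj
  have h2 := hu j hj
  have h3 := hl M le_rfl
  have h4 := hu M le_rfl
  rw [htel] at h3 h4
  rw [← le_div_iff₀' hM'] at h3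
  rw [← div_le_iff₀' hM'] at h4
  have hj0 : (0 : ℝ) ≤ j := Nat.cast_nonneg _
  have h5 := mul_le_mul_of_nonneg_left h3 hj0
  have h6 := mul_le_mul_of_nonneg_left h4 hj0
  change |_| ≤ j * w K
  rw [abs_le]
  constructor <;> linarith

lemma latticeP3_add (n j : ℕ) :
    latticeP3 ((n + j : ℕ) : ℝ) = latticeP3 (n : ℝ) + ∑ i ∈ Finset.Icc 1 j, (repCount (n + i) : ℝ)
      - (ballVol ((n + j : ℕ) : ℝ) - ballVol (n : ℝ)) := by
  have h : (shiftCount 0 ((n + j : ℕ) : ℝ) : ℝ)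
      = shiftCount 0 (n : ℝ) + ∑ i ∈ Finset.Icc 1 j, (repCount (n + i) : ℝ) := by
    induction j with
    | zero => simp
    | succ j ih =>
      rw [← add_assoc, shiftCount_zero_succ, Nat.cast_add, ih,
        Finset.sum_Icc_succ_top (by omega)]
      ring_nf
  rw [latticeP3_eq, latticeP3_eq, h]
  ring

/-- The summatory function of the deviation of the density of `a² + b² + c² ≡ n mod M`. -/
noncomputable def densitySum (M : ℕ) [NeZero M] (j : ℕ) : ℝ :=
  ∑ i ∈ Finset.Icc 1 j, ((modCount M i : ℝ) / M ^ 2 - 1)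

/-- The summatory density deviation, normalised to have mean zero. -/
noncomputable def densityDev (M : ℕ) [NeZero M] (j : ℕ) : ℝ :=
  densitySum M j - (∑ i ∈ Finset.Icc 1 M, densitySum M i) / M

lemma abs_sum_latticeP3_sub_le {M j : ℕ} [NeZero M] (hj : j ≤ M) :
    |∑ k ∈ Finset.range (M ^ 3), latticeP3 ((k * M + j : ℕ) : ℝ)
        - ∑ k ∈ Finset.range (M ^ 3), latticeP3 ((k * M : ℕ) : ℝ)
        - 4 * π / 3 * M ^ 5 * densitySum M j| ≤ 608 * (M : ℝ) ^ 5 := by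
  have hM0 : 0 < M := NeZero.pos M
  have hM : (1 : ℝ) ≤ M := by exact_mod_cast hM0
  have hX : ((M ^ 3 * M : ℕ) : ℝ) = ((M : ℝ) ^ 2) ^ 2 := by push_cast; ring
  have hV : ballVol ((M ^ 3 * M : ℕ) : ℝ) = 4 * π / 3 * M ^ 6 := by
    rw [hX, ballVol_sq (by positivity)]; ring
  have hb := abs_sum_ballVol_sub_le (K := M ^ 3) hM0 hj
  rw [hV, hX, Real.sqrt_sq (by positivity)] at hb
  have hR : ∀ i ∈ Finset.Icc 1 M, |∑ k ∈ Finset.range (M ^ 3), (repCount (k * M + i) : ℝ)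
      - modCount M i * (4 * π / 3 * M ^ 3)| ≤ (modCount M i : ℝ) * (600 * (M : ℝ) ^ 2) + 1 := by
    intro i hi
    obtain ⟨h1, h2⟩ := sum_repCount_mem_Icc (K := M ^ 3) hi
    have h3 := abs_card_sumSq_residue_sub_le (M := M) (X := M ^ 3 * M)
      (by nlinarith [Nat.one_le_iff_ne_zero.2 hM0.ne', Nat.pow_le_pow_right hM0 (by norm_num : 2 ≤ 4)]) i
    rw [hV, hX] at h3
    have e1 : 4 * π / 3 * (M : ℝ) ^ 6 / M ^ 3 = 4 * π / 3 * M ^ 3 := by field_simp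
    have e2 : ((M : ℝ) ^ 2) ^ 2 / M ^ 2 = M ^ 2 := by field_simp
    rw [e1, e2] at h3
    have h1' : ((∑ k ∈ Finset.range (M ^ 3), repCount (k * M + i) : ℕ) : ℝ) ≤ _ :=
      Nat.cast_le.2 h1
    have h2' := Nat.cast_le (α := ℝ).2 h2
    push_cast at h1' h2'
    rw [abs_le] at h3 ⊢
    constructor <;> linarith
  have hsum : ∑ i ∈ Finset.Icc 1 j, (modCount M i : ℝ) ≤ M ^ 3 := by
    have h1 := sum_Icc_natCast_zmod M (modCount M)
    rw [sum_modCount] at h1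
    have h2 : ∑ i ∈ Finset.Icc 1 j, modCount M i ≤ ∑ i ∈ Finset.Icc 1 M, modCount M i :=
      Finset.sum_le_sum_of_subset (Finset.Icc_subset_Icc_right hj)
    rw [h1] at h2
    exact_mod_cast h2
  have hR2 : |∑ i ∈ Finset.Icc 1 j, (∑ k ∈ Finset.range (M ^ 3), (repCount (k * M + i) : ℝ)
      - modCount M i * (4 * π / 3 * M ^ 3))| ≤ 601 * (M : ℝ) ^ 5 := by
    have hsub : Finset.Icc 1 j ⊆ Finset.Icc 1 M := Finset.Icc_subset_Icc_right hj
    refine ((Finset.abs_sum_le_sum_abs _ _).trans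
      (Finset.sum_le_sum fun i hi => hR i (hsub hi))).trans ?_
    rw [Finset.sum_add_distrib, ← Finset.sum_mul]
    have h1 : (∑ i ∈ Finset.Icc 1 j, (1 : ℝ)) ≤ M ^ 5 := by
      simp only [Finset.sum_const, Nat.card_Icc, nsmul_eq_mul, mul_one]
      calc ((j + 1 - 1 : ℕ) : ℝ) ≤ M := by exact_mod_cast hj
        _ ≤ M ^ 5 := le_self_pow₀ hM (by norm_num)
    nlinarith [mul_le_mul_of_nonneg_right hsum (by positivity : (0 : ℝ) ≤ 600 * M ^ 2)]
  have hjw : (j : ℝ) * (2 * π * M ^ 2) ≤ 7 * (M : ℝ) ^ 5 := by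
    have : (j : ℝ) ≤ M := by exact_mod_cast hj
    have hπ := Real.pi_lt_d2
    calc (j : ℝ) * (2 * π * M ^ 2) ≤ (M : ℝ) * (7 * (M : ℝ) ^ 2) := by gcongr; linarith
      _ = 7 * (M : ℝ) ^ 3 := by ring
      _ ≤ 7 * (M : ℝ) ^ 5 := by gcongr; norm_num
  have key : ∑ k ∈ Finset.range (M ^ 3), latticeP3 ((k * M + j : ℕ) : ℝ)
        - ∑ k ∈ Finset.range (M ^ 3), latticeP3 ((k * M : ℕ) : ℝ)
        - 4 * π / 3 * M ^ 5 * densitySum M j =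
      ∑ i ∈ Finset.Icc 1 j, (∑ k ∈ Finset.range (M ^ 3), (repCount (k * M + i) : ℝ)
        - modCount M i * (4 * π / 3 * M ^ 3)) -
      (∑ k ∈ Finset.range (M ^ 3), (ballVol ((k * M + j : ℕ) : ℝ) - ballVol ((k * M : ℕ) : ℝ))
        - j * (4 * π / 3 * M ^ 6 / M)) := by
    simp only [latticeP3_add, Finset.sum_add_distrib, Finset.sum_sub_distrib, densitySum,
      ← Finset.sum_mul, ← Finset.sum_div]
    rw [Finset.sum_comm]
    simp only [Finset.sum_const, Nat.card_Icc, nsmul_eq_mul, mul_one, Nat.add_sub_cancel]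
    field_simp
    ring
  rw [key]
  refine (abs_sub _ _).trans ?_
  linarith

lemma sum_sum_latticeP3 (M K : ℕ) :
    ∑ j ∈ Finset.Icc 1 M, ∑ k ∈ Finset.range K, latticeP3 ((k * M + j : ℕ) : ℝ)
      = ∑ n ∈ Finset.range (K * M + 1), latticeP3 n - latticeP3 0 := by
  rw [Finset.sum_range_succ']
  simp only [Nat.cast_zero, add_sub_cancel_right]
  rw [Finset.sum_comm]
  induction K with
  | zero => simp
  | succ K ih =>
    rw [Finset.sum_range_succ, ih, Nat.succ_mul, Finset.sum_range_add,
      ← Finset.Ico_add_one_right_eq_Icc, Finset.sum_Ico_eq_sum_range, Nat.add_sub_cancel]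
    congr 1
    refine Finset.sum_congr rfl fun i _ => ?_
    congr 2
    ring

/-- The sum of the discrepancy over a residue class is governed by `densityDev`. -/
lemma abs_sum_latticeP3_residue_le {M j : ℕ} [NeZero M] (hM2 : 2 ≤ M) (hj : j ≤ M) :
    |∑ k ∈ Finset.range (M ^ 3), latticeP3 ((k * M + j : ℕ) : ℝ)
        - 4 * π / 3 * M ^ 5 * densityDev M j| ≤ 10 ^ 6 * (M : ℝ) ^ 5 := by
  have hM0 : 0 < M := NeZero.pos M
  have hM : (2 : ℝ) ≤ M := by exact_mod_cast hM2
  set P0 := ∑ k ∈ Finset.range (M ^ 3), latticeP3 ((k * M : ℕ) : ℝ)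
  have h1 := sum_sum_latticeP3 M (M ^ 3)
  have h2 : |∑ n ∈ Finset.range (M ^ 3 * M + 1), latticeP3 n| ≤ 62000 * (8 * (M : ℝ) ^ 6) := by
    refine (abs_sum_latticeP3_le ?_).trans ?_
    · have := Nat.pow_le_pow_left hM2 4
      rw [← pow_succ, show 3 + 1 = 4 from rfl]; omega
    · have : √((M ^ 3 * M + 1 : ℕ) : ℝ) ≤ 2 * M ^ 2 := by
        apply Real.sqrt_le_iff.2 ⟨by positivity, ?_⟩
        push_cast
        nlinarith [pow_le_pow_left₀ (by norm_num) hM 4]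
      calc 62000 * √((M ^ 3 * M + 1 : ℕ) : ℝ) ^ 3 ≤ 62000 * (2 * M ^ 2) ^ 3 := by gcongr
        _ = _ := by ring
  have h3 : latticeP3 0 = 1 := by
    rw [latticeP3_eq]
    have : shiftCount 0 0 = 1 := by
      have h := shiftCount_zero_eq_card 0
      rw [Nat.cast_zero] at h
      rw [h, Finset.card_eq_one]
      refine ⟨0, ?_⟩
      ext v
      simp only [mem_latticeBall, Finset.mem_singleton, Nat.le_zero, sumSq,
        Finset.sum_eq_zero_iff, Finset.mem_univ, true_imp_iff]
      simp [funext_iff]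
    rw [this]; simp [ballVol]
  have h4 : |∑ i ∈ Finset.Icc 1 M, (∑ k ∈ Finset.range (M ^ 3), latticeP3 ((k * M + i : ℕ) : ℝ)
        - P0 - 4 * π / 3 * M ^ 5 * densitySum M i)| ≤ 608 * (M : ℝ) ^ 6 := by
    refine ((Finset.abs_sum_le_sum_abs _ _).trans (Finset.sum_le_sum fun i hi =>
      abs_sum_latticeP3_sub_le (Finset.mem_Icc.1 hi).2)).trans_eq ?_
    simp only [Finset.sum_const, Nat.card_Icc, nsmul_eq_mul, Nat.add_sub_cancel]
    ring
  simp only [Finset.sum_sub_distrib, ← Finset.mul_sum] at h4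
  rw [h1, h3] at h4
  simp only [Finset.sum_const, Nat.card_Icc, nsmul_eq_mul, Nat.add_sub_cancel] at h4
  have h5 := abs_le.1 (abs_sum_latticeP3_sub_le hj)
  set D := ∑ i ∈ Finset.Icc 1 M, densitySum M i with hD
  have h6 : |P0 + 4 * π / 3 * M ^ 5 * (D / M)| ≤ 496609 * (M : ℝ) ^ 5 := by
    have e : M * (P0 + 4 * π / 3 * M ^ 5 * (D / M)) = M * P0 + 4 * π / 3 * M ^ 5 * D := by
      field_simp
    have hp : (0 : ℝ) < M := by linarith
    have h7 : |(M : ℝ) * (P0 + 4 * π / 3 * M ^ 5 * (D / M))| ≤ 496609 * (M : ℝ) ^ 6 := by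
      rw [e]
      have h1le : (1 : ℝ) ≤ M ^ 6 := one_le_pow₀ (by linarith)
      rw [abs_le] at h2 h4 ⊢
      constructor <;> linarith
    rw [abs_mul, abs_of_pos hp] at h7
    refine le_of_mul_le_mul_left (h7.trans_eq ?_) hp
    ring
  rw [densityDev]
  rw [abs_le] at h6 ⊢
  have hM5 : (0 : ℝ) ≤ M ^ 5 := by positivity
  have e2 : 4 * π / 3 * M ^ 5 * (densitySum M j - D / M)
    = 4 * π / 3 * M ^ 5 * densitySum M j - 4 * π / 3 * M ^ 5 * (D / M) := by ring
  rw [e2]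
  constructor <;> linarith

lemma exists_latticeP3_ge {M j : ℕ} [NeZero M] (hM2 : 2 ≤ M) (hj : j ≤ M) :
    ∃ n : ℕ, n ≤ M ^ 4 ∧ (4 * π / 3 * densityDev M j - 10 ^ 6) * M ^ 2 ≤ latticeP3 n := by
  have h := (abs_le.1 (abs_sum_latticeP3_residue_le hM2 hj)).1
  have hM0 : 0 < M := NeZero.pos M
  by_contra! hc
  have hlt : ∑ k ∈ Finset.range (M ^ 3), latticeP3 ((k * M + j : ℕ) : ℝ)
      < ∑ k ∈ Finset.range (M ^ 3), (4 * π / 3 * densityDev M j - 10 ^ 6) * (M : ℝ) ^ 2 := by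
    refine Finset.sum_lt_sum_of_nonempty ⟨0, by simp [hM0]⟩ fun k hk => hc _ ?_
    have := Nat.mul_le_mul_right M (Nat.succ_le_of_lt (Finset.mem_range.1 hk))
    rw [Nat.succ_mul, ← pow_succ, show 3 + 1 = 4 from rfl] at this
    omega
  simp only [Finset.sum_const, Finset.card_range, nsmul_eq_mul, Nat.cast_pow] at hlt
  nlinarith

lemma exists_latticeP3_le {M j : ℕ} [NeZero M] (hM2 : 2 ≤ M) (hj : j ≤ M) :
    ∃ n : ℕ, n ≤ M ^ 4 ∧ latticeP3 n ≤ (4 * π / 3 * densityDev M j + 10 ^ 6) * M ^ 2 := by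
  have h := (abs_le.1 (abs_sum_latticeP3_residue_le hM2 hj)).2
  have hM0 : 0 < M := NeZero.pos M
  by_contra! hc
  have hlt : ∑ k ∈ Finset.range (M ^ 3), (4 * π / 3 * densityDev M j + 10 ^ 6) * (M : ℝ) ^ 2
      < ∑ k ∈ Finset.range (M ^ 3), latticeP3 ((k * M + j : ℕ) : ℝ) := by
    refine Finset.sum_lt_sum_of_nonempty ⟨0, by simp [hM0]⟩ fun k hk => hc _ ?_
    have := Nat.mul_le_mul_right M (Nat.succ_le_of_lt (Finset.mem_range.1 hk))
    rw [Nat.succ_mul, ← pow_succ, show 3 + 1 = 4 from rfl] at this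
    omega
  simp only [Finset.sum_const, Finset.card_range, nsmul_eq_mul, Nat.cast_pow] at hlt
  nlinarith

/-! ### Counting solutions modulo odd squarefree integers -/

lemma squarefree_odd_induction {P : ℕ → Prop} (one : P 1)
    (prime_mul : ∀ p m : ℕ, p.Prime → p ≠ 2 → Squarefree m → Odd m → p.Coprime m → P m → P (p * m))
    (n : ℕ) (hn : Squarefree n) (hodd : Odd n) : P n := by
  induction n using induction_on_primes with
  | zero => exact absurd hn not_squarefree_zero
  | one => exact one
  | prime_mul p m hp ih =>
    have hm := Squarefree.of_mul_right hn
    obtain ⟨h1, h2⟩ := Nat.odd_mul.1 hodd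
    refine prime_mul p m hp ?_ hm h2 (Nat.coprime_of_squarefree_mul hn) (ih hm h2)
    rintro rfl
    exact absurd h1 (by decide)

lemma sum_divisors_prime_mul {A : Type*} [AddCommMonoid A] {p m : ℕ} (hp : p.Prime)
    (hpm : p.Coprime m) (h : ℕ → A) :
    ∑ d ∈ (p * m).divisors, h d = ∑ d ∈ m.divisors, h d + ∑ d ∈ m.divisors, h (p * d) := by
  have h1 : (p * m).divisors = m.divisors ∪ m.divisors.image (p * ·) := by
    ext d
    simp only [Finset.mem_union, Finset.mem_image, Nat.mem_divisors]
    constructor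
    · rintro ⟨hd, h0⟩
      have hm0 : m ≠ 0 := right_ne_zero_of_mul h0
      by_cases hpd : p ∣ d
      · obtain ⟨e, rfl⟩ := hpd
        exact Or.inr ⟨e, ⟨Nat.dvd_of_mul_dvd_mul_left hp.pos hd, hm0⟩, rfl⟩
      · exact Or.inl ⟨((hp.coprime_iff_not_dvd.2 hpd).symm).dvd_of_dvd_mul_left hd, hm0⟩
    · rintro (⟨hd, h0⟩ | ⟨e, ⟨he, h0⟩, rfl⟩)
      · exact ⟨dvd_mul_of_dvd_right hd p, mul_ne_zero hp.ne_zero h0⟩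
      · exact ⟨Nat.mul_dvd_mul_left p he, mul_ne_zero hp.ne_zero h0⟩
  rw [h1, Finset.sum_union, Finset.sum_image fun a _ b _ hab => Nat.eq_of_mul_eq_mul_left hp.pos hab]
  rw [Finset.disjoint_left]
  intro d hd hd'
  obtain ⟨e, -, rfl⟩ := Finset.mem_image.1 hd'
  exact hp.coprime_iff_not_dvd.1 hpm (dvd_trans (dvd_mul_right p e) (Nat.dvd_of_mem_divisors hd))

lemma modCount_mul {m n : ℕ} [NeZero m] [NeZero n] [NeZero (m * n)] (h : m.Coprime n) (k : ℤ) :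
    modCount (m * n) k = modCount m k * modCount n k := by
  let e := ZMod.chineseRemainder h
  rw [modCount, modCount, modCount, ← Finset.card_product]
  have he : ∀ a : Fin 3 → ZMod (m * n), ∑ i, a i ^ 2 = (k : ZMod (m * n)) ↔
      ∑ i, (e (a i)).1 ^ 2 = (k : ZMod m) ∧ ∑ i, (e (a i)).2 ^ 2 = (k : ZMod n) := by
    intro a
    rw [← e.injective.eq_iff, map_intCast, map_sum, Prod.ext_iff, Prod.fst_sum, Prod.snd_sum]
    simp
  refine Finset.card_nbij' (fun a => (fun i => (e (a i)).1, fun i => (e (a i)).2))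
    (fun b i => e.symm (b.1 i, b.2 i)) ?_ ?_ ?_ ?_
  · intro a ha
    simpa [he] using ha
  · intro b hb
    simpa [he] using hb
  · intro a _
    simp
  · intro b _
    simp

section PrimeField

variable {p : ℕ} [Fact p.Prime]

lemma sum_comp_sq (hp : p ≠ 2) (f : ZMod p → ℤ) :
    ∑ a : ZMod p, f (a ^ 2) = ∑ x : ZMod p, (quadraticChar (ZMod p) x + 1) * f x := by
  have h2 : ringChar (ZMod p) ≠ 2 := by rwa [ZMod.ringChar_zmod_n]
  rw [← Finset.sum_fiberwise' Finset.univ (fun a : ZMod p => a ^ 2) f]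
  refine Finset.sum_congr rfl fun x _ => ?_
  rw [Finset.sum_const, nsmul_eq_mul, ← quadraticChar_card_sqrts h2]
  congr 3
  ext a
  simp

lemma sum_quadraticChar_mul_sub (hp : p ≠ 2) (m : ZMod p) :
    ∑ y : ZMod p, quadraticChar (ZMod p) y * quadraticChar (ZMod p) (m - y)
      = quadraticChar (ZMod p) (-1) * ((if m = 0 then (p : ℤ) else 0) - 1) := by
  have h2 : ringChar (ZMod p) ≠ 2 := by rwa [ZMod.ringChar_zmod_n]
  split_ifs with hm
  · subst hm
    have : ∀ y : ZMod p, quadraticChar (ZMod p) y * quadraticChar (ZMod p) (0 - y)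
        = quadraticChar (ZMod p) (-1) * (if y = 0 then 0 else 1) := by
      intro y
      rw [zero_sub, ← neg_one_mul, map_mul, mul_left_comm]
      split_ifs with hy
      · simp [hy]
      · rw [← sq, quadraticChar_sq_one hy]
    rw [Finset.sum_congr rfl fun y _ => this y, ← Finset.mul_sum]
    congr 1
    have h3 : ∑ y : ZMod p, (if y = 0 then (0 : ℤ) else 1)
        = ∑ y : ZMod p, (1 - if y = 0 then (1 : ℤ) else 0) :=
      Finset.sum_congr rfl fun y _ => by split_ifs <;> rfl
    rw [h3, Finset.sum_sub_distrib]
    simp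
  · have hj := jacobiSum_nontrivial_inv (quadraticChar_ne_one h2)
    rw [(quadraticChar_isQuadratic (ZMod p)).inv, jacobiSum] at hj
    rw [zero_sub, mul_neg_one, ← hj, ← Equiv.sum_comp (Equiv.mulLeft₀ m hm)]
    refine Finset.sum_congr rfl fun y _ => ?_
    simp only [Equiv.mulLeft₀_apply]
    rw [show m - m * y = m * (1 - y) by ring, map_mul, map_mul, mul_mul_mul_comm, ← sq,
      quadraticChar_sq_one hm, one_mul]

lemma modCount_prime (hp : p ≠ 2) (n : ZMod p) :
    (modCount p n : ℤ) = p ^ 2 + p * quadraticChar (ZMod p) (-n) := by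
  have h2 : ringChar (ZMod p) ≠ 2 := by rwa [ZMod.ringChar_zmod_n]
  have h0 : ∑ a, quadraticChar (ZMod p) a = 0 := quadraticChar_sum_zero h2
  have hs : ∀ c : ZMod p, ∑ y : ZMod p, quadraticChar (ZMod p) (c - y) = 0 := by
    intro c
    rw [← h0]
    exact Equiv.sum_comp (Equiv.subLeft c) _
  have h1 : (modCount p n : ℤ) = ∑ a : ZMod p, ∑ b : ZMod p,
      (quadraticChar (ZMod p) (n - a ^ 2 - b ^ 2) + 1) := by
    have hc : modCount p n = ∑ a : ZMod p, ∑ b : ZMod p,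
        (Finset.univ.filter fun c : ZMod p => c ^ 2 = n - a ^ 2 - b ^ 2).card := by
      simp only [modCount, Finset.card_filter]
      rw [← (Fin.consEquiv fun _ : Fin 3 => ZMod p).sum_comp, Fintype.sum_prod_type]
      refine Finset.sum_congr rfl fun a _ => ?_
      rw [← (Fin.consEquiv fun _ : Fin 2 => ZMod p).sum_comp, Fintype.sum_prod_type]
      refine Finset.sum_congr rfl fun b _ => ?_
      rw [← (Equiv.funUnique (Fin 1) (ZMod p)).symm.sum_comp]
      refine Finset.sum_congr rfl fun c _ => ?_
      congr 1
      rw [Fin.sum_univ_three, eq_iff_iff]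
      change a ^ 2 + b ^ 2 + c ^ 2 = n ↔ c ^ 2 = n - a ^ 2 - b ^ 2
      constructor <;> intro h <;> linear_combination h
    rw [hc]
    push_cast
    refine Finset.sum_congr rfl fun a _ => Finset.sum_congr rfl fun b _ => ?_
    rw [← quadraticChar_card_sqrts h2]
    congr 2
    ext c
    simp
  rw [h1, sum_comp_sq hp fun x => ∑ b : ZMod p, (quadraticChar (ZMod p) (n - x - b ^ 2) + 1)]
  have h3 : ∀ x : ZMod p, ∑ b : ZMod p, (quadraticChar (ZMod p) (n - x - b ^ 2) + 1)
      = quadraticChar (ZMod p) (-1) * ((if n - x = 0 then (p : ℤ) else 0) - 1) + p := by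
    intro x
    rw [sum_comp_sq hp fun y => quadraticChar (ZMod p) (n - x - y) + 1,
      ← sum_quadraticChar_mul_sub hp]
    simp only [add_mul, mul_add, Finset.sum_add_distrib, mul_one, one_mul, h0, hs]
    simp
  simp only [h3]
  have h4 : ∑ x : ZMod p, quadraticChar (ZMod p) x * (if n - x = 0 then (p : ℤ) else 0)
      = p * quadraticChar (ZMod p) n := by
    simp [sub_eq_zero, mul_comm]
  have h5 : ∑ x : ZMod p, (if n - x = 0 then (p : ℤ) else 0) = p := by
    simp [sub_eq_zero]
  have h6 : ∑ x : ZMod p, (quadraticChar (ZMod p) x + 1)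
      * (quadraticChar (ZMod p) (-1) * ((if n - x = 0 then (p : ℤ) else 0) - 1) + p)
    = ∑ x : ZMod p, (quadraticChar (ZMod p) (-1) *
        (quadraticChar (ZMod p) x * (if n - x = 0 then (p : ℤ) else 0))
      + (p - quadraticChar (ZMod p) (-1)) * quadraticChar (ZMod p) x
      + quadraticChar (ZMod p) (-1) * (if n - x = 0 then (p : ℤ) else 0)
      + (p - quadraticChar (ZMod p) (-1))) :=
    Finset.sum_congr rfl fun x _ => by ring
  rw [h6]
  simp only [Finset.sum_add_distrib, ← Finset.mul_sum, h0, h4, h5]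
  simp only [Finset.sum_const, Finset.card_univ, ZMod.card, nsmul_eq_mul]
  rw [← neg_one_mul n, map_mul]
  ring

end PrimeField

/-- The number of solutions of `a² + b² + c² ≡ k` modulo an odd squarefree `M`. -/
lemma modCount_eq_sum_divisors (M : ℕ) [NeZero M] (hM : Squarefree M) (hodd : Odd M) (k : ℤ) :
    (modCount M k : ℝ) = M ^ 2 * ∑ d ∈ M.divisors, (jacobiSym (-k) d : ℝ) / d := by
  suffices h : ∀ h0 : NeZero M,
      (modCount M k : ℝ) = M ^ 2 * ∑ d ∈ M.divisors, (jacobiSym (-k) d : ℝ) / d from h _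
  refine squarefree_odd_induction (P := fun M => ∀ h0 : NeZero M,
      (modCount M k : ℝ) = M ^ 2 * ∑ d ∈ M.divisors, (jacobiSym (-k) d : ℝ) / d) ?_ ?_ M hM hodd
  · intro _
    simp [modCount, eq_iff_true_of_subsingleton]
  · intro p m hp hp2 hm hmodd hpm ih h0
    have : NeZero m := ⟨hm.ne_zero⟩
    have : Fact p.Prime := ⟨hp⟩
    have h1 : (modCount p k : ℝ) = p ^ 2 + p * jacobiSym (-k) p := by
      have h := modCount_prime hp2 (k : ZMod p)
      rw [← jacobiSym.legendreSym.to_jacobiSym, legendreSym]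
      have h' := congrArg (Int.cast : ℤ → ℝ) h
      push_cast at h' ⊢
      exact h'
    rw [modCount_mul hpm, Nat.cast_mul, ih, h1, sum_divisors_prime_mul hp hpm]
    have h2 : ∑ d ∈ m.divisors, (jacobiSym (-k) (p * d) : ℝ) / ((p * d : ℕ) : ℝ)
        = jacobiSym (-k) p / p * ∑ d ∈ m.divisors, (jacobiSym (-k) d : ℝ) / d := by
      rw [Finset.mul_sum]
      refine Finset.sum_congr rfl fun d hd => ?_
      have : NeZero d := ⟨(Nat.pos_of_mem_divisors hd).ne'⟩
      rw [jacobiSym.mul_right]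
      push_cast
      rw [mul_div_mul_comm]
    rw [h2]
    have : (p : ℝ) ≠ 0 := Nat.cast_ne_zero.2 hp.ne_zero
    push_cast
    field_simp

/-! ### Half-period and first-moment sums of Jacobi symbols -/

lemma sum_range_double_succ {A : Type*} [AddCommMonoid A] (g : ℕ → A) (h : ℕ) :
    ∑ n ∈ Finset.range (2 * h + 1), g n
      = ∑ m ∈ Finset.range (h + 1), g (2 * m) + ∑ m ∈ Finset.range h, g (2 * m + 1) := by
  induction h with
  | zero => simp
  | succ h ih =>
    rw [show 2 * (h + 1) + 1 = 2 * h + 1 + 1 + 1 by ring, Finset.sum_range_succ,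
      Finset.sum_range_succ, ih, Finset.sum_range_succ (fun m => g (2 * m)) (h + 1),
      Finset.sum_range_succ (fun m => g (2 * m + 1)) h,
      show 2 * (h + 1) = 2 * h + 1 + 1 by ring]
    abel

lemma sum_range_odd_sub {A : Type*} [AddCommMonoid A] (g : ℤ → A) (h : ℕ) :
    ∑ n ∈ Finset.range (2 * h + 1), g n
      = ∑ m ∈ Finset.range (h + 1), g (2 * m)
        + ∑ m ∈ Finset.range h, g ((2 * h + 1 : ℕ) - 2 * (m + 1 : ℕ)) := by
  rw [sum_range_double_succ fun n => g n]
  congr 1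
  rw [← Finset.sum_range_reflect]
  refine Finset.sum_congr rfl fun m hm => ?_
  have := Finset.mem_range.1 hm
  congr 1
  omega

lemma sum_range_fold {A : Type*} [AddCommMonoid A] (g : ℤ → A) (h : ℕ) :
    ∑ n ∈ Finset.range (2 * h + 1), g n
      = ∑ m ∈ Finset.range (h + 1), g m
        + ∑ m ∈ Finset.range h, g ((2 * h + 1 : ℕ) - (m + 1 : ℕ)) := by
  rw [show 2 * h + 1 = h + 1 + h by ring, Finset.sum_range_add]
  congr 1
  rw [← Finset.sum_range_reflect]
  refine Finset.sum_congr rfl fun m hm => ?_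
  have := Finset.mem_range.1 hm
  congr 1
  omega

/-- For an odd periodic function multiplicative at `2`, the half-period sum in terms of the first
moment. -/
lemma sum_half_period {f : ℤ → ℝ} {h : ℕ} {χ : ℝ} (hper : ∀ n, f ((2 * h + 1 : ℕ) + n) = f n)
    (hodd : ∀ n, f (-n) = -f n) (h2 : ∀ n, f (2 * n) = χ * f n) (hχ : χ ^ 2 = 1) :
    ((2 * h + 1 : ℕ) : ℝ) * ∑ n ∈ Finset.range (h + 1), f n
      = -(2 - χ) * ∑ n ∈ Finset.range (2 * h + 1), (n : ℝ) * f n := by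
  have h0 : f 0 = 0 := by have := hodd 0; rw [neg_zero] at this; linarith
  have hsub : ∀ n, f ((2 * h + 1 : ℕ) - n) = -f n := fun n => by rw [sub_eq_add_neg, hper, hodd]
  set U := ∑ m ∈ Finset.range h, ((m + 1 : ℕ) : ℝ) * f (m + 1 : ℕ) with hU
  set T := ∑ m ∈ Finset.range h, f (m + 1 : ℕ) with hT
  set d : ℕ := 2 * h + 1 with hd
  have e1 : ∑ n ∈ Finset.range (h + 1), f n = T := by
    rw [Finset.sum_range_succ']; simp [hT, h0]
  have e2 : ∑ n ∈ Finset.range d, (n : ℝ) * f n = 2 * U - d * T := by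
    have := sum_range_fold (fun n : ℤ => (n : ℝ) * f n) h
    simp only [Int.cast_natCast] at this
    rw [this, Finset.sum_range_succ']
    simp only [← hd, hsub, Nat.cast_zero, zero_mul, add_zero]
    rw [← hU, two_mul, add_sub_assoc]
    congr 1
    rw [hU, hT, Finset.mul_sum, ← Finset.sum_sub_distrib]
    refine Finset.sum_congr rfl fun m _ => ?_
    push_cast
    ring
  have e3 : ∑ n ∈ Finset.range d, (n : ℝ) * f n = χ * (4 * U - d * T) := by
    have := sum_range_odd_sub (fun n : ℤ => (n : ℝ) * f n) h
    simp only [Int.cast_natCast] at this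
    rw [this, Finset.sum_range_succ']
    simp only [← hd, hsub, h2]
    rw [hU, hT, Finset.mul_sum, Finset.mul_sum, ← Finset.sum_sub_distrib, Finset.mul_sum,
      Nat.cast_zero, mul_zero, Int.cast_zero, zero_mul, add_zero, ← Finset.sum_add_distrib]
    refine Finset.sum_congr rfl fun m _ => ?_
    push_cast
    ring
  rw [e1]
  linear_combination (2 : ℝ) * e2 - χ * e3 - (4 * U - d * T) * hχ

lemma periodic_mul_add {A : Type*} {f : ℕ → A} {d : ℕ} (hper : ∀ n, f (n + d) = f n) (q n : ℕ) :
    f (d * q + n) = f n := by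
  induction q generalizing n with
  | zero => simp
  | succ q ih => rw [show d * (q + 1) + n = d * q + n + d by ring, hper, ih]

lemma sum_range_periodic_add {f : ℕ → ℝ} {d : ℕ} (hper : ∀ n, f (n + d) = f n) (q r : ℕ) :
    ∑ n ∈ Finset.range (d * q + r), f n
      = q * ∑ n ∈ Finset.range d, f n + ∑ n ∈ Finset.range r, f n := by
  have hper' := periodic_mul_add hper
  rw [Finset.sum_range_add]
  simp only [hper']
  congr 1
  induction q with
  | zero => simp
  | succ q ih =>
    rw [show d * (q + 1) = d * q + d by ring, Finset.sum_range_add, ih]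
    simp only [hper']
    push_cast
    ring

lemma sum_range_mul_periodic {f : ℕ → ℝ} {d : ℕ} (hper : ∀ n, f (n + d) = f n)
    (h0 : ∑ n ∈ Finset.range d, f n = 0) (q : ℕ) :
    ∑ n ∈ Finset.range (d * q), (n : ℝ) * f n = q * ∑ n ∈ Finset.range d, (n : ℝ) * f n := by
  have hper' := periodic_mul_add hper
  induction q with
  | zero => simp
  | succ q ih =>
    rw [show d * (q + 1) = d * q + d by ring, Finset.sum_range_add, ih]
    simp only [hper', Nat.cast_add, add_mul, Finset.sum_add_distrib, ← Finset.mul_sum, h0]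
    push_cast
    ring

/-- For a prime factor `p` of a squarefree odd `d`, there is a `u ≡ 1` modulo `d / p` with
Jacobi symbol `-1`. -/
lemma exists_jacobiSym_eq_neg_one {p m : ℕ} (hp : p.Prime) (hp2 : p ≠ 2) (hpm : p.Coprime m)
    (hm : m ≠ 0) : ∃ u : ℕ, jacobiSym u (p * m) = -1 ∧ u ≡ 1 [MOD m] := by
  have : Fact p.Prime := ⟨hp⟩
  have : NeZero m := ⟨hm⟩
  obtain ⟨a, ha⟩ := quadraticChar_exists_neg_one (F := ZMod p) (by rwa [ZMod.ringChar_zmod_n])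
  obtain ⟨u, hu1, hu2⟩ := Nat.chineseRemainder hpm a.val 1
  refine ⟨u, ?_, hu2⟩
  have h1 : jacobiSym u p = -1 := by
    rw [← jacobiSym.legendreSym.to_jacobiSym, legendreSym, Int.cast_natCast,
      (ZMod.natCast_eq_natCast_iff _ _ _).2 hu1, ZMod.natCast_zmod_val, ha]
  have h2 : jacobiSym u m = 1 := by
    rw [jacobiSym.mod_left' (a₂ := 1) (b := m), jacobiSym.one_left]
    exact_mod_cast hu2
  rw [jacobiSym.mul_right, h1, h2, mul_one]

lemma isUnit_of_jacobiSym_eq_neg_one {u d : ℕ} [NeZero d] (hu : jacobiSym u d = -1) :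
    IsUnit (u : ZMod d) := by
  rw [ZMod.isUnit_iff_coprime]
  by_contra hc
  have := jacobiSym.eq_zero_iff_not_coprime (a := u) (b := d)
  rw [hu] at this
  have h3 := this.2 (by simpa using hc)
  norm_num at h3

lemma sum_range_jacobiSym_mul_add {d u a : ℕ} [NeZero d] (hu : jacobiSym u d = -1)
    (ha : a.Coprime d) (b : ℕ) :
    ∑ n ∈ Finset.range d, (jacobiSym (a * n + b : ℕ) d : ℝ) = 0 := by
  let F : ZMod d → ℝ := fun x => jacobiSym x.val d
  have hF : ∀ n : ℕ, F n = jacobiSym n d := by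
    intro n
    simp only [F, ZMod.val_natCast, Int.natCast_mod]
    rw [← jacobiSym.mod_left]
  have hu' := isUnit_of_jacobiSym_eq_neg_one hu
  have e1 : ∑ n ∈ Finset.range d, (jacobiSym (a * n + b : ℕ) d : ℝ) = ∑ x, F x := by
    rw [← Equiv.sum_comp ((Units.mulLeft (ZMod.unitOfCoprime a ha)).trans (Equiv.addRight (b : ZMod d))),
      ← sum_range_natCast_zmod d]
    refine Finset.sum_congr rfl fun n _ => ?_
    rw [← hF]
    simp
  have e2 : ∑ x, F x = -∑ x, F x := by
    conv_lhs => rw [← Equiv.sum_comp (Units.mulLeft hu'.unit)]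
    rw [← Finset.sum_neg_distrib]
    refine Finset.sum_congr rfl fun x _ => ?_
    have h4 : (Units.mulLeft hu'.unit) x = ((u * x.val : ℕ) : ZMod d) := by
      simp
    rw [h4, hF]
    simp only [F]
    push_cast
    rw [jacobiSym.mul_left, hu]
    simp
  rw [e1]
  linarith

lemma sum_range_jacobiSym {d : ℕ} (hd : Squarefree d) (hodd : Odd d) (h1 : d ≠ 1) :
    ∑ n ∈ Finset.range d, (jacobiSym n d : ℝ) = 0 := by
  obtain ⟨p, hp, m, rfl⟩ := Nat.exists_prime_and_dvd h1
  have hm : m ≠ 0 := by rintro rfl; simp at hd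
  have hp2 : p ≠ 2 := by rintro rfl; exact absurd (Nat.odd_mul.1 hodd).1 (by decide)
  have : NeZero (p * m) := ⟨hd.ne_zero⟩
  obtain ⟨u, hu, -⟩ := exists_jacobiSym_eq_neg_one hp hp2 (Nat.coprime_of_squarefree_mul hd) hm
  simpa using sum_range_jacobiSym_mul_add hu (Nat.coprime_one_left (p * m)) 0

/-- The normalised first moment `-(1/d) ∑_{n < d} n (n/d)` of the Jacobi symbol; for negative
fundamental discriminants `-d` it is essentially the class number. -/
noncomputable def jacobiMoment (d : ℕ) : ℝ :=
  -(∑ n ∈ Finset.range d, (n : ℝ) * (jacobiSym n d : ℝ)) / d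

lemma jacobiSym_add_self (n d : ℕ) : jacobiSym (n + d : ℕ) d = jacobiSym n d := by
  apply jacobiSym.mod_left'
  push_cast
  simp

lemma jacobiSym_zero_of_ne_one {d : ℕ} (hd : d ≠ 1) (h0 : d ≠ 0) : jacobiSym 0 d = 0 :=
  jacobiSym.zero_left (by omega)

lemma jacobiSym_neg_of_mod_four_eq_three {d : ℕ} (hd : d % 4 = 3) (n : ℤ) :
    jacobiSym (-n) d = -jacobiSym n d := by
  rw [jacobiSym.neg n (Nat.odd_iff.2 (by omega)), ZMod.χ₄_nat_three_mod_four hd, neg_one_mul]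

lemma jacobiSym_neg_of_mod_four_eq_one {d : ℕ} (hd : d % 4 = 1) (n : ℤ) :
    jacobiSym (-n) d = jacobiSym n d := by
  rw [jacobiSym.neg n (Nat.odd_iff.2 (by omega)), ZMod.χ₄_nat_one_mod_four hd, one_mul]

lemma sum_half_jacobiSym_of_mod_four_eq_three {h : ℕ} (hd : (2 * h + 1) % 4 = 3) :
    ∑ n ∈ Finset.range (h + 1), (jacobiSym n (2 * h + 1) : ℝ)
      = (2 - jacobiSym 2 (2 * h + 1)) * jacobiMoment (2 * h + 1) := by
  have h3 := sum_half_period (f := fun n => (jacobiSym n (2 * h + 1) : ℝ)) (h := h)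
    (χ := jacobiSym 2 (2 * h + 1)) ?_ ?_ ?_ ?_
  · have hpos : ((2 * h + 1 : ℕ) : ℝ) ≠ 0 := by positivity
    rw [jacobiMoment, mul_div_assoc', eq_div_iff hpos, mul_comm, h3]
    ring
  · intro n
    rw [jacobiSym.mod_left' (a₂ := n)]
    simp
  · intro n
    rw [jacobiSym_neg_of_mod_four_eq_three hd, Int.cast_neg]
  · intro n
    rw [jacobiSym.mul_left, Int.cast_mul]
  · have : jacobiSym 2 (2 * h + 1) ^ 2 = 1 := by
      apply jacobiSym.sq_one
      simp
    exact_mod_cast this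

lemma sum_half_jacobiSym_of_mod_four_eq_one {h : ℕ} (hd : (2 * h + 1) % 4 = 1)
    (hsq : Squarefree (2 * h + 1)) (h1 : 2 * h + 1 ≠ 1) :
    ∑ n ∈ Finset.range (h + 1), (jacobiSym n (2 * h + 1) : ℝ) = 0 ∧
      jacobiMoment (2 * h + 1) = 0 := by
  have hsub : ∀ n : ℕ, jacobiSym ((2 * h + 1 : ℕ) - n) (2 * h + 1) = jacobiSym n (2 * h + 1) := by
    intro n
    rw [← jacobiSym_neg_of_mod_four_eq_one hd n]
    apply jacobiSym.mod_left'
    rw [sub_eq_add_neg, Int.add_emod_left]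
  have h0 : jacobiSym 0 (2 * h + 1) = 0 := jacobiSym_zero_of_ne_one h1 (by omega)
  have hs := sum_range_jacobiSym hsq ⟨h, rfl⟩ h1
  have e1 := sum_range_fold (fun n : ℤ => (jacobiSym n (2 * h + 1) : ℝ)) h
  have e2 := sum_range_fold (fun n : ℤ => (n : ℝ) * (jacobiSym n (2 * h + 1) : ℝ)) h
  simp only [hsub] at e1 e2
  rw [hs, Finset.sum_range_succ'] at e1
  simp only [Nat.cast_zero, h0, Int.cast_zero] at e1
  rw [Finset.sum_range_succ' _ h] at e2 ⊢
  simp only [Nat.cast_zero, h0, Int.cast_zero] at e2 ⊢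
  have hT : ∑ m ∈ Finset.range h, (jacobiSym (m + 1 : ℕ) (2 * h + 1) : ℝ) = 0 := by linarith
  refine ⟨by rw [hT, add_zero], ?_⟩
  rw [mul_zero, add_zero, ← Finset.sum_add_distrib] at e2
  have e3 : ∑ n ∈ Finset.range (2 * h + 1), (n : ℝ) * (jacobiSym n (2 * h + 1) : ℝ)
      = (2 * h + 1 : ℕ) * ∑ m ∈ Finset.range h, (jacobiSym (m + 1 : ℕ) (2 * h + 1) : ℝ) := by
    have : ∀ n : ℕ, (n : ℝ) = ((n : ℤ) : ℝ) := fun n => by simp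
    rw [Finset.mul_sum]
    simp only [this] at e2 ⊢
    rw [e2]
    refine Finset.sum_congr rfl fun m _ => ?_
    push_cast
    ring
  rw [jacobiMoment, e3, hT]
  simp

lemma sum_Icc_sum_range (f : ℕ → ℝ) (M : ℕ) :
    ∑ i ∈ Finset.Icc 1 M, ∑ n ∈ Finset.range (i + 1), f n
      = (M + 1) * ∑ n ∈ Finset.range (M + 1), f n
        - ∑ n ∈ Finset.range (M + 1), (n : ℝ) * f n - f 0 := by
  induction M with
  | zero => simp
  | succ M ih =>
    rw [Finset.sum_Icc_succ_top (by omega), ih, Finset.sum_range_succ _ (M + 1),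
      Finset.sum_range_succ (fun n => (n : ℝ) * f n) (M + 1)]
    push_cast
    ring

section Density

variable (M : ℕ) [NeZero M]

lemma density_eq_sum (hM : Squarefree M) (hodd : Odd M) (n : ℕ) :
    (modCount M n : ℝ) / M ^ 2 - 1
      = ∑ d ∈ M.divisors.erase 1, (ZMod.χ₄ d : ℝ) / d * (jacobiSym n d : ℝ) := by
  have h := modCount_eq_sum_divisors M hM hodd n
  rw [Int.cast_natCast] at h
  have hM0 : (M : ℝ) ^ 2 ≠ 0 := pow_ne_zero 2 (Nat.cast_ne_zero.2 (NeZero.ne M))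
  rw [h, mul_div_cancel_left₀ _ hM0,
    ← Finset.add_sum_erase _ _ (Nat.mem_divisors.2 ⟨one_dvd M, NeZero.ne M⟩)]
  simp only [jacobiSym.one_right, Int.cast_one, Nat.cast_one, div_one, add_sub_cancel_left]
  refine Finset.sum_congr rfl fun d hd => ?_
  rw [jacobiSym.neg _ (hodd.of_dvd_nat (Nat.dvd_of_mem_divisors (Finset.mem_of_mem_erase hd)))]
  push_cast
  ring

lemma densitySum_eq_sum (hM : Squarefree M) (hodd : Odd M) (j : ℕ) :
    densitySum M j = ∑ d ∈ M.divisors.erase 1,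
      (ZMod.χ₄ d : ℝ) / d * ∑ n ∈ Finset.range (j + 1), (jacobiSym n d : ℝ) := by
  simp only [densitySum, density_eq_sum M hM hodd, Finset.mul_sum]
  rw [Finset.sum_comm]
  refine Finset.sum_congr rfl fun d hd => ?_
  rw [Finset.sum_range_succ', Finset.range_eq_Ico,
    Finset.sum_Ico_add' (fun n : ℕ => (ZMod.χ₄ d : ℝ) / d * (jacobiSym n d : ℝ)) 0 j 1]
  rw [Nat.cast_zero, jacobiSym_zero_of_ne_one (Finset.ne_of_mem_erase hd)
    (Nat.pos_of_mem_divisors (Finset.mem_of_mem_erase hd)).ne']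
  simp only [Int.cast_zero, mul_zero, add_zero]
  exact Finset.sum_congr (by ext; simp) fun _ _ => rfl

lemma densityDev_self (hM : Squarefree M) (hodd : Odd M) :
    densityDev M M = ∑ d ∈ M.divisors with d % 4 = 3, jacobiMoment d / d := by
  have hM0 : (M : ℝ) ≠ 0 := Nat.cast_ne_zero.2 (NeZero.ne M)
  have hS : ∀ d ∈ M.divisors.erase 1,
      ∑ n ∈ Finset.range (M + 1), (jacobiSym n d : ℝ) = 0 ∧
      ∑ n ∈ Finset.range (M + 1), (n : ℝ) * (jacobiSym n d : ℝ) = -M * jacobiMoment d := by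
    intro d hd
    have hdM := Nat.dvd_of_mem_divisors (Finset.mem_of_mem_erase hd)
    have hd0 : d ≠ 0 := (Nat.pos_of_mem_divisors (Finset.mem_of_mem_erase hd)).ne'
    have hd1 := Finset.ne_of_mem_erase hd
    have h0 := sum_range_jacobiSym (hM.squarefree_of_dvd hdM) (hodd.of_dvd_nat hdM) hd1
    obtain ⟨q, rfl⟩ := hdM
    have hper : ∀ n : ℕ, (jacobiSym (n + d : ℕ) d : ℝ) = jacobiSym n d := fun n => by
      rw [jacobiSym_add_self]
    have hz : jacobiSym (d * q : ℕ) d = 0 := by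
      rw [← jacobiSym_zero_of_ne_one hd1 hd0]
      apply jacobiSym.mod_left'
      push_cast
      simp
    have e1 := sum_range_periodic_add (f := fun n => (jacobiSym n d : ℝ)) hper q 0
    have e2 := sum_range_mul_periodic (f := fun n => (jacobiSym n d : ℝ)) hper h0 q
    simp only [Finset.sum_range_succ, hz, Int.cast_zero, mul_zero, add_zero]
    simp only [Finset.sum_range_zero, h0, mul_zero, add_zero] at e1
    refine ⟨e1, ?_⟩
    rw [e2, jacobiMoment]
    have : (d : ℝ) ≠ 0 := Nat.cast_ne_zero.2 hd0
    push_cast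
    field_simp
  have h1 : densitySum M M = 0 := by
    rw [densitySum_eq_sum M hM hodd]
    exact Finset.sum_eq_zero fun d hd => by rw [(hS d hd).1, mul_zero]
  have h2 : ∑ i ∈ Finset.Icc 1 M, densitySum M i
      = M * ∑ d ∈ M.divisors.erase 1, (ZMod.χ₄ d : ℝ) / d * jacobiMoment d := by
    simp only [densitySum_eq_sum M hM hodd]
    rw [Finset.sum_comm, Finset.mul_sum]
    refine Finset.sum_congr rfl fun d hd => ?_
    rw [← Finset.mul_sum, sum_Icc_sum_range (fun n => (jacobiSym n d : ℝ)), (hS d hd).1,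
      (hS d hd).2, Nat.cast_zero, jacobiSym_zero_of_ne_one (Finset.ne_of_mem_erase hd)
        (Nat.pos_of_mem_divisors (Finset.mem_of_mem_erase hd)).ne']
    push_cast
    ring
  rw [densityDev, h1, h2, mul_div_cancel_left₀ _ hM0, zero_sub, ← Finset.sum_neg_distrib]
  have hsub : M.divisors.filter (fun d => d % 4 = 3) ⊆ M.divisors.erase 1 := by
    intro d hd
    obtain ⟨h3, h4⟩ := Finset.mem_filter.1 hd
    exact Finset.mem_erase.2 ⟨by rintro rfl; simp at h4, h3⟩
  refine (Finset.sum_subset_zero_on_sdiff hsub ?_ ?_).symm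
  · intro d hd
    obtain ⟨hd1, hd2⟩ := Finset.mem_sdiff.1 hd
    have hdM := Nat.dvd_of_mem_divisors (Finset.mem_of_mem_erase hd1)
    obtain ⟨h, rfl⟩ := hodd.of_dvd_nat hdM
    have h4 : (2 * h + 1) % 4 ≠ 3 := fun h4 =>
      hd2 (Finset.mem_filter.2 ⟨Finset.mem_of_mem_erase hd1, h4⟩)
    rw [(sum_half_jacobiSym_of_mod_four_eq_one (by omega) (hM.squarefree_of_dvd hdM)
      (Finset.ne_of_mem_erase hd1)).2]
    simp
  · intro d hd
    rw [ZMod.χ₄_nat_three_mod_four (Finset.mem_filter.1 hd).2]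
    push_cast
    ring

lemma densityDev_half (hM : Squarefree M) (hodd : Odd M) :
    densityDev M ((M - 1) / 2) = -2 * ∑ d ∈ M.divisors with d % 8 = 3, jacobiMoment d / d := by
  have hS : ∀ d ∈ M.divisors.erase 1,
      (ZMod.χ₄ d : ℝ) / d * ∑ n ∈ Finset.range ((M - 1) / 2 + 1), (jacobiSym n d : ℝ)
        = if d % 4 = 3 then -(2 - jacobiSym 2 d) * (jacobiMoment d / d) else 0 := by
    intro d hd
    have hdM := Nat.dvd_of_mem_divisors (Finset.mem_of_mem_erase hd)
    have hd0 : d ≠ 0 := (Nat.pos_of_mem_divisors (Finset.mem_of_mem_erase hd)).ne'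
    have hd1 := Finset.ne_of_mem_erase hd
    have hsq := hM.squarefree_of_dvd hdM
    have hdo := hodd.of_dvd_nat hdM
    have h0 := sum_range_jacobiSym hsq hdo hd1
    have hqo : Odd (M / d) := hodd.of_dvd_nat (Nat.div_dvd_of_dvd hdM)
    have hMd : d * (M / d) = M := Nat.mul_div_cancel' hdM
    obtain ⟨g, hg⟩ := hqo
    obtain ⟨h, rfl⟩ := hdo
    have hper : ∀ n : ℕ, (jacobiSym (n + (2 * h + 1) : ℕ) (2 * h + 1) : ℝ)
        = jacobiSym n (2 * h + 1) := fun n => by rw [jacobiSym_add_self]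
    have hidx : (M - 1) / 2 + 1 = (2 * h + 1) * g + (h + 1) := by
      rw [← hMd, hg]
      have : (2 * h + 1) * (2 * g + 1) = 2 * ((2 * h + 1) * g + h) + 1 := by ring
      omega
    rw [hidx, sum_range_periodic_add (f := fun n => (jacobiSym n (2 * h + 1) : ℝ)) hper g (h + 1),
      h0, mul_zero, zero_add]
    split_ifs with h4
    · rw [sum_half_jacobiSym_of_mod_four_eq_three h4, ZMod.χ₄_nat_three_mod_four h4]
      push_cast
      ring
    · rw [(sum_half_jacobiSym_of_mod_four_eq_one (by omega) hsq hd1).1, mul_zero]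
  have h1 : densityDev M ((M - 1) / 2) = densitySum M ((M - 1) / 2) + densityDev M M := by
    have h2 : densitySum M M = 0 := by
      have : ∑ n : ZMod M, ((modCount M n : ℝ) / M ^ 2 - 1) = 0 := by
        rw [Finset.sum_sub_distrib, ← Finset.sum_div]
        have h3 : ∑ n : ZMod M, (modCount M n : ℝ) = (M : ℝ) ^ 3 := by
          exact_mod_cast sum_modCount M
        have hM0 : (M : ℝ) ≠ 0 := Nat.cast_ne_zero.2 (NeZero.ne M)
        rw [h3]
        simp only [Finset.sum_const, Finset.card_univ, ZMod.card, nsmul_eq_mul, mul_one]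
        field_simp
        simp
      rw [← this, densitySum, sum_Icc_natCast_zmod M fun n => (modCount M n : ℝ) / M ^ 2 - 1]
    rw [densityDev, densityDev, h2]
    ring
  have hsub : M.divisors.filter (fun d => d % 4 = 3) ⊆ M.divisors.erase 1 := by
    intro d hd
    obtain ⟨h3, h4⟩ := Finset.mem_filter.1 hd
    exact Finset.mem_erase.2 ⟨by rintro rfl; simp at h4, h3⟩
  have h3 : (M.divisors.erase 1).filter (fun d => d % 4 = 3)
      = M.divisors.filter (fun d => d % 4 = 3) := by
    ext d
    simp only [Finset.mem_filter, Finset.mem_erase]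
    constructor
    · rintro ⟨⟨-, h⟩, h'⟩; exact ⟨h, h'⟩
    · rintro ⟨h, h'⟩; exact ⟨⟨by rintro rfl; simp at h', h⟩, h'⟩
  rw [h1, densitySum_eq_sum M hM hodd, densityDev_self M hM hodd, Finset.sum_congr rfl hS,
    ← Finset.sum_filter, h3, ← Finset.sum_add_distrib, Finset.mul_sum]
  have h5 : M.divisors.filter (fun d => d % 8 = 3)
      = (M.divisors.filter (fun d => d % 4 = 3)).filter (fun d => d % 8 = 3) := by
    ext d
    simp only [Finset.mem_filter]
    constructor
    · rintro ⟨h, h'⟩; exact ⟨⟨h, by omega⟩, h'⟩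
    · rintro ⟨⟨h, -⟩, h'⟩; exact ⟨h, h'⟩
  rw [h5, Finset.sum_filter (p := fun d => d % 8 = 3)]
  refine Finset.sum_congr rfl fun d hd => ?_
  have h4 := (Finset.mem_filter.1 hd).2
  rw [jacobiSym.at_two (Nat.odd_iff.2 (by omega)), ZMod.χ₈_nat_eq_if_mod_eight]
  have : d % 8 = 3 ∨ d % 8 = 7 := by omega
  rcases this with h8 | h8 <;> simp [h8, show d % 2 = 1 by omega] <;> ring

end Density

/-! ### The quadratic Gauss sum via the theta function -/

section Theta

open Complex Topology

lemma cpow_real_mul {r : ℝ} (hr : 0 < r) {z : ℂ} (hz : z ≠ 0) (s : ℂ) :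
    ((r : ℂ) * z) ^ s = (r : ℂ) ^ s * z ^ s := by
  have hr' : (r : ℂ) ≠ 0 := ofReal_ne_zero.2 hr.ne'
  rw [cpow_def_of_ne_zero (mul_ne_zero hr' hz), cpow_def_of_ne_zero hr', cpow_def_of_ne_zero hz,
    log_ofReal_mul hr hz, ← Complex.exp_add, add_mul, ofReal_log hr.le]

lemma summable_cexp_neg_sq {δ : ℂ} (hδ : 0 < δ.re) :
    Summable fun n : ℤ => cexp (-π * δ * (n : ℂ) ^ 2) := by
  have h := (summable_jacobiTheta₂_term_iff 0 (I * δ)).2 (by simpa using hδ)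
  refine h.congr fun n => ?_
  rw [jacobiTheta₂_term]
  congr 1
  linear_combination (π : ℂ) * n ^ 2 * δ * I_mul_I

lemma summable_exp_neg_pi_sq : Summable fun n : ℤ => Real.exp (-π * (n : ℝ) ^ 2) := by
  have h := (summable_cexp_neg_sq (δ := 1) (by simp)).norm
  refine h.congr fun n => ?_
  rw [Complex.norm_exp]
  congr 1
  rw [show -(π : ℂ) * 1 * (n : ℂ) ^ 2 = ((-π * (n : ℝ) ^ 2 : ℝ) : ℂ) by push_cast; ring, ofReal_re]

lemma tsum_residue (m : ℕ) [NeZero m] {F : ℤ → ℂ} (hF : Summable F) :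
    ∑' n, F n = ∑ r ∈ Finset.range m, ∑' n : ℤ, F (n * m + r) := by
  rw [← (Int.divModEquiv m).symm.tsum_eq F]
  have hs : Summable fun p : ℤ × Fin m => F ((Int.divModEquiv m).symm p) :=
    (Int.divModEquiv m).symm.summable_iff.2 hF
  rw [← (Equiv.prodComm (Fin m) ℤ).tsum_eq]
  have hs' := (Equiv.prodComm (Fin m) ℤ).summable_iff.2 hs
  refine (Summable.tsum_prod hs').trans ?_
  rw [tsum_fintype, Finset.sum_range]
  rfl

lemma cpow_half_mul_tsum_residue {δ : ℂ} (hδ : 0 < δ.re) {m : ℕ} (hm : m ≠ 0) (r : ℕ) :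
    δ ^ (1 / 2 : ℂ) * ∑' n : ℤ, cexp (-π * δ * ((n * m + r : ℤ) : ℂ) ^ 2)
      = 1 / m * ∑' n : ℤ, cexp (-π / (δ * m ^ 2) * n ^ 2 + 2 * π * I * (n * r / m)) := by
  have hm' : (m : ℂ) ≠ 0 := Nat.cast_ne_zero.2 hm
  have hmr : (0 : ℝ) < m := by positivity
  have hδ0 : δ ≠ 0 := by rintro rfl; simp at hδ
  have hre : 0 < (δ * m ^ 2).re := by
    rw [show δ * (m : ℂ) ^ 2 = ((m ^ 2 : ℝ) : ℂ) * δ by push_cast; ring, re_ofReal_mul]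
    positivity
  have hsqrt : (δ * m ^ 2) ^ (1 / 2 : ℂ) = m * δ ^ (1 / 2 : ℂ) := by
    rw [show δ * (m : ℂ) ^ 2 = ((m ^ 2 : ℝ) : ℂ) * δ by push_cast; ring,
      cpow_real_mul (by positivity) hδ0]
    congr 1
    have := sq_cpow_two_inv (x := (m : ℂ)) (by simpa using hmr)
    rw [one_div, ← this]
    push_cast
    rfl
  have h := Complex.tsum_exp_neg_quadratic hre (-δ * m * r)
  have e1 : ∀ n : ℤ, cexp (-π * δ * ((n * m + r : ℤ) : ℂ) ^ 2)
      = cexp (-π * δ * r ^ 2)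
        * cexp (-π * (δ * m ^ 2) * n ^ 2 + 2 * π * (-δ * m * r) * n) := by
    intro n
    rw [← Complex.exp_add]
    congr 1
    push_cast
    ring
  have e2 : ∀ n : ℤ, cexp (-π * δ * r ^ 2)
        * cexp (-π / (δ * m ^ 2) * (n + I * (-δ * m * r)) ^ 2)
      = cexp (-π / (δ * m ^ 2) * n ^ 2 + 2 * π * I * (n * r / m)) := by
    intro n
    rw [← Complex.exp_add]
    congr 1
    field_simp
    ring_nf
    rw [I_sq]
    ring
  simp only [e1]
  rw [tsum_mul_left, h, hsqrt]
  simp only [← e2]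
  rw [tsum_mul_left]
  have : δ ^ (1 / 2 : ℂ) ≠ 0 := by
    rw [Ne, cpow_eq_zero_iff]
    simp [hδ0]
  field_simp

lemma tendsto_cpow_half_mul_tsum {ι : Type*} {l : Filter ι} [l.IsCountablyGenerated] {δ : ι → ℂ}
    (hδ : ∀ᶠ t in l, 0 < (δ t).re) (hlim : Tendsto (fun t => ((δ t)⁻¹).re) l atTop)
    {m : ℕ} (hm : m ≠ 0) (r : ℕ) :
    Tendsto (fun t => (δ t) ^ (1 / 2 : ℂ) *
      ∑' n : ℤ, cexp (-π * δ t * ((n * m + r : ℤ) : ℂ) ^ 2)) l (𝓝 (1 / m)) := by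
  have hm' : (m : ℂ) ≠ 0 := Nat.cast_ne_zero.2 hm
  have hmr : (0 : ℝ) < m := by positivity
  have hnorm : ∀ t (n : ℤ),
      ‖cexp (-π / (δ t * m ^ 2) * n ^ 2 + 2 * π * I * (n * r / m))‖
        = Real.exp (-(π * n ^ 2 / m ^ 2 * ((δ t)⁻¹).re)) := by
    intro t n
    rw [Complex.norm_exp]
    congr 1
    have : -(π : ℂ) / (δ t * m ^ 2) * n ^ 2 + 2 * π * I * (n * r / m)
        = ((-(π * n ^ 2 / m ^ 2) : ℝ) : ℂ) * (δ t)⁻¹ + ((2 * π * (n * r / m) : ℝ) : ℂ) * I := by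
      push_cast
      field_simp
    rw [this, add_re, re_ofReal_mul, re_ofReal_mul, I_re]
    ring
  have key : Tendsto (fun t => ∑' n : ℤ,
      cexp (-π / (δ t * m ^ 2) * n ^ 2 + 2 * π * I * (n * r / m))) l
      (𝓝 (∑' n : ℤ, if n = 0 then 1 else 0)) := by
    refine tendsto_tsum_of_dominated_convergence summable_exp_neg_pi_sq ?_ ?_
    · intro n
      split_ifs with hn
      · subst hn
        simpa using tendsto_const_nhds
      · rw [tendsto_zero_iff_norm_tendsto_zero]
        simp only [hnorm]
        refine Real.tendsto_exp_neg_atTop_nhds_zero.comp ?_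
        refine Tendsto.const_mul_atTop ?_ hlim
        have : (n : ℝ) ≠ 0 := Int.cast_ne_zero.2 hn
        positivity
    · filter_upwards [hlim.eventually_ge_atTop ((m : ℝ) ^ 2)] with t ht n
      rw [hnorm]
      refine Real.exp_le_exp.2 ?_
      rw [neg_mul, neg_le_neg_iff]
      have : π * n ^ 2 = π * n ^ 2 / m ^ 2 * (m : ℝ) ^ 2 := by field_simp
      conv_lhs => rw [this]
      gcongr
  rw [tsum_ite_eq] at key
  have := key.const_mul (1 / (m : ℂ))
  rw [mul_one] at this
  refine this.congr' ?_
  filter_upwards [hδ] with t ht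
  rw [cpow_half_mul_tsum_residue ht hm]

end Theta

section GaussSum

open Complex Topology

/-- Evaluation of the quadratic Gauss sum for moduli congruent to `3` modulo `4`. -/
lemma sum_cexp_sq {N : ℕ} (hN : N % 4 = 3) :
    ∑ r ∈ Finset.range N, cexp (2 * π * I * (r ^ 2 / N)) = I * (√N : ℝ) := by
  have hN0 : N ≠ 0 := by omega
  have : NeZero N := ⟨hN0⟩
  have hNr : (0 : ℝ) < N := by positivity
  have hNc : (N : ℂ) ≠ 0 := Nat.cast_ne_zero.2 hN0
  let a : ℝ → ℂ := fun t => t - 2 * I / N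
  let w : ℝ → ℂ := fun t => -I * N / (2 * a t)
  have hare : ∀ t, (a t).re = t := by
    intro t
    have : a t = (t : ℂ) + ((-(2 / N) : ℝ) : ℂ) * I := by simp only [a]; push_cast; ring
    rw [this, add_re, re_ofReal_mul, I_re, ofReal_re]; ring
  have hat : Tendsto a (𝓝[>] 0) (𝓝 (-2 * I / N)) := by
    have hc : Continuous a := by fun_prop
    have := (hc.tendsto 0).mono_left (nhdsWithin_le_nhds (s := Set.Ioi 0))
    convert this using 2
    simp only [a]; push_cast; ring
  have ha0 : (-2 * I / N : ℂ) ≠ 0 := by simp [hNc]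
  have hwt : Tendsto w (𝓝[>] 0) (𝓝 ((N ^ 2 / 4 : ℝ) : ℂ)) := by
    have := (tendsto_const_nhds (x := (-I * N : ℂ))).div (hat.const_mul 2)
      (mul_ne_zero two_ne_zero ha0)
    have e : ((N ^ 2 / 4 : ℝ) : ℂ) = -I * N / (2 * (-2 * I / N)) := by
      push_cast
      field_simp
      norm_num
    rw [e]
    exact this
  have hpos : ∀ᶠ t : ℝ in 𝓝[>] 0, 0 < t := self_mem_nhdsWithin
  have hwre : ∀ᶠ t in 𝓝[>] (0 : ℝ), 0 < (w t).re := by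
    refine ((continuous_re.tendsto _).comp hwt).eventually_const_lt ?_
    rw [ofReal_re]; positivity
  have hinv : Tendsto (fun t : ℝ => t⁻¹) (𝓝[>] 0) atTop := tendsto_inv_nhdsGT_zero
  -- the theta series, split according to residues modulo `N`
  have hL : Tendsto (fun t : ℝ => (t : ℂ) ^ (1 / 2 : ℂ) * ∑' n : ℤ, cexp (-π * a t * n ^ 2))
      (𝓝[>] 0) (𝓝 (∑ r ∈ Finset.range N, cexp (2 * π * I * (r ^ 2 / N)) * (1 / N))) := by
    have h1 : ∀ r ∈ Finset.range N, Tendsto (fun t : ℝ => cexp (2 * π * I * (r ^ 2 / N)) *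
        ((t : ℂ) ^ (1 / 2 : ℂ) * ∑' n : ℤ, cexp (-π * t * ((n * N + r : ℤ) : ℂ) ^ 2)))
        (𝓝[>] 0) (𝓝 (cexp (2 * π * I * (r ^ 2 / N)) * (1 / N))) := by
      intro r _
      refine Tendsto.const_mul _ (tendsto_cpow_half_mul_tsum (δ := fun t : ℝ => (t : ℂ)) ?_ ?_ hN0 r)
      · simpa using hpos
      · refine hinv.congr fun t => ?_
        rw [← ofReal_inv, ofReal_re]
    refine (tendsto_finsetSum _ h1).congr' ?_
    filter_upwards [hpos] with t ht
    rw [tsum_residue N (summable_cexp_neg_sq (by rwa [hare])), Finset.mul_sum]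
    refine Finset.sum_congr rfl fun r _ => ?_
    rw [mul_left_comm, ← tsum_mul_left]
    congr 2
    ext n
    rw [← Complex.exp_add, Complex.exp_eq_exp_iff_exists_int]
    refine ⟨-(n ^ 2 * N + 2 * n * r), ?_⟩
    simp only [a]
    push_cast
    field_simp
    ring
  -- the dual theta series, split according to parity
  have hR : Tendsto (fun t : ℝ => (t : ℂ) ^ (1 / 2 : ℂ) * ∑' n : ℤ, cexp (-π / a t * n ^ 2))
      (𝓝[>] 0) (𝓝 (((N ^ 2 / 4 : ℝ) : ℂ) ^ (-(1 / 2) : ℂ) * ((1 + I) * (1 / 2)))) := by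
    have hwp : Tendsto (fun t => w t ^ (-(1 / 2) : ℂ)) (𝓝[>] 0)
        (𝓝 (((N ^ 2 / 4 : ℝ) : ℂ) ^ (-(1 / 2) : ℂ))) := by
      refine hwt.cpow tendsto_const_nhds ?_
      rw [ofReal_mem_slitPlane]; positivity
    have hδre : ∀ᶠ t : ℝ in 𝓝[>] 0, 0 < ((t : ℂ) * w t).re := by
      filter_upwards [hpos, hwre] with t ht hw
      rw [re_ofReal_mul]; positivity
    have hδlim : Tendsto (fun t : ℝ => (((t : ℂ) * w t)⁻¹).re) (𝓝[>] 0) atTop := by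
      have h2 : Tendsto (fun t => ((w t)⁻¹).re) (𝓝[>] 0) (𝓝 (((N ^ 2 / 4 : ℝ) : ℂ)⁻¹).re) := by
        refine (continuous_re.tendsto _).comp (hwt.inv₀ ?_)
        rw [Ne, ofReal_eq_zero]; positivity
      have h3 := hinv.atTop_mul_pos (C := (((N ^ 2 / 4 : ℝ) : ℂ)⁻¹).re) (by
        rw [← ofReal_inv, ofReal_re]; positivity) h2
      refine h3.congr fun t => ?_
      rw [mul_inv, ← ofReal_inv, re_ofReal_mul]
    have h0 := tendsto_cpow_half_mul_tsum hδre hδlim two_ne_zero 0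
    have h1 := tendsto_cpow_half_mul_tsum hδre hδlim two_ne_zero 1
    have h2 := hwp.mul (h0.add (h1.const_mul I))
    have e : (1 : ℂ) / (2 : ℕ) + I * (1 / (2 : ℕ)) = (1 + I) * (1 / 2) := by push_cast; ring
    rw [e] at h2
    refine h2.congr' ?_
    filter_upwards [hpos, hδre, hwre] with t ht hδ hw
    have hw0 : w t ≠ 0 := by rintro h; simp [h] at hw
    have hat0 : a t ≠ 0 := by
      intro h
      have := hare t
      rw [h, zero_re] at this
      exact ht.ne this
    have hinv_a : (a t)⁻¹ = I * N / 2 + t * w t := by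
      have : a t * N = t * N - 2 * I := by simp only [a]; field_simp
      simp only [w]
      field_simp
      linear_combination -I * this + 2 * I_sq
    have hs : Summable fun n : ℤ => cexp (-π / a t * n ^ 2) := by
      have h4 := summable_cexp_neg_sq (δ := (a t)⁻¹) (by
        rw [hinv_a, add_re]
        have : (I * N / 2 : ℂ).re = 0 := by
          rw [show (I * N / 2 : ℂ) = ((N / 2 : ℝ) : ℂ) * I by push_cast; ring, re_ofReal_mul]
          simp
        rw [this, zero_add]
        exact hδ)
      simpa only [div_eq_mul_inv] using h4
    rw [tsum_residue 2 hs, Finset.sum_range_succ, Finset.sum_range_one,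
      cpow_real_mul ht hw0, cpow_neg]
    have hw2 : w t ^ (1 / 2 : ℂ) ≠ 0 := by
      rw [Ne, cpow_eq_zero_iff]; simp [hw0]
    have e0 : ∑' n : ℤ, cexp (-π / a t * ((n * (2 : ℕ) + (0 : ℕ) : ℤ) : ℂ) ^ 2)
        = ∑' n : ℤ, cexp (-π * (t * w t) * ((n * (2 : ℕ) + (0 : ℕ) : ℤ) : ℂ) ^ 2) := by
      congr 1
      ext n
      rw [div_eq_mul_inv, hinv_a, Complex.exp_eq_exp_iff_exists_int]
      refine ⟨-(N * n ^ 2), ?_⟩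
      push_cast
      ring
    have e1 : ∑' n : ℤ, cexp (-π / a t * ((n * (2 : ℕ) + (1 : ℕ) : ℤ) : ℂ) ^ 2)
        = I * ∑' n : ℤ, cexp (-π * (t * w t) * ((n * (2 : ℕ) + (1 : ℕ) : ℤ) : ℂ) ^ 2) := by
      rw [← tsum_mul_left]
      congr 1
      ext n
      have hI : I = cexp (π / 2 * I) := by
        rw [Complex.exp_mul_I]
        simp
      obtain ⟨q, hq⟩ : ∃ q, N = 4 * q + 3 := ⟨N / 4, by omega⟩
      conv_rhs => rw [hI]
      rw [← Complex.exp_add, div_eq_mul_inv, hinv_a, Complex.exp_eq_exp_iff_exists_int]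
      refine ⟨-(N * (n ^ 2 + n)) - q - 1, ?_⟩
      rw [hq]
      push_cast
      ring
    rw [e0, e1]
    field_simp
  have hfun : ∀ᶠ t : ℝ in 𝓝[>] 0,
      (a t) ^ (1 / 2 : ℂ) * ((t : ℂ) ^ (1 / 2 : ℂ) * ∑' n : ℤ, cexp (-π * a t * n ^ 2))
        = (t : ℂ) ^ (1 / 2 : ℂ) * ∑' n : ℤ, cexp (-π / a t * n ^ 2) := by
    filter_upwards [hpos] with t ht
    have hat0 : a t ≠ 0 := by
      intro h
      have := hare t
      rw [h, zero_re] at this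
      exact ht.ne this
    have h2 : a t ^ (1 / 2 : ℂ) ≠ 0 := by
      rw [Ne, cpow_eq_zero_iff]; simp [hat0]
    rw [Complex.tsum_exp_neg_mul_int_sq (by rwa [hare])]
    field_simp
  have hap : Tendsto (fun t => a t ^ (1 / 2 : ℂ)) (𝓝[>] 0) (𝓝 ((-2 * I / N) ^ (1 / 2 : ℂ))) := by
    refine hat.cpow tendsto_const_nhds (Or.inr ?_)
    rw [show (-2 * I / N : ℂ) = ((-(2 / N) : ℝ) : ℂ) * I by push_cast; ring, im_ofReal_mul, I_im]
    have : 0 < (2 : ℝ) / N := by positivity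
    simp [hN0]
  have heq := tendsto_nhds_unique ((hap.mul hL).congr' hfun) hR
  have hsq : ((√N : ℝ) : ℂ) ^ 2 = N := by
    rw [← ofReal_pow, Real.sq_sqrt hNr.le, ofReal_natCast]
  have hsq0 : ((√N : ℝ) : ℂ) ≠ 0 := ofReal_ne_zero.2 (Real.sqrt_pos.2 hNr).ne'
  have v1 : (-2 * I / N : ℂ) ^ (1 / 2 : ℂ) = (1 - I) / (√N : ℝ) := by
    have h1 : (-2 * I / N : ℂ) = ((1 - I) / (√N : ℝ)) ^ 2 := by
      rw [div_pow, hsq]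
      congr 1
      linear_combination -I_sq
    rw [h1, one_div, sq_cpow_two_inv]
    rw [div_ofReal_re]
    simp only [sub_re, one_re, I_re, sub_zero]
    positivity
  have v2 : ((N ^ 2 / 4 : ℝ) : ℂ) ^ (-(1 / 2) : ℂ) = 2 / N := by
    have h1 : ((N ^ 2 / 4 : ℝ) : ℂ) = (N / 2 : ℂ) ^ 2 := by push_cast; ring
    rw [cpow_neg, h1, one_div, sq_cpow_two_inv, inv_div]
    rw [show (N / 2 : ℂ) = ((N / 2 : ℝ) : ℂ) by push_cast; ring, ofReal_re]
    positivity
  rw [v1, v2, ← Finset.sum_mul] at heq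
  set G := ∑ r ∈ Finset.range N, cexp (2 * π * I * (r ^ 2 / N))
  have h3 : (1 - I) * G = (√N : ℝ) * (1 + I) := by
    field_simp at heq
    linear_combination heq
  have h4 : (1 + I) * ((1 - I) * G) = (1 + I) * ((√N : ℝ) * (1 + I)) := by rw [h3]
  have h5 : (2 : ℂ) * G = 2 * (I * (√N : ℝ)) := by
    linear_combination h4 + (G + (√N : ℝ)) * I_sq
  exact mul_left_cancel₀ two_ne_zero h5

end GaussSum

lemma card_filter_sq_mul {m n : ℕ} [NeZero m] [NeZero n] [NeZero (m * n)] (h : m.Coprime n)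
    (k : ℤ) :
    (Finset.univ.filter fun x : ZMod (m * n) => x ^ 2 = k).card
      = (Finset.univ.filter fun x : ZMod m => x ^ 2 = k).card
        * (Finset.univ.filter fun x : ZMod n => x ^ 2 = k).card := by
  let e := ZMod.chineseRemainder h
  rw [← Finset.card_product]
  have he : ∀ x : ZMod (m * n), x ^ 2 = (k : ZMod (m * n)) ↔
      (e x).1 ^ 2 = (k : ZMod m) ∧ (e x).2 ^ 2 = (k : ZMod n) := by
    intro x
    rw [← e.injective.eq_iff, map_intCast, map_pow, Prod.ext_iff]
    simp
  refine Finset.card_nbij' e e.symm ?_ ?_ ?_ ?_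
  · intro x hx
    simpa [he] using hx
  · intro x hx
    simpa [he] using hx
  · intro x _
    simp
  · intro x _
    simp

lemma card_filter_sq_eq_sum_divisors (d : ℕ) [NeZero d] (hd : Squarefree d) (hodd : Odd d) (k : ℤ) :
    ((Finset.univ.filter fun x : ZMod d => x ^ 2 = k).card : ℤ)
      = ∑ e ∈ d.divisors, jacobiSym k e := by
  suffices h : ∀ h0 : NeZero d, ((Finset.univ.filter fun x : ZMod d => x ^ 2 = k).card : ℤ)
      = ∑ e ∈ d.divisors, jacobiSym k e from h _
  refine squarefree_odd_induction (P := fun d => ∀ h0 : NeZero d,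
      ((Finset.univ.filter fun x : ZMod d => x ^ 2 = k).card : ℤ)
      = ∑ e ∈ d.divisors, jacobiSym k e) ?_ ?_ d hd hodd
  · intro _
    simp [eq_iff_true_of_subsingleton]
  · intro p m hp hp2 hm hmodd hpm ih h0
    have : NeZero m := ⟨hm.ne_zero⟩
    have : Fact p.Prime := ⟨hp⟩
    have h1 : ((Finset.univ.filter fun x : ZMod p => x ^ 2 = k).card : ℤ) = jacobiSym k p + 1 := by
      rw [← jacobiSym.legendreSym.to_jacobiSym, legendreSym,
        ← quadraticChar_card_sqrts (by rwa [ZMod.ringChar_zmod_n])]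
      congr 2
      ext x
      simp
    rw [card_filter_sq_mul hpm, Nat.cast_mul, ih, h1, sum_divisors_prime_mul hp hpm]
    have h2 : ∑ e ∈ m.divisors, jacobiSym k (p * e)
        = jacobiSym k p * ∑ e ∈ m.divisors, jacobiSym k e := by
      rw [Finset.mul_sum]
      refine Finset.sum_congr rfl fun e he => ?_
      have : NeZero e := ⟨(Nat.pos_of_mem_divisors he).ne'⟩
      rw [jacobiSym.mul_right]
    rw [h2]
    ring

lemma jacobiSym_val_natCast (d : ℕ) {e : ℕ} (he : e ∣ d) (n : ℕ) :
    jacobiSym ((n : ZMod d).val) e = jacobiSym n e := by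
  apply jacobiSym.mod_left'
  rw [ZMod.val_natCast]
  exact_mod_cast Nat.mod_mod_of_dvd n he

section JacobiGauss

open Complex

variable (d : ℕ) [NeZero d]

/-- The Gauss sum of the Jacobi symbol modulo `e`, to the modulus `d`. -/
noncomputable def jacobiGauss (e : ℕ) (k : ZMod d) : ℂ :=
  ∑ x : ZMod d, (jacobiSym x.val e : ℂ) * ZMod.stdAddChar (k * x)

lemma jacobiGauss_eq_zero_of_ne {e : ℕ} (he : e ∣ d) (hne : e ≠ d) : jacobiGauss d e 1 = 0 := by
  have h1 : (ZMod.stdAddChar (e : ZMod d) : ℂ) ≠ 1 := by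
    intro h
    rw [← (ZMod.stdAddChar (N := d)).map_zero_eq_one] at h
    have h2 := ZMod.injective_stdAddChar h
    rw [ZMod.natCast_eq_zero_iff] at h2
    exact hne (Nat.dvd_antisymm he h2)
  have h2 : jacobiGauss d e 1 = ZMod.stdAddChar (e : ZMod d) * jacobiGauss d e 1 := by
    conv_lhs => rw [jacobiGauss, ← Equiv.sum_comp (Equiv.addRight (e : ZMod d))]
    rw [jacobiGauss, Finset.mul_sum]
    refine Finset.sum_congr rfl fun x _ => ?_
    have h3 : jacobiSym ((x + e : ZMod d).val) e = jacobiSym x.val e := by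
      have : (x + e : ZMod d) = ((x.val + e : ℕ) : ZMod d) := by simp
      rw [this, jacobiSym_val_natCast d he, jacobiSym_add_self]
    rw [Equiv.coe_addRight, h3, one_mul, one_mul, AddChar.map_add_eq_mul]
    ring
  have h3 : (ZMod.stdAddChar (e : ZMod d) - 1) * jacobiGauss d e 1 = 0 := by
    linear_combination -h2
  exact (mul_eq_zero.1 h3).resolve_left (sub_ne_zero.2 h1)

lemma jacobiGauss_one (hd : Squarefree d) (h3 : d % 4 = 3) :
    jacobiGauss d d 1 = I * (√d : ℝ) := by
  have hodd : Odd d := Nat.odd_iff.2 (by omega)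
  have hs : ∀ n : ℕ, (ZMod.stdAddChar (n : ZMod d) : ℂ) = cexp (2 * π * I * (n / d)) := by
    intro n
    have := ZMod.stdAddChar_coe (N := d) n
    push_cast at this
    rw [this]
    congr 1
    ring
  have h1 : ∑ x : ZMod d, (ZMod.stdAddChar (x ^ 2) : ℂ) = I * (√d : ℝ) := by
    rw [← sum_cexp_sq h3, ← sum_range_natCast_zmod d fun x => (ZMod.stdAddChar (x ^ 2) : ℂ)]
    refine Finset.sum_congr rfl fun n _ => ?_
    rw [← Nat.cast_pow, hs]
    push_cast
    rfl
  have h2 : ∑ x : ZMod d, (ZMod.stdAddChar (x ^ 2) : ℂ) = ∑ e ∈ d.divisors, jacobiGauss d e 1 := by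
    rw [← Finset.sum_fiberwise' Finset.univ (fun x : ZMod d => x ^ 2)
      fun y => (ZMod.stdAddChar y : ℂ)]
    simp only [jacobiGauss]
    rw [Finset.sum_comm]
    refine Finset.sum_congr rfl fun y _ => ?_
    rw [Finset.sum_const, nsmul_eq_mul, ← Finset.sum_mul, one_mul]
    congr 1
    have := card_filter_sq_eq_sum_divisors d hd hodd y.val
    rw [Int.cast_natCast, ZMod.natCast_zmod_val] at this
    exact_mod_cast congrArg (Int.cast : ℤ → ℂ) this
  rw [← h1, h2, Finset.sum_eq_single_of_mem d (Nat.mem_divisors_self d (NeZero.ne d))]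
  intro e he hne
  exact jacobiGauss_eq_zero_of_ne d (Nat.dvd_of_mem_divisors he) hne

lemma jacobiGauss_eq (hd : Squarefree d) (hodd : Odd d) (k : ℕ) :
    jacobiGauss d d k = jacobiSym k d * jacobiGauss d d 1 := by
  have hsub : ∀ (u : ℕ) (hu : IsUnit (u : ZMod d)) (k : ZMod d),
      jacobiGauss d d k = jacobiSym u d * jacobiGauss d d (k * u) := by
    intro u hu k
    conv_lhs => rw [jacobiGauss, ← Equiv.sum_comp (Units.mulLeft hu.unit)]
    rw [jacobiGauss, Finset.mul_sum]
    refine Finset.sum_congr rfl fun x _ => ?_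
    have h4 : (Units.mulLeft hu.unit) x = ((u * x.val : ℕ) : ZMod d) := by simp
    rw [h4, jacobiSym_val_natCast d dvd_rfl]
    push_cast
    rw [jacobiSym.mul_left, ZMod.natCast_zmod_val]
    push_cast
    rw [mul_assoc, mul_assoc]
  by_cases hk : IsUnit (k : ZMod d)
  · have h1 := hsub k hk 1
    have h2 : (jacobiSym k d : ℂ) ^ 2 = 1 := by
      have := jacobiSym.sq_one (a := k) (b := d) (by
        rw [ZMod.isUnit_iff_coprime] at hk
        simpa using hk)
      exact_mod_cast congrArg (Int.cast : ℤ → ℂ) this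
    rw [h1, one_mul, ← mul_assoc, ← sq, h2, one_mul]
  · have h0 : jacobiSym k d = 0 := by
      rw [jacobiSym.eq_zero_iff_not_coprime]
      rw [ZMod.isUnit_iff_coprime] at hk
      simpa using hk
    rw [h0, Int.cast_zero, zero_mul]
    rw [ZMod.isUnit_iff_coprime] at hk
    obtain ⟨p, hp, hpk, m, hm⟩ := Nat.Prime.not_coprime_iff_dvd.1 hk
    have hm0 : m ≠ 0 := by rintro rfl; exact NeZero.ne d (by simpa using hm)
    have hp2 : p ≠ 2 := by
      rintro rfl
      rw [hm] at hodd
      exact absurd (Nat.odd_mul.1 hodd).1 (by decide)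
    obtain ⟨u, hu, hu1⟩ := exists_jacobiSym_eq_neg_one hp hp2
      (Nat.coprime_of_squarefree_mul (hm ▸ hd)) hm0
    rw [← hm] at hu
    have hu' := isUnit_of_jacobiSym_eq_neg_one hu
    have hku : (k : ZMod d) * u = k := by
      rw [← Nat.cast_mul, ZMod.natCast_eq_natCast_iff, hm]
      obtain ⟨q, rfl⟩ := hpk
      have := (hu1.mul_left' (p)).mul_left q
      rw [mul_one] at this
      simpa [mul_comm, mul_assoc, mul_left_comm] using this
    have h1 := hsub u hu' k
    rw [hku, hu] at h1
    push_cast at h1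
    have h2 : (2 : ℂ) * jacobiGauss d d k = 0 := by linear_combination h1
    exact (mul_eq_zero.1 h2).resolve_left two_ne_zero

/-- The finite sine transform of the Jacobi symbol. -/
lemma sum_jacobiSym_mul_sin (hd : Squarefree d) (h3 : d % 4 = 3) (k : ℕ) :
    ∑ n ∈ Finset.range d, (jacobiSym n d : ℝ) * Real.sin (2 * π * k * (n / d))
      = jacobiSym k d * √d := by
  have h1 := jacobiGauss_eq d hd (Nat.odd_iff.2 (by omega)) k
  rw [jacobiGauss_one d hd h3, jacobiGauss,
    ← sum_range_natCast_zmod d fun x =>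
      (jacobiSym x.val d : ℂ) * ZMod.stdAddChar ((k : ZMod d) * x)] at h1
  have h2 := congrArg Complex.im h1
  rw [Complex.im_sum] at h2
  rw [show (jacobiSym k d : ℂ) * (I * (√d : ℝ)) = ((jacobiSym k d * √d : ℝ) : ℂ) * I by
    push_cast; ring, im_ofReal_mul, I_im, mul_one] at h2
  rw [← h2]
  refine Finset.sum_congr rfl fun n _ => ?_
  rw [jacobiSym_val_natCast d dvd_rfl, ← Nat.cast_mul]
  have := ZMod.stdAddChar_coe (N := d) ((k * n : ℕ) : ℤ)
  rw [Int.cast_natCast] at this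
  rw [this, ← ofReal_intCast, im_ofReal_mul]
  congr 1
  rw [show (2 * π * I * (((k * n : ℕ) : ℤ) : ℂ) / d : ℂ)
    = ((2 * π * k * (n / d) : ℝ) : ℂ) * I by push_cast; ring, exp_ofReal_mul_I_im]

end JacobiGauss

/-! ### The Fourier series of the sawtooth function -/

lemma sin_mul_dirichlet_kernel (x : ℝ) (K : ℕ) :
    sin (π * x) * (1 + ∑ k ∈ Finset.range K, 2 * cos (2 * π * (k + 1) * x))
      = sin ((2 * K + 1) * π * x) := by
  induction K with
  | zero => simp
  | succ K ih =>
    rw [Finset.sum_range_succ, ← add_assoc, mul_add, ih]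
    have h1 : (2 * K + 1) * π * x = 2 * π * (K + 1) * x - π * x := by ring
    have h2 : (2 * (K + 1 : ℕ) + 1) * π * x = 2 * π * (K + 1) * x + π * x := by push_cast; ring
    rw [h1, h2, sin_sub, sin_add]
    ring

/-- The difference of the sawtooth function and a partial sum of its Fourier series. -/
noncomputable def sawtoothRemainder (K : ℕ) (x : ℝ) : ℝ :=
  x - 1 / 2 + ∑ k ∈ Finset.range K, sin (2 * π * (k + 1) * x) / (π * (k + 1))

lemma hasDerivAt_sawtoothRemainder (K : ℕ) (x : ℝ) :
    HasDerivAt (sawtoothRemainder K)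
      (1 + ∑ k ∈ Finset.range K, 2 * cos (2 * π * (k + 1) * x)) x := by
  refine ((hasDerivAt_id x).sub_const _).add (HasDerivAt.fun_sum fun k _ => ?_)
  have h1 : HasDerivAt (fun x : ℝ => 2 * π * (k + 1) * x) (2 * π * (k + 1)) x := by
    simpa using (hasDerivAt_id x).const_mul (2 * π * ((k : ℝ) + 1))
  have h2 := h1.sin.div_const (π * ((k : ℝ) + 1))
  have : (k : ℝ) + 1 ≠ 0 := by positivity
  exact h2.congr_deriv (by field_simp)

lemma sawtoothRemainder_half (K : ℕ) : sawtoothRemainder K (1 / 2) = 0 := by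
  rw [sawtoothRemainder, sub_self, zero_add]
  refine Finset.sum_eq_zero fun k _ => ?_
  rw [show 2 * π * ((k : ℝ) + 1) * (1 / 2) = ((k + 1 : ℕ) : ℝ) * π by push_cast; ring,
    sin_nat_mul_pi, zero_div]

lemma sawtoothRemainder_one_sub (K : ℕ) (x : ℝ) :
    sawtoothRemainder K (1 - x) = -sawtoothRemainder K x := by
  rw [sawtoothRemainder, sawtoothRemainder, neg_add, ← Finset.sum_neg_distrib]
  congr 1
  · ring
  · refine Finset.sum_congr rfl fun k _ => ?_
    rw [show 2 * π * ((k : ℝ) + 1) * (1 - x)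
      = ((k + 1 : ℕ) : ℝ) * (2 * π) - 2 * π * (k + 1) * x by push_cast; ring,
      sin_nat_mul_two_pi_sub, neg_div]

lemma abs_sawtoothRemainder_le_of_le_half (K : ℕ) {x : ℝ} (hx : 0 < x) (hx2 : x ≤ 1 / 2) :
    |sawtoothRemainder K x| ≤ 1 / ((2 * K + 1) * x) := by
  set c : ℝ := (2 * K + 1) * π with hc
  have hcpos : 0 < c := by positivity
  let h : ℝ → ℝ := fun t => (c * sin (π * t))⁻¹
  let g : ℝ → ℝ := fun t => sawtoothRemainder K t + cos (c * t) * h t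
  have hsin : ∀ t ∈ Set.Icc x (1 / 2), 0 < sin (π * t) := by
    intro t ht
    refine sin_pos_of_pos_of_lt_pi (mul_pos pi_pos (hx.trans_le ht.1)) ?_
    nlinarith [pi_pos, ht.2]
  have hh : ∀ t ∈ Set.Icc x (1 / 2),
      HasDerivAt h (-(c * (π * cos (π * t))) / (c * sin (π * t)) ^ 2) t := by
    intro t ht
    have h1 : HasDerivAt (fun t : ℝ => π * t) π t := by
      simpa using (hasDerivAt_id t).const_mul π
    have h2 := (h1.sin.const_mul c).fun_inv (mul_pos hcpos (hsin t ht)).ne'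
    exact h2.congr_deriv (by ring)
  have hh0 : ∀ t ∈ Set.Icc x (1 / 2),
      -(c * (π * cos (π * t))) / (c * sin (π * t)) ^ 2 ≤ 0 := by
    intro t ht
    have : 0 ≤ cos (π * t) := by
      refine cos_nonneg_of_neg_pi_div_two_le_of_le ?_ ?_ <;>
        nlinarith [pi_pos, ht.2, hx.trans_le ht.1]
    refine div_nonpos_of_nonpos_of_nonneg ?_ (sq_nonneg _)
    have := pi_pos
    rw [neg_nonpos]
    positivity
  have hg : ∀ t ∈ Set.Icc x (1 / 2), HasDerivAt g
      (cos (c * t) * (-(c * (π * cos (π * t))) / (c * sin (π * t)) ^ 2)) t := by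
    intro t ht
    have h1 : HasDerivAt (fun t : ℝ => c * t) c t := by
      simpa using (hasDerivAt_id t).const_mul c
    have h2 := (hasDerivAt_sawtoothRemainder K t).add (h1.cos.mul (hh t ht))
    refine h2.congr_deriv ?_
    have h3 := sin_mul_dirichlet_kernel t K
    have h4 := (hsin t ht).ne'
    rw [mul_comm, ← eq_div_iff h4] at h3
    rw [h3, ← hc]
    simp only [h]
    field_simp
    ring
  have hmem : x ∈ Set.Icc x (1 / 2) := ⟨le_rfl, hx2⟩
  have hmem2 : (1 / 2 : ℝ) ∈ Set.Icc x (1 / 2) := ⟨hx2, le_rfl⟩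
  have hg2 : g (1 / 2) = 0 := by
    simp only [g]
    rw [sawtoothRemainder_half, show c * (1 / 2) = (K : ℝ) * π + π / 2 by rw [hc]; ring,
      cos_add_pi_div_two, sin_nat_mul_pi]
    simp
  have hhpos : 0 < h (1 / 2) := inv_pos.2 (mul_pos hcpos (hsin _ hmem2))
  have hint : interior (Set.Icc x (1 / 2)) ⊆ Set.Icc x (1 / 2) := interior_subset
  have m1 : AntitoneOn (fun t => g t + h t) (Set.Icc x (1 / 2)) := by
    refine antitoneOn_of_hasDerivWithinAt_nonpos (convex_Icc _ _)
      (fun t ht => ((hg t ht).add (hh t ht)).continuousAt.continuousWithinAt)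
      (fun t ht => ((hg t (hint ht)).add (hh t (hint ht))).hasDerivWithinAt) fun t ht => ?_
    nlinarith [hh0 t (hint ht), neg_one_le_cos (c * t)]
  have m2 : MonotoneOn (fun t => g t - h t) (Set.Icc x (1 / 2)) := by
    refine monotoneOn_of_hasDerivWithinAt_nonneg (convex_Icc _ _)
      (fun t ht => ((hg t ht).sub (hh t ht)).continuousAt.continuousWithinAt)
      (fun t ht => ((hg t (hint ht)).sub (hh t (hint ht))).hasDerivWithinAt) fun t ht => ?_
    nlinarith [hh0 t (hint ht), cos_le_one (c * t)]
  have e1 := m1 hmem hmem2 hx2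
  have e2 := m2 hmem hmem2 hx2
  simp only [hg2] at e1 e2
  have hgx : |g x| ≤ h x := abs_le.2 ⟨by linarith, by linarith⟩
  have hhx : 0 < h x := inv_pos.2 (mul_pos hcpos (hsin _ hmem))
  have hfx : |sawtoothRemainder K x| ≤ 2 * h x := by
    have : sawtoothRemainder K x = g x - cos (c * x) * h x := by simp only [g]; ring
    rw [this]
    calc _ ≤ |g x| + |cos (c * x) * h x| := abs_sub _ _
      _ ≤ h x + 1 * h x := by
        rw [abs_mul, abs_of_pos hhx]
        gcongr
        exact abs_cos_le_one _
      _ = 2 * h x := by ring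
  refine hfx.trans ?_
  have hs : 2 * x ≤ sin (π * x) := by
    have := mul_le_sin (x := π * x) (by positivity) (by nlinarith [pi_pos])
    have e : 2 / π * (π * x) = 2 * x := by field_simp
    linarith
  have hKx : 0 < (2 * (K : ℝ) + 1) * x := by positivity
  have : 2 * ((2 * K + 1) * x) ≤ c * sin (π * x) := by
    have hp : (1 : ℝ) ≤ π := by linarith [pi_gt_three]
    calc 2 * ((2 * K + 1) * x) = (2 * K + 1) * 1 * (2 * x) := by ring
      _ ≤ (2 * K + 1) * π * sin (π * x) := by gcongr
  simp only [h]
  rw [← one_div, mul_one_div, div_le_div_iff₀ (mul_pos hcpos (hsin _ hmem)) hKx]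
  linarith

lemma abs_sawtoothRemainder_le (K : ℕ) {x : ℝ} (hx : 0 < x) (hx1 : x < 1) :
    |sawtoothRemainder K x| ≤ (1 / x + 1 / (1 - x)) / (2 * K + 1) := by
  have hx1' : 0 < 1 - x := by linarith
  rcases le_total x (1 / 2) with h | h
  · refine (abs_sawtoothRemainder_le_of_le_half K hx h).trans ?_
    rw [mul_comm, ← div_div]
    gcongr
    have : 0 < 1 / (1 - x) := by positivity
    linarith
  · rw [← abs_neg, ← sawtoothRemainder_one_sub]
    refine (abs_sawtoothRemainder_le_of_le_half K hx1' (by linarith)).trans ?_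
    rw [mul_comm, ← div_div]
    gcongr
    have : 0 < 1 / x := by positivity
    linarith

lemma sum_range_one_div_le (n : ℕ) : ∑ k ∈ Finset.range n, 1 / ((k : ℝ) + 1) ≤ 1 + log n := by
  have := harmonic_le_one_add_log n
  rw [harmonic] at this
  push_cast at this
  simpa using this

/-- The truncated class number formula. -/
lemma abs_jacobiMoment_sub_le {d : ℕ} (hd : Squarefree d) (h3 : d % 4 = 3) {K : ℕ} (hK : 0 < K) :
    |jacobiMoment d - √d / π * ∑ k ∈ Finset.range K, (jacobiSym (k + 1 : ℕ) d : ℝ) / (k + 1)|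
      ≤ d * (1 + log d) / K := by
  have hd0 : d ≠ 0 := by omega
  have : NeZero d := ⟨hd0⟩
  have hdr : (0 : ℝ) < d := by positivity
  have hd1 : d ≠ 1 := by omega
  have hodd : Odd d := Nat.odd_iff.2 (by omega)
  have hS := sum_range_jacobiSym hd hodd hd1
  have e1 : jacobiMoment d - √d / π * ∑ k ∈ Finset.range K,
      (jacobiSym (k + 1 : ℕ) d : ℝ) / (k + 1)
      = -∑ n ∈ Finset.range d, (jacobiSym n d : ℝ) * sawtoothRemainder K (n / d) := by
    have e2 : ∑ n ∈ Finset.range d, (jacobiSym n d : ℝ) * sawtoothRemainder K (n / d)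
        = (∑ n ∈ Finset.range d, (n : ℝ) * (jacobiSym n d : ℝ)) / d
          - 1 / 2 * ∑ n ∈ Finset.range d, (jacobiSym n d : ℝ)
          + ∑ k ∈ Finset.range K, (∑ n ∈ Finset.range d, (jacobiSym n d : ℝ)
              * sin (2 * π * (k + 1 : ℕ) * (n / d))) / (π * (k + 1)) := by
      simp only [Finset.sum_div, Finset.mul_sum]
      rw [Finset.sum_comm (s := Finset.range K), ← Finset.sum_sub_distrib,
        ← Finset.sum_add_distrib]
      refine Finset.sum_congr rfl fun n _ => ?_
      rw [sawtoothRemainder, mul_add, Finset.mul_sum]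
      congr 1
      · ring
      · refine Finset.sum_congr rfl fun k _ => ?_
        push_cast
        ring
    rw [e2, hS]
    simp only [sum_jacobiSym_mul_sin d hd h3]
    rw [jacobiMoment, Finset.mul_sum, mul_zero, sub_zero, neg_add, neg_div, sub_eq_add_neg,
      ← Finset.sum_neg_distrib, ← Finset.sum_neg_distrib]
    congr 1
    refine Finset.sum_congr rfl fun k _ => ?_
    have : (k : ℝ) + 1 ≠ 0 := by positivity
    field_simp
  rw [e1, abs_neg]
  obtain ⟨m, rfl⟩ := Nat.exists_eq_succ_of_ne_zero hd0
  rw [Nat.succ_eq_add_one] at *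
  rw [Finset.sum_range_succ']
  have hz : jacobiSym ((0 : ℕ) : ℤ) (m + 1) = 0 := jacobiSym_zero_of_ne_one hd1 hd0
  rw [hz, Int.cast_zero, zero_mul, add_zero]
  have hb : ∀ n ∈ Finset.range m, |(jacobiSym (n + 1 : ℕ) (m + 1) : ℝ)
      * sawtoothRemainder K ((n + 1 : ℕ) / (m + 1 : ℕ))|
      ≤ ((m + 1 : ℕ) : ℝ) / (2 * K + 1) * (1 / ((n : ℝ) + 1) + 1 / (((m - 1 - n : ℕ) : ℝ) + 1)) := by
    intro n hn
    have hnm := Finset.mem_range.1 hn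
    have hj : |(jacobiSym (n + 1 : ℕ) (m + 1) : ℝ)| ≤ 1 := by
      rcases jacobiSym.trichotomy (n + 1 : ℕ) (m + 1) with h | h | h <;> rw [h] <;> simp
    have hlt : (((n + 1 : ℕ) : ℝ) / (m + 1 : ℕ)) < 1 := by
      rw [div_lt_one hdr]
      exact_mod_cast Nat.succ_lt_succ hnm
    have h1 := abs_sawtoothRemainder_le K (x := ((n + 1 : ℕ) : ℝ) / (m + 1 : ℕ)) (by positivity) hlt
    rw [abs_mul]
    refine (mul_le_of_le_one_left (abs_nonneg _) hj).trans (h1.trans (le_of_eq ?_))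
    have hc : ((m - 1 - n : ℕ) : ℝ) + 1 = ((m + 1 : ℕ) : ℝ) - ((n + 1 : ℕ) : ℝ) := by
      rw [eq_sub_iff_add_eq]
      have : m - 1 - n + 1 + (n + 1) = m + 1 := by omega
      exact_mod_cast this
    have hne : ((m + 1 : ℕ) : ℝ) - ((n + 1 : ℕ) : ℝ) ≠ 0 := by
      rw [← hc]; positivity
    have hne' : (1 : ℝ) - ((n + 1 : ℕ) : ℝ) / (m + 1 : ℕ) ≠ 0 := by linarith
    rw [hc]
    have h5 : (1 : ℝ) / (1 - ((n + 1 : ℕ) : ℝ) / (m + 1 : ℕ))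
        = (m + 1 : ℕ) * (1 / (((m + 1 : ℕ) : ℝ) - ((n + 1 : ℕ) : ℝ))) := by
      rw [one_sub_div hdr.ne', one_div_div, mul_one_div]
    rw [h5, one_div_div]
    push_cast
    field_simp
  refine (Finset.abs_sum_le_sum_abs _ _).trans ((Finset.sum_le_sum hb).trans ?_)
  rw [← Finset.mul_sum, Finset.sum_add_distrib,
    Finset.sum_range_reflect (fun n => 1 / ((n : ℝ) + 1)) m]
  have h1 := sum_range_one_div_le m
  have h2 : log m ≤ log (m + 1 : ℕ) := by
    rcases Nat.eq_zero_or_pos m with h | h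
    · omega
    · exact log_le_log (by positivity) (by push_cast; linarith)
  have hlog : 0 ≤ log (m + 1 : ℕ) := log_natCast_nonneg _
  have hKr : (0 : ℝ) < K := by positivity
  calc ((m + 1 : ℕ) : ℝ) / (2 * K + 1) * (∑ k ∈ Finset.range m, 1 / ((k : ℝ) + 1)
        + ∑ k ∈ Finset.range m, 1 / ((k : ℝ) + 1))
      ≤ ((m + 1 : ℕ) : ℝ) / (2 * K) * (2 * (1 + log (m + 1 : ℕ))) := by
        gcongr
        · linarith
        · linarith
    _ = _ := by field_simp

/-! ### Nonnegativity of the moments of the Jacobi symbol -/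

/-- Abel's inequality. -/
lemma abs_sum_range_mul_le {f a : ℕ → ℝ} (hf : Antitone f) (hf0 : ∀ n, 0 ≤ f n) {B : ℝ}
    (ha : ∀ n, |∑ k ∈ Finset.range n, a k| ≤ B) (n : ℕ) :
    |∑ k ∈ Finset.range n, f k * a k| ≤ f 0 * B := by
  have hB : 0 ≤ B := (abs_nonneg _).trans (ha 0)
  have key : ∀ n, |∑ k ∈ Finset.range n, f k * a k - f n * ∑ k ∈ Finset.range n, a k|
      ≤ (f 0 - f n) * B := by
    intro n
    induction n with
    | zero => simp
    | succ n ih =>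
      have h1 := hf (Nat.le_succ n)
      have h2 := ha (n + 1)
      have e : ∑ k ∈ Finset.range (n + 1), f k * a k
            - f (n + 1) * ∑ k ∈ Finset.range (n + 1), a k
          = (∑ k ∈ Finset.range n, f k * a k - f n * ∑ k ∈ Finset.range n, a k)
            + (f n - f (n + 1)) * ∑ k ∈ Finset.range (n + 1), a k := by
        rw [Finset.sum_range_succ, Finset.sum_range_succ]
        ring
      rw [e]
      refine (abs_add_le _ _).trans ?_
      rw [abs_mul, abs_of_nonneg (sub_nonneg.2 h1)]
      have := mul_le_mul_of_nonneg_left h2 (sub_nonneg.2 h1)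
      simp only [Nat.succ_eq_add_one] at *
      linarith
  have h1 : |f n * ∑ k ∈ Finset.range n, a k| ≤ f n * B := by
    rw [abs_mul, abs_of_nonneg (hf0 n)]
    exact mul_le_mul_of_nonneg_left (ha n) (hf0 n)
  have h2 := abs_add_le (∑ k ∈ Finset.range n, f k * a k - f n * ∑ k ∈ Finset.range n, a k)
    (f n * ∑ k ∈ Finset.range n, a k)
  rw [sub_add_cancel] at h2
  linarith [key n]

lemma abs_jacobiSym_le_one (a : ℤ) (b : ℕ) : |(jacobiSym a b : ℝ)| ≤ 1 := by
  rcases jacobiSym.trichotomy a b with h | h | h <;> rw [h] <;> simp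

lemma abs_sum_range_jacobiSym_le {d : ℕ} (hd : Squarefree d) (hodd : Odd d) (h1 : d ≠ 1) (m : ℕ) :
    |∑ n ∈ Finset.range m, (jacobiSym n d : ℝ)| ≤ d := by
  have hper : ∀ n : ℕ, (jacobiSym ((n + d : ℕ) : ℤ) d : ℝ) = jacobiSym n d := fun n => by
    rw [jacobiSym_add_self]
  rw [← Nat.div_add_mod m d,
    sum_range_periodic_add (f := fun n => (jacobiSym n d : ℝ)) hper, sum_range_jacobiSym hd hodd h1,
    mul_zero, zero_add]
  calc |∑ n ∈ Finset.range (m % d), (jacobiSym n d : ℝ)|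
      ≤ ∑ n ∈ Finset.range (m % d), |(jacobiSym n d : ℝ)| := Finset.abs_sum_le_sum_abs _ _
    _ ≤ ∑ n ∈ Finset.range (m % d), (1 : ℝ) :=
        Finset.sum_le_sum fun n _ => abs_jacobiSym_le_one _ _
    _ ≤ d := by
        rw [Finset.sum_const, Finset.card_range, nsmul_one]
        exact_mod_cast (Nat.mod_lt m hodd.pos).le

/-- The Jacobi symbol as an arithmetic function of its numerator. -/
def jacobiArith (d : ℕ) : ArithmeticFunction ℝ where
  toFun n := if n = 0 then 0 else (jacobiSym n d : ℝ)
  map_zero' := rfl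

lemma jacobiArith_apply {d n : ℕ} (hn : n ≠ 0) : jacobiArith d n = (jacobiSym n d : ℝ) :=
  if_neg hn

lemma isMultiplicative_jacobiArith (d : ℕ) : (jacobiArith d).IsMultiplicative := by
  rw [ArithmeticFunction.IsMultiplicative.iff_ne_zero]
  refine ⟨by simp [jacobiArith_apply one_ne_zero], fun {m n} hm hn _ => ?_⟩
  rw [jacobiArith_apply hm, jacobiArith_apply hn, jacobiArith_apply (mul_ne_zero hm hn)]
  push_cast
  rw [jacobiSym.mul_left]
  push_cast
  rfl

lemma jacobiArith_mul_zeta_nonneg (d n : ℕ) :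
    0 ≤ (jacobiArith d * (ArithmeticFunction.zeta : ArithmeticFunction ℝ)) n := by
  rcases eq_or_ne n 0 with rfl | hn
  · simp
  rw [((isMultiplicative_jacobiArith d).mul
    ArithmeticFunction.isMultiplicative_zeta.natCast).multiplicative_factorization _ hn]
  refine Finset.prod_nonneg fun p hp => ?_
  have hp := Nat.prime_of_mem_primeFactors hp
  beta_reduce
  rw [ArithmeticFunction.coe_mul_zeta_apply, Nat.sum_divisors_prime_pow hp]
  have e : ∀ i, jacobiArith d (p ^ i) = (jacobiSym p d : ℝ) ^ i := fun i => by
    rw [jacobiArith_apply (pow_ne_zero _ hp.ne_zero)]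
    push_cast
    rw [jacobiSym.pow_left]
    push_cast
    rfl
  simp only [e]
  rcases jacobiSym.trichotomy p d with h | h | h <;> rw [h]
  · exact Finset.sum_nonneg fun i _ => by simp
  · exact Finset.sum_nonneg fun i _ => by simp
  · push_cast
    rw [neg_one_geom_sum]
    split_ifs <;> norm_num

lemma sum_Ioc_zero_eq_sum_range (f : ℕ → ℝ) (n : ℕ) :
    ∑ k ∈ Finset.Ioc 0 n, f k = ∑ k ∈ Finset.range n, f (k + 1) := by
  induction n with
  | zero => simp
  | succ n ih => rw [Finset.sum_range_succ, Finset.sum_Ioc_succ_top (Nat.zero_le n), ih]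

lemma neg_le_sum_jacobiSym_div {d : ℕ} (hd : Squarefree d) (hodd : Odd d) (h1 : d ≠ 1) {K : ℕ}
    (hK : 0 < K) :
    -((2 * d + 1) / K) ≤ ∑ k ∈ Finset.range K, (jacobiSym (k + 1 : ℕ) d : ℝ) / (k + 1) := by
  set N := K * K with hN
  have hKr : (0 : ℝ) < K := by positivity
  have h0 : 0 ≤ ∑ k ∈ Finset.range N, (jacobiSym (k + 1 : ℕ) d : ℝ) * (N / (k + 1) : ℕ) := by
    have := Finset.sum_nonneg fun n (_ : n ∈ Finset.Ioc 0 N) => jacobiArith_mul_zeta_nonneg d n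
    rw [ArithmeticFunction.sum_Ioc_mul_zeta_eq_sum, sum_Ioc_zero_eq_sum_range] at this
    refine this.trans_eq (Finset.sum_congr rfl fun k _ => ?_)
    rw [jacobiArith_apply k.succ_ne_zero]
  obtain ⟨r, hr⟩ : ∃ r, N = K + r := ⟨N - K, by nlinarith [Nat.sub_add_cancel (Nat.le_mul_self K)]⟩
  rw [show Finset.range N = Finset.range (K + r) by rw [hr], Finset.sum_range_add] at h0
  have e1 : ∑ k ∈ Finset.range K, (jacobiSym (k + 1 : ℕ) d : ℝ) * (N / (k + 1) : ℕ)
      ≤ N * ∑ k ∈ Finset.range K, (jacobiSym (k + 1 : ℕ) d : ℝ) / (k + 1) + K := by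
    have : (K : ℝ) = ∑ k ∈ Finset.range K, 1 := by simp
    rw [Finset.mul_sum, this, ← Finset.sum_add_distrib]
    refine Finset.sum_le_sum fun k _ => ?_
    have a1 : ((N / (k + 1) : ℕ) : ℝ) ≤ N / (k + 1) := by exact_mod_cast Nat.cast_div_le
    have a2 : (N : ℝ) / (k + 1) ≤ (N / (k + 1) : ℕ) + 1 := by
      rw [div_le_iff₀ (by positivity)]
      have := Nat.lt_mul_div_succ N k.succ_pos
      rw [mul_comm] at this
      exact_mod_cast this.le
    have e : (N : ℝ) * ((jacobiSym (k + 1 : ℕ) d : ℝ) / (k + 1))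
        = (jacobiSym (k + 1 : ℕ) d : ℝ) * (N / (k + 1)) := by ring
    rw [e]
    rcases jacobiSym.trichotomy (k + 1 : ℕ) d with h | h | h <;> rw [h] <;> push_cast <;> linarith
  have e2 : |∑ k ∈ Finset.range r, ((N / (K + k + 1) : ℕ) : ℝ) * (jacobiSym (K + k + 1 : ℕ) d : ℝ)|
      ≤ ((N / (K + 0 + 1) : ℕ) : ℝ) * (2 * d) := by
    refine abs_sum_range_mul_le (f := fun k => ((N / (K + k + 1) : ℕ) : ℝ))
      (a := fun k => (jacobiSym (K + k + 1 : ℕ) d : ℝ)) (fun a b hab => ?_)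
      (fun n => Nat.cast_nonneg _) (fun n => ?_) r
    · have : N / (K + b + 1) ≤ N / (K + a + 1) := Nat.div_le_div_left (by omega) (by omega)
      exact Nat.cast_le.2 this
    · have h := Finset.sum_range_add (fun n : ℕ => (jacobiSym n d : ℝ)) (K + 1) n
      have h2 := abs_sum_range_jacobiSym_le hd hodd h1 (K + 1 + n)
      have h3 := abs_sum_range_jacobiSym_le hd hodd h1 (K + 1)
      have e : ∀ k, K + k + 1 = K + 1 + k := fun k => by ring
      simp only [e]
      rw [abs_le] at *
      constructor <;> linarith
  have e3 : ((N / (K + 0 + 1) : ℕ) : ℝ) * (2 * d) ≤ K * (2 * d) := by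
    gcongr
    refine Nat.div_le_of_le_mul ?_
    rw [hN]
    nlinarith
  have e4 : ∑ k ∈ Finset.range r, (jacobiSym (K + k + 1 : ℕ) d : ℝ) * (N / (K + k + 1) : ℕ)
      ≤ K * (2 * d) := by
    simp only [mul_comm (jacobiSym _ d : ℝ)]
    exact (le_abs_self _).trans (e2.trans e3)
  have h5 : 0 ≤ (K : ℝ) * (K * ∑ k ∈ Finset.range K, (jacobiSym (k + 1 : ℕ) d : ℝ) / (k + 1)
      + (2 * d + 1)) := by
    rw [hN] at h0 e1 e4
    push_cast at h0 e1 e4 ⊢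
    linarith
  have h6 := nonneg_of_mul_nonneg_right h5 hKr
  rw [← neg_div, div_le_iff₀ hKr]
  linarith

lemma jacobiMoment_nonneg {d : ℕ} (hd : Squarefree d) (h3 : d % 4 = 3) : 0 ≤ jacobiMoment d := by
  set C : ℝ := √d / π * (2 * d + 1) + d * (1 + log d) with hC
  have key : ∀ K : ℕ, 0 < K → -(C / K) ≤ jacobiMoment d := by
    intro K hK
    have h1 := (abs_le.1 (abs_jacobiMoment_sub_le hd h3 hK)).1
    have h2 := mul_le_mul_of_nonneg_left
      (neg_le_sum_jacobiSym_div hd (Nat.odd_iff.2 (by omega)) (by omega) hK)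
      (show 0 ≤ √(d : ℝ) / π by positivity)
    have e : -(C / K) = √d / π * -((2 * d + 1) / K) - d * (1 + log d) / K := by rw [hC]; ring
    rw [e]
    linarith
  have hl : Tendsto (fun K : ℕ => -(C / K)) atTop (nhds (-0)) :=
    (tendsto_const_div_atTop_nhds_zero_nat C).neg
  rw [neg_zero] at hl
  exact le_of_tendsto hl ((eventually_gt_atTop 0).mono key)

/-! ### Sums of Jacobi symbols over squarefree denominators -/

lemma exists_jacobiSym_eq_neg_one_of_not_isSquare {k : ℕ} (hodd : Odd k) (hk : ¬IsSquare k) :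
    ∃ u : ℕ, jacobiSym u k = -1 := by
  obtain ⟨b, s, rfl, hb⟩ := Nat.sq_mul_squarefree k
  have hbodd : Odd b := (Nat.odd_mul.1 hodd).2
  have hs0 : s ≠ 0 := by rintro rfl; simp at hodd
  have hb1 : b ≠ 1 := by
    rintro rfl
    exact hk ⟨s, by ring⟩
  obtain ⟨p, hp, m, rfl⟩ := Nat.exists_prime_and_dvd hb1
  have hm : m ≠ 0 := by rintro rfl; simp at hb
  have hp2 : p ≠ 2 := by rintro rfl; exact absurd (Nat.odd_mul.1 hbodd).1 (by decide)
  have : NeZero (p * m) := ⟨hb.ne_zero⟩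
  have : NeZero s := ⟨hs0⟩
  obtain ⟨u, hu, -⟩ := exists_jacobiSym_eq_neg_one hp hp2 (Nat.coprime_of_squarefree_mul hb) hm
  obtain ⟨q, hqs, hq, hqu⟩ :=
    Nat.forall_exists_prime_gt_and_eq_mod (isUnit_of_jacobiSym_eq_neg_one hu) s
  refine ⟨q, ?_⟩
  have h1 : jacobiSym q (p * m) = -1 := by
    rw [← hu]
    exact jacobiSym.mod_left' (by exact_mod_cast (ZMod.natCast_eq_natCast_iff _ _ _).1 hqu)
  have h2 : jacobiSym q s ^ 2 = 1 := by
    refine jacobiSym.sq_one ?_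
    rw [Int.gcd_natCast_natCast]
    exact (Nat.Prime.coprime_iff_not_dvd hq).2
      fun h => absurd (Nat.le_of_dvd (Nat.pos_of_ne_zero hs0) h) (by omega)
  rw [jacobiSym.mul_right, jacobiSym.pow_right, h2, h1, one_mul]

lemma sum_range_filter_mod_eight (g : ℕ → ℝ) (z : ℕ) :
    ∑ f ∈ Finset.range (z + 1) with f % 8 = 3, g f
      = ∑ m ∈ Finset.range ((z + 5) / 8), g (8 * m + 3) := by
  refine Finset.sum_nbij' (fun f => f / 8) (fun m => 8 * m + 3) ?_ ?_ ?_ ?_ ?_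
  · intro f hf
    simp only [Finset.mem_filter, Finset.mem_range] at hf ⊢
    omega
  · intro m hm
    simp only [Finset.mem_filter, Finset.mem_range] at hm ⊢
    omega
  · intro f hf
    simp only [Finset.mem_filter, Finset.mem_range] at hf
    omega
  · intro m hm
    omega
  · intro f hf
    simp only [Finset.mem_filter, Finset.mem_range] at hf
    congr 1
    omega

lemma abs_sum_jacobiSym_le {k : ℕ} (hk0 : k ≠ 0) (hk : ¬IsSquare k) (hk2 : ¬IsSquare (2 * k))
    (z : ℕ) :
    |∑ f ∈ Finset.range (z + 1) with f % 8 = 3, (jacobiSym k f : ℝ)| ≤ k := by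
  obtain ⟨a, k', hodd, rfl⟩ := Nat.exists_eq_two_pow_mul_odd hk0
  have hk' : ¬IsSquare k' := by
    rintro ⟨r, rfl⟩
    rcases Nat.even_or_odd' a with ⟨c, rfl | rfl⟩
    · exact hk ⟨2 ^ c * r, by ring⟩
    · exact hk2 ⟨2 ^ (c + 1) * r, by ring⟩
  obtain ⟨u, hu⟩ := exists_jacobiSym_eq_neg_one_of_not_isSquare hodd hk'
  have : NeZero k' := ⟨by rintro rfl; simp at hk0⟩
  rw [sum_range_filter_mod_eight (fun f => (jacobiSym (2 ^ a * k' : ℕ) f : ℝ))]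
  have e : ∀ m : ℕ, (jacobiSym (2 ^ a * k' : ℕ) (8 * m + 3) : ℝ)
      = (-1) ^ a * (-1) ^ (k' / 2) * (jacobiSym (8 * m + 3 : ℕ) k' : ℝ) := by
    intro m
    have ho : Odd (8 * m + 3) := Nat.odd_iff.2 (by omega)
    have h2 : jacobiSym 2 (8 * m + 3) = -1 := by
      rw [jacobiSym.at_two ho, ZMod.χ₈_nat_eq_if_mod_eight, if_neg (by omega), if_neg (by omega)]
    have h3 : (8 * m + 3) / 2 = 2 * (2 * m) + 1 := by omega
    have h4 : ((-1 : ℤ) ^ (k' / 2 * (2 * (2 * m) + 1))) = (-1) ^ (k' / 2) := by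
      rw [mul_comm, pow_mul, pow_succ, pow_mul]
      norm_num
    have h5 := jacobiSym.quadratic_reciprocity hodd ho
    rw [h3, h4] at h5
    rw [Nat.cast_mul, Nat.cast_pow, jacobiSym.mul_left, jacobiSym.pow_left, Nat.cast_ofNat, h2, h5]
    push_cast
    ring
  simp only [e]
  rw [← Finset.mul_sum, abs_mul, abs_mul, abs_pow, abs_pow, abs_neg, abs_one, one_pow, one_pow,
    one_mul, one_mul]
  have hper : ∀ n : ℕ, (jacobiSym (8 * (n + k') + 3 : ℕ) k' : ℝ) = jacobiSym (8 * n + 3 : ℕ) k' := by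
    intro n
    rw [jacobiSym.mod_left' (a₂ := (8 * n + 3 : ℕ))]
    rw [show 8 * (n + k') + 3 = 8 * n + 3 + k' * 8 by ring, Nat.cast_add, Nat.cast_mul,
      Int.add_mul_emod_self_left]
  have hcop : Nat.Coprime 8 k' := by
    rw [show 8 = 2 ^ 3 by norm_num]
    exact Nat.Coprime.pow_left _ (Nat.coprime_two_left.2 hodd)
  set Z := (z + 5) / 8
  rw [← Nat.div_add_mod Z k',
    sum_range_periodic_add (f := fun n => (jacobiSym (8 * n + 3 : ℕ) k' : ℝ)) hper,
    sum_range_jacobiSym_mul_add hu hcop, mul_zero, zero_add]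
  calc |∑ n ∈ Finset.range (Z % k'), (jacobiSym (8 * n + 3 : ℕ) k' : ℝ)|
      ≤ ∑ n ∈ Finset.range (Z % k'), |(jacobiSym (8 * n + 3 : ℕ) k' : ℝ)| :=
        Finset.abs_sum_le_sum_abs _ _
    _ ≤ ∑ n ∈ Finset.range (Z % k'), (1 : ℝ) :=
        Finset.sum_le_sum fun n _ => abs_jacobiSym_le_one _ _
    _ ≤ (2 ^ a * k' : ℕ) := by
        rw [Finset.sum_const, Finset.card_range, nsmul_one]
        have h1 := (Nat.mod_lt Z (NeZero.pos k')).le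
        have h2 : k' ≤ 2 ^ a * k' := Nat.le_mul_of_pos_left _ (by positivity)
        exact_mod_cast h1.trans h2

lemma sum_moebius_sq_dvd {n Y : ℕ} (hn : 0 < n) (hY : n ≤ Y) :
    ∑ e ∈ Finset.range (Y + 1) with e ^ 2 ∣ n, (ArithmeticFunction.moebius e : ℝ)
      = if Squarefree n then 1 else 0 := by
  obtain ⟨b, s, rfl, hb⟩ := Nat.sq_mul_squarefree n
  have hs0 : s ≠ 0 := by rintro rfl; simp at hn
  have hdvd : ∀ e : ℕ, e ^ 2 ∣ s ^ 2 * b → e ∣ s := by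
    intro e he
    have he0 : e ≠ 0 := by
      rintro rfl
      rw [zero_pow two_ne_zero, zero_dvd_iff] at he
      exact hn.ne' he
    rw [← Nat.factorization_le_iff_dvd (pow_ne_zero _ he0) hn.ne',
      Nat.factorization_mul (pow_ne_zero _ hs0) hb.ne_zero, Nat.factorization_pow,
      Nat.factorization_pow] at he
    rw [← Nat.factorization_le_iff_dvd he0 hs0]
    intro p
    have h1 := he p
    have h2 := hb.natFactorization_le_one p
    simp only [Finsupp.coe_add, Pi.add_apply, Finsupp.smul_apply, smul_eq_mul] at h1
    omega
  have e1 : (Finset.range (Y + 1)).filter (fun e => e ^ 2 ∣ s ^ 2 * b) = s.divisors := by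
    ext e
    rw [Finset.mem_filter, Nat.mem_divisors, Finset.mem_range]
    refine ⟨fun h => ⟨hdvd e h.2, hs0⟩, fun h => ⟨?_, (pow_dvd_pow_of_dvd h.1 2).mul_right b⟩⟩
    have h1 := Nat.le_of_dvd (Nat.pos_of_ne_zero hs0) h.1
    have h2 : s ≤ s ^ 2 * b := by
      rw [sq, mul_assoc]
      exact Nat.le_mul_of_pos_right _ (Nat.mul_pos (Nat.pos_of_ne_zero hs0)
        (Nat.pos_of_ne_zero hb.ne_zero))
    omega
  rw [e1]
  have h3 := congrArg (fun f => f s) ArithmeticFunction.moebius_mul_coe_zeta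
  simp only [ArithmeticFunction.coe_mul_zeta_apply, ArithmeticFunction.one_apply] at h3
  have h4 : Squarefree (s ^ 2 * b) ↔ s = 1 := by
    constructor
    · intro h
      exact Nat.isUnit_iff.1 (h s ⟨b, by ring⟩)
    · rintro rfl
      simpa using hb
  rw [← Int.cast_sum, h3]
  simp only [h4]
  split_ifs <;> simp

/-- The squarefree `d ≤ y` congruent to `3` modulo `8`. -/
def sqfreeThree (y : ℕ) : Finset ℕ :=
  (Finset.range (y + 1)).filter fun d => Squarefree d ∧ d % 8 = 3

lemma sum_range_filter_sq_dvd_odd (g : ℕ → ℝ) {e : ℕ} (he : Odd e) (y : ℕ) :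
    ∑ n ∈ Finset.range (y + 1) with n % 8 = 3 ∧ e ^ 2 ∣ n, g n
      = ∑ f ∈ Finset.range (y / e ^ 2 + 1) with f % 8 = 3, g (e ^ 2 * f) := by
  have h8 : e ^ 2 % 8 = 1 := by
    have : e % 8 = 1 ∨ e % 8 = 3 ∨ e % 8 = 5 ∨ e % 8 = 7 := by
      have := Nat.odd_iff.1 he
      omega
    rcases this with h | h | h | h <;> simp [Nat.pow_mod, h]
  have hpos : 0 < e ^ 2 := pow_pos he.pos 2
  have hmod : ∀ f, e ^ 2 * f % 8 = f % 8 := fun f => by rw [Nat.mul_mod, h8, one_mul, Nat.mod_mod]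
  symm
  refine Finset.sum_nbij (fun f => e ^ 2 * f) ?_ ?_ ?_ (fun _ _ => rfl)
  · intro f hf
    simp only [Finset.mem_filter, Finset.mem_range, Nat.lt_succ_iff, hmod] at hf ⊢
    exact ⟨(Nat.mul_comm _ _).trans_le ((Nat.le_div_iff_mul_le hpos).1 hf.1), hf.2,
      Dvd.intro _ rfl⟩
  · intro f _ f' _ h
    exact Nat.eq_of_mul_eq_mul_left hpos h
  · rintro n hn
    simp only [Finset.coe_filter, Finset.mem_range, Set.mem_ofPred_eq, Nat.lt_succ_iff] at hn
    obtain ⟨hn1, hn2, f, rfl⟩ := hn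
    refine ⟨f, ?_, rfl⟩
    simp only [Finset.coe_filter, Finset.mem_range, Set.mem_ofPred_eq, Nat.lt_succ_iff]
    rw [hmod] at hn2
    exact ⟨(Nat.le_div_iff_mul_le hpos).2 (by rwa [Nat.mul_comm]), hn2⟩

lemma sum_range_filter_sq_dvd_even (g : ℕ → ℝ) {e : ℕ} (he : Even e) (y : ℕ) :
    ∑ n ∈ Finset.range (y + 1) with n % 8 = 3 ∧ e ^ 2 ∣ n, g n = 0 := by
  rw [Finset.filter_eq_empty_iff.2, Finset.sum_empty]
  rintro n - ⟨h1, h2⟩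
  have := (even_iff_two_dvd.1 he).trans ((dvd_pow_self e two_ne_zero).trans h2)
  omega

lemma sum_Ico_one_div_sq_le {E : ℕ} (hE : 0 < E) (y : ℕ) :
    ∑ e ∈ Finset.Ico (E + 1) (y + 1), 1 / (e : ℝ) ^ 2 ≤ 1 / (E : ℝ) := by
  have key : ∀ m : ℕ, ∑ e ∈ Finset.Ico (E + 1) (E + 1 + m), 1 / (e : ℝ) ^ 2
      ≤ 1 / (E : ℝ) - 1 / ((E + m : ℕ) : ℝ) := by
    intro m
    induction m with
    | zero => simp
    | succ m ih =>
      rw [← add_assoc, Finset.sum_Ico_succ_top (by omega)]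
      have h1 : 1 / ((E + 1 + m : ℕ) : ℝ) ^ 2 ≤ 1 / ((E + m : ℕ) : ℝ) - 1 / ((E + (m + 1) : ℕ) : ℝ) := by
        have hp : (0 : ℝ) < (E + m : ℕ) := by positivity
        have e1 : ((E + 1 + m : ℕ) : ℝ) = (E + m : ℕ) + 1 := by push_cast; ring
        have e2 : ((E + (m + 1) : ℕ) : ℝ) = (E + m : ℕ) + 1 := by push_cast; ring
        rw [e1, e2, div_sub_div _ _ hp.ne' (by positivity), div_le_div_iff₀ (by positivity)
          (by positivity)]
        nlinarith
      linarith
  rcases le_total E y with h | h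
  · have := key (y - E)
    rw [show E + 1 + (y - E) = y + 1 by omega] at this
    refine this.trans (sub_le_self _ (by positivity))
  · rw [Finset.Ico_eq_empty (by omega), Finset.sum_empty]
    positivity

lemma abs_sum_sqfreeThree_sub_le {g : ℕ → ℝ} (hg : ∀ n, |g n| ≤ 1) {E y : ℕ} (hE : 0 < E)
    (hEy : E ≤ y) :
    |∑ d ∈ sqfreeThree y, g d - ∑ e ∈ Finset.range (E + 1), (ArithmeticFunction.moebius e : ℝ)
      * ∑ n ∈ Finset.range (y + 1) with n % 8 = 3 ∧ e ^ 2 ∣ n, g n| ≤ y / E := by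
  have e1 : ∑ d ∈ sqfreeThree y, g d = ∑ e ∈ Finset.range (y + 1),
      (ArithmeticFunction.moebius e : ℝ)
        * ∑ n ∈ Finset.range (y + 1) with n % 8 = 3 ∧ e ^ 2 ∣ n, g n := by
    have e2 : ∀ e ∈ Finset.range (y + 1), (ArithmeticFunction.moebius e : ℝ)
        * ∑ n ∈ Finset.range (y + 1) with n % 8 = 3 ∧ e ^ 2 ∣ n, g n
        = ∑ n ∈ Finset.range (y + 1), if n % 8 = 3 then
          (if e ^ 2 ∣ n then (ArithmeticFunction.moebius e : ℝ) else 0) * g n else 0 := by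
      intro e _
      rw [Finset.sum_filter, Finset.mul_sum]
      refine Finset.sum_congr rfl fun n _ => ?_
      by_cases h1 : n % 8 = 3 <;> by_cases h2 : e ^ 2 ∣ n <;> simp [h1, h2]
    rw [Finset.sum_congr rfl e2, Finset.sum_comm, sqfreeThree, Finset.sum_filter]
    refine Finset.sum_congr rfl fun n hn => ?_
    rw [Finset.mem_range] at hn
    by_cases h : n % 8 = 3
    · simp only [h, and_true, if_true]
      rw [← Finset.sum_mul, ← Finset.sum_filter, sum_moebius_sq_dvd (by omega) (by omega)]
      split_ifs <;> simp
    · simp [h]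
  rw [e1, ← Finset.sum_range_add_sum_Ico _ (show E + 1 ≤ y + 1 by omega), add_sub_cancel_left]
  have hb : ∀ e ∈ Finset.Ico (E + 1) (y + 1), |(ArithmeticFunction.moebius e : ℝ)
      * ∑ n ∈ Finset.range (y + 1) with n % 8 = 3 ∧ e ^ 2 ∣ n, g n| ≤ y * (1 / (e : ℝ) ^ 2) := by
    intro e he
    have he0 : 0 < e := by
      rw [Finset.mem_Ico] at he
      omega
    have hmu : |(ArithmeticFunction.moebius e : ℝ)| ≤ 1 := by
      exact_mod_cast ArithmeticFunction.abs_moebius_le_one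
    rw [abs_mul]
    refine (mul_le_of_le_one_left (abs_nonneg _) hmu).trans ?_
    refine (Finset.abs_sum_le_sum_abs _ _).trans ((Finset.sum_le_sum fun n _ => hg n).trans ?_)
    rw [Finset.sum_const, nsmul_one]
    have hsub : (Finset.range (y + 1)).filter (fun n => n % 8 = 3 ∧ e ^ 2 ∣ n)
        ⊆ (Finset.Ioc 0 y).filter (fun n => e ^ 2 ∣ n) := by
      intro n hn
      simp only [Finset.mem_filter, Finset.mem_range, Finset.mem_Ioc] at hn ⊢
      omega
    have hc := Finset.card_le_card hsub
    rw [Nat.Ioc_filter_dvd_card_eq_div] at hc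
    refine (Nat.cast_le.2 hc).trans (Nat.cast_div_le.trans (le_of_eq ?_))
    push_cast
    ring
  refine (Finset.abs_sum_le_sum_abs _ _).trans ((Finset.sum_le_sum hb).trans ?_)
  rw [← Finset.mul_sum, div_eq_mul_one_div (y : ℝ)]
  exact mul_le_mul_of_nonneg_left (sum_Ico_one_div_sq_le hE y) (Nat.cast_nonneg y)

lemma le_card_sqfreeThree {T : ℕ} (hT : 2 ≤ T) :
    (T : ℝ) ^ 6 / 16 - 1 - T - (T : ℝ) ^ 5 ≤ (sqfreeThree (T ^ 6)).card := by
  have hTr : (0 : ℝ) < T := by positivity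
  have h := abs_sum_sqfreeThree_sub_le (g := fun _ => 1) (by simp) (E := T) (y := T ^ 6)
    (by omega) (Nat.le_self_pow (by norm_num) T)
  rw [Finset.sum_const, nsmul_one,
    ← Finset.sum_range_add_sum_Ico _ (show 3 ≤ T + 1 by omega)] at h
  have hodd : ∀ e, Odd e → ∑ n ∈ Finset.range (T ^ 6 + 1) with n % 8 = 3 ∧ e ^ 2 ∣ n, (1 : ℝ)
      = ((T ^ 6 / e ^ 2 + 5) / 8 : ℕ) := by
    intro e he
    rw [sum_range_filter_sq_dvd_odd (fun _ => 1) he, sum_range_filter_mod_eight (fun _ => 1)]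
    simp
  have h0 : ∑ e ∈ Finset.range 3, (ArithmeticFunction.moebius e : ℝ)
      * ∑ n ∈ Finset.range (T ^ 6 + 1) with n % 8 = 3 ∧ e ^ 2 ∣ n, (1 : ℝ)
      = ((T ^ 6 + 5) / 8 : ℕ) := by
    rw [Finset.sum_range_succ, Finset.sum_range_succ, Finset.sum_range_one,
      sum_range_filter_sq_dvd_even (fun _ => 1) even_two, hodd 1 odd_one]
    simp
  have h1 : ((T : ℝ) ^ 6) / 8 - 1 ≤ ((T ^ 6 + 5) / 8 : ℕ) := by
    have : T ^ 6 ≤ 8 * ((T ^ 6 + 5) / 8) + 8 := by omega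
    have : (T : ℝ) ^ 6 ≤ 8 * ((T ^ 6 + 5) / 8 : ℕ) + 8 := by exact_mod_cast this
    linarith
  have h2 : ∀ e ∈ Finset.Ico 3 (T + 1), |(ArithmeticFunction.moebius e : ℝ)
      * ∑ n ∈ Finset.range (T ^ 6 + 1) with n % 8 = 3 ∧ e ^ 2 ∣ n, (1 : ℝ)|
      ≤ (T : ℝ) ^ 6 / 8 * (1 / (e : ℝ) ^ 2) + 1 := by
    intro e he
    have hmu : |(ArithmeticFunction.moebius e : ℝ)| ≤ 1 := by
      exact_mod_cast ArithmeticFunction.abs_moebius_le_one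
    rw [abs_mul]
    refine (mul_le_of_le_one_left (abs_nonneg _) hmu).trans ?_
    rcases Nat.even_or_odd e with he2 | he2
    · rw [sum_range_filter_sq_dvd_even (fun _ => 1) he2, abs_zero]
      positivity
    · rw [hodd e he2, Nat.abs_cast]
      have a1 : 8 * ((T ^ 6 / e ^ 2 + 5) / 8) ≤ T ^ 6 / e ^ 2 + 8 := by omega
      have a2 : 8 * (((T ^ 6 / e ^ 2 + 5) / 8 : ℕ) : ℝ) ≤ (T ^ 6 / e ^ 2 : ℕ) + 8 := by
        exact_mod_cast a1
      have a3 : ((T ^ 6 / e ^ 2 : ℕ) : ℝ) ≤ (T : ℝ) ^ 6 / (e : ℝ) ^ 2 := by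
        exact_mod_cast Nat.cast_div_le (α := ℝ) (m := T ^ 6) (n := e ^ 2)
      have a4 : (T : ℝ) ^ 6 / 8 * (1 / (e : ℝ) ^ 2) = (T : ℝ) ^ 6 / (e : ℝ) ^ 2 / 8 := by ring
      rw [a4]
      linarith
  have h3 := (Finset.abs_sum_le_sum_abs _ _).trans (Finset.sum_le_sum h2)
  rw [Finset.sum_add_distrib, ← Finset.mul_sum, Finset.sum_const, Nat.card_Ico, nsmul_one] at h3
  have h4 := mul_le_mul_of_nonneg_left
    (show ∑ e ∈ Finset.Ico 3 (T + 1), 1 / (e : ℝ) ^ 2 ≤ 1 / 2 from sum_Ico_one_div_sq_le two_pos T)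
    (show (0 : ℝ) ≤ (T : ℝ) ^ 6 / 8 by positivity)
  have h5 : ((T + 1 - 3 : ℕ) : ℝ) ≤ T := by exact_mod_cast (by omega : T + 1 - 3 ≤ T)
  have h6 : ((T ^ 6 : ℕ) : ℝ) / T = (T : ℝ) ^ 5 := by
    push_cast
    field_simp
  rw [h0, h6] at h
  have h7 := (abs_le.1 h).1
  have h8 := (abs_le.1 h3).1
  linarith

lemma half_le_sum_jacobiSym_div {d : ℕ} (hd : d % 8 = 3) {K : ℕ} (hK : 0 < K) :
    1 / 2 ≤ ∑ k ∈ Finset.Ioc 0 K with IsSquare k ∨ IsSquare (2 * k), (jacobiSym k d : ℝ) / k := by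
  classical
  set f : ℕ → ℝ := fun k => (jacobiSym k d : ℝ) / k with hf
  set Q := (Finset.Ioc 0 K).filter fun k => IsSquare k with hQ
  set R := (Finset.Ioc 0 K).filter fun k => IsSquare (2 * k) with hR
  have hodd : Odd d := Nat.odd_iff.2 (by omega)
  have h2 : jacobiSym 2 d = -1 := by
    rw [jacobiSym.at_two hodd, ZMod.χ₈_nat_eq_if_mod_eight, if_neg (by omega), if_neg (by omega)]
  have hsq : ∀ k : ℕ, IsSquare k → 0 ≤ f k := by
    rintro k ⟨r, rfl⟩
    simp only [hf]
    push_cast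
    rw [jacobiSym.mul_left]
    push_cast
    exact div_nonneg (mul_self_nonneg _) (by positivity)
  have hdouble : ∀ k : ℕ, f (2 * k) = -(1 / 2) * f k := by
    intro k
    simp only [hf]
    push_cast
    rw [jacobiSym.mul_left, h2]
    push_cast
    ring
  have hR2 : ∀ k ∈ R, ∃ m, k = 2 * m ∧ IsSquare m := by
    intro k hk
    obtain ⟨r, hr⟩ := (Finset.mem_filter.1 hk).2
    have hr2 : 2 ∣ r := by
      have : 2 ∣ r * r := ⟨k, hr.symm⟩
      rcases Nat.prime_two.dvd_mul.1 this with h | h <;> exact h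
    obtain ⟨s, rfl⟩ := hr2
    exact ⟨s * s, by nlinarith, s, rfl⟩
  have hfR : ∀ k ∈ R, f k ≤ 0 := by
    intro k hk
    obtain ⟨m, rfl, hm⟩ := hR2 k hk
    rw [hdouble]
    linarith [hsq m hm]
  have e1 : ∑ k ∈ R, f k ≤ ∑ k ∈ R \ Q, f k := by
    have := Finset.sum_le_sum_of_subset_of_nonneg (f := fun k => -f k)
      (Finset.sdiff_subset (s := R) (t := Q)) fun k hk _ => neg_nonneg.2 (hfR k hk)
    simp only [Finset.sum_neg_distrib] at this
    linarith
  have e2 : -(1 / 2) * ∑ k ∈ Q, f k ≤ ∑ k ∈ R, f k := by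
    have h3 : ∑ k ∈ R, f k = ∑ k ∈ R.image (· / 2), -(1 / 2) * f k := by
      rw [Finset.sum_image]
      · refine Finset.sum_congr rfl fun k hk => ?_
        obtain ⟨m, rfl, -⟩ := hR2 k hk
        rw [Nat.mul_div_cancel_left _ two_pos, hdouble]
      · intro k hk l hl hkl
        obtain ⟨m, rfl, -⟩ := hR2 k hk
        obtain ⟨m', rfl, -⟩ := hR2 l hl
        simp only at hkl
        omega
    have h4 : R.image (· / 2) ⊆ Q := by
      intro m hm
      obtain ⟨k, hk, rfl⟩ := Finset.mem_image.1 hm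
      have hk' := (Finset.mem_filter.1 hk).1
      obtain ⟨m, rfl, hmsq⟩ := hR2 k hk
      rw [Finset.mem_Ioc] at hk'
      rw [Nat.mul_div_cancel_left _ two_pos, hQ, Finset.mem_filter, Finset.mem_Ioc]
      exact ⟨⟨by omega, by omega⟩, hmsq⟩
    have h5 := Finset.sum_le_sum_of_subset_of_nonneg (f := f) h4
      fun k hk _ => hsq k (Finset.mem_filter.1 hk).2
    rw [h3, ← Finset.mul_sum]
    linarith
  have e3 : 1 ≤ ∑ k ∈ Q, f k := by
    have h1 : (1 : ℕ) ∈ Q := by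
      rw [hQ, Finset.mem_filter, Finset.mem_Ioc]
      exact ⟨⟨one_pos, hK⟩, 1, rfl⟩
    have := Finset.single_le_sum (f := f) (fun k hk => hsq k (Finset.mem_filter.1 hk).2) h1
    simpa [hf] using this
  rw [Finset.filter_or, ← Finset.union_sdiff_self_eq_union,
    Finset.sum_union Finset.disjoint_sdiff]
  linarith

lemma abs_sum_sqfreeThree_jacobiSym_le {k : ℕ} (hk0 : k ≠ 0) (hk : ¬IsSquare k)
    (hk2 : ¬IsSquare (2 * k)) {E y : ℕ} (hE : 0 < E) (hEy : E ≤ y) :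
    |∑ d ∈ sqfreeThree y, (jacobiSym k d : ℝ)| ≤ E * k + y / E := by
  have h := abs_sum_sqfreeThree_sub_le (g := fun n => (jacobiSym k n : ℝ))
    (fun n => abs_jacobiSym_le_one _ _) hE hEy
  have h1 : ∀ e ∈ Finset.range E, |(ArithmeticFunction.moebius (e + 1) : ℝ)
      * ∑ n ∈ Finset.range (y + 1) with n % 8 = 3 ∧ (e + 1) ^ 2 ∣ n, (jacobiSym k n : ℝ)| ≤ k := by
    intro e _
    have hmu : |(ArithmeticFunction.moebius (e + 1) : ℝ)| ≤ 1 := by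
      exact_mod_cast ArithmeticFunction.abs_moebius_le_one
    rw [abs_mul]
    refine (mul_le_of_le_one_left (abs_nonneg _) hmu).trans ?_
    rcases Nat.even_or_odd (e + 1) with he | he
    · rw [sum_range_filter_sq_dvd_even _ he, abs_zero]
      positivity
    · rw [sum_range_filter_sq_dvd_odd _ he]
      have e1 : ∀ f ∈ (Finset.range (y / (e + 1) ^ 2 + 1)).filter (fun f => f % 8 = 3),
          (jacobiSym k ((e + 1) ^ 2 * f) : ℝ)
            = (jacobiSym k (e + 1) : ℝ) ^ 2 * (jacobiSym k f : ℝ) := by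
        intro f hf
        have : NeZero f := ⟨by rintro rfl; simp at hf⟩
        rw [jacobiSym.mul_right, jacobiSym.pow_right]
        push_cast
        rfl
      rw [Finset.sum_congr rfl e1, ← Finset.mul_sum, abs_mul, abs_pow]
      exact (mul_le_of_le_one_left (abs_nonneg _)
        (pow_le_one₀ (abs_nonneg _) (abs_jacobiSym_le_one _ _))).trans
        (abs_sum_jacobiSym_le hk0 hk hk2 _)
  have h2 := (Finset.abs_sum_le_sum_abs _ _).trans (Finset.sum_le_sum h1)
  rw [Finset.sum_const, Finset.card_range, nsmul_eq_mul] at h2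
  rw [Finset.sum_range_succ'] at h
  simp only [ArithmeticFunction.map_zero, Int.cast_zero, zero_mul, add_zero] at h
  rw [abs_le] at *
  constructor <;> linarith

lemma le_sum_sqfreeThree_sum {E y K : ℕ} (hE : 0 < E) (hEy : E ≤ y) (hK : 0 < K) :
    ((sqfreeThree y).card : ℝ) / 2 - (E * K + y / E * (1 + log K))
      ≤ ∑ d ∈ sqfreeThree y, ∑ k ∈ Finset.range K, (jacobiSym (k + 1 : ℕ) d : ℝ) / (k + 1) := by
  have e0 : ∀ d, ∑ k ∈ Finset.range K, (jacobiSym (k + 1 : ℕ) d : ℝ) / (k + 1)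
      = ∑ k ∈ Finset.Ioc 0 K, (jacobiSym k d : ℝ) / k := fun d => by
    rw [sum_Ioc_zero_eq_sum_range (fun k => (jacobiSym k d : ℝ) / k)]
    push_cast
    rfl
  simp only [e0]
  have e1 : ∀ d, ∑ k ∈ Finset.Ioc 0 K, (jacobiSym k d : ℝ) / k
      = ∑ k ∈ Finset.Ioc 0 K with IsSquare k ∨ IsSquare (2 * k), (jacobiSym k d : ℝ) / k
        + ∑ k ∈ Finset.Ioc 0 K with ¬(IsSquare k ∨ IsSquare (2 * k)), (jacobiSym k d : ℝ) / k :=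
    fun d => (Finset.sum_filter_add_sum_filter_not _ _ _).symm
  simp only [e1]
  rw [Finset.sum_add_distrib]
  have h1 : ((sqfreeThree y).card : ℝ) / 2 ≤ ∑ d ∈ sqfreeThree y,
      ∑ k ∈ Finset.Ioc 0 K with IsSquare k ∨ IsSquare (2 * k), (jacobiSym k d : ℝ) / k := by
    have := Finset.card_nsmul_le_sum (sqfreeThree y) (fun d => ∑ k ∈ Finset.Ioc 0 K with
      IsSquare k ∨ IsSquare (2 * k), (jacobiSym k d : ℝ) / k) (1 / 2)
      fun d hd => half_le_sum_jacobiSym_div (Finset.mem_filter.1 hd).2.2 hK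
    rw [nsmul_eq_mul] at this
    linarith
  have h2 : |∑ d ∈ sqfreeThree y, ∑ k ∈ Finset.Ioc 0 K with ¬(IsSquare k ∨ IsSquare (2 * k)),
      (jacobiSym k d : ℝ) / k| ≤ E * K + y / E * (1 + log K) := by
    rw [Finset.sum_comm]
    have hb : ∀ k ∈ (Finset.Ioc 0 K).filter (fun k => ¬(IsSquare k ∨ IsSquare (2 * k))),
        |∑ d ∈ sqfreeThree y, (jacobiSym k d : ℝ) / k| ≤ E + y / E * (1 / (k : ℝ)) := by
      intro k hk
      simp only [Finset.mem_filter, Finset.mem_Ioc, not_or] at hk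
      have hkr : (0 : ℝ) < k := by exact_mod_cast hk.1.1
      rw [← Finset.sum_div, abs_div, Nat.abs_cast, div_le_iff₀ hkr]
      refine (abs_sum_sqfreeThree_jacobiSym_le hk.1.1.ne' hk.2.1 hk.2.2 hE hEy).trans (le_of_eq ?_)
      field_simp
    refine (Finset.abs_sum_le_sum_abs _ _).trans ((Finset.sum_le_sum hb).trans ?_)
    refine (Finset.sum_le_sum_of_subset_of_nonneg (Finset.filter_subset _ _)
      fun k _ _ => by positivity).trans ?_
    rw [Finset.sum_add_distrib, ← Finset.mul_sum, Finset.sum_const, Nat.card_Ioc, nsmul_eq_mul,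
      sum_Ioc_zero_eq_sum_range (fun k => 1 / (k : ℝ)), Nat.sub_zero, mul_comm (K : ℝ)]
    have := sum_range_one_div_le K
    push_cast
    gcongr
  have := (abs_le.1 h2).1
  linarith

lemma le_jacobiMoment_div {d T : ℕ} (hd : Squarefree d) (h3 : d % 4 = 3) (hT : 0 < T)
    (hdT : d ≤ T ^ 6) :
    ((∑ k ∈ Finset.range (T ^ 4), (jacobiSym (k + 1 : ℕ) d : ℝ) / (k + 1)) / π
      - (1 + 6 * log T) / T) / (T : ℝ) ^ 3 ≤ jacobiMoment d / d := by
  set L := ∑ k ∈ Finset.range (T ^ 4), (jacobiSym (k + 1 : ℕ) d : ℝ) / (k + 1)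
  have hTr : (0 : ℝ) < T := by positivity
  have hdr : (0 : ℝ) < d := by
    have : 0 < d := by omega
    positivity
  have hs : 0 < √(d : ℝ) := sqrt_pos.2 hdr
  have hss : √(d : ℝ) * √d = d := mul_self_sqrt hdr.le
  have hdT' : (d : ℝ) ≤ (T : ℝ) ^ 6 := by exact_mod_cast hdT
  have hsT : √(d : ℝ) ≤ (T : ℝ) ^ 3 := by
    rw [sqrt_le_left (by positivity), ← pow_mul]
    exact hdT'
  have hlog : log d ≤ 6 * log T := by
    calc log d ≤ log ((T : ℝ) ^ 6) := log_le_log hdr hdT'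
      _ = 6 * log T := by rw [log_pow]; norm_num
  have hlog0 : 0 ≤ log (d : ℝ) := log_natCast_nonneg d
  have h1 := (abs_le.1 (abs_jacobiMoment_sub_le hd h3 (K := T ^ 4) (by positivity))).1
  have h2 : L / π - (1 + 6 * log T) / T ≤ jacobiMoment d / √d := by
    rw [le_div_iff₀ hs]
    have h4 : (d : ℝ) * (1 + log d) / (T ^ 4 : ℕ) ≤ (1 + 6 * log T) / T * √d := by
      calc (d : ℝ) * (1 + log d) / (T ^ 4 : ℕ)
          = √d * (√d * (1 + log d)) / (T : ℝ) ^ 4 := by rw [← mul_assoc, hss]; push_cast; rfl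
        _ ≤ √d * ((T : ℝ) ^ 3 * (1 + 6 * log T)) / (T : ℝ) ^ 4 := by gcongr
        _ = _ := by field_simp
    have e : (L / π - (1 + 6 * log T) / T) * √d = √d / π * L - (1 + 6 * log T) / T * √d := by ring
    rw [e]
    linarith
  have hH := jacobiMoment_nonneg hd h3
  calc _ ≤ jacobiMoment d / √d / (T : ℝ) ^ 3 := by gcongr
    _ ≤ jacobiMoment d / √d / √d := by gcongr
    _ = jacobiMoment d / d := by rw [div_div, hss]

lemma eventually_le_sum_jacobiMoment_div :
    ∀ᶠ T : ℕ in atTop, (T : ℝ) ^ 3 / 1000 ≤ ∑ d ∈ sqfreeThree (T ^ 6), jacobiMoment d / d := by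
  have hlim : Tendsto (fun T : ℕ => (1 + log T) / T) atTop (nhds 0) := by
    have h1 : Tendsto (fun x : ℝ => log x / x) atTop (nhds 0) := by
      simpa using tendsto_pow_log_div_mul_add_atTop 1 0 1 one_ne_zero
    have h2 := (tendsto_const_div_atTop_nhds_zero_nat (1 : ℝ)).add
      (h1.comp tendsto_natCast_atTop_atTop)
    rw [add_zero] at h2
    refine h2.congr fun T => ?_
    simp only [Function.comp]
    ring
  filter_upwards [hlim.eventually_lt_const (show (0 : ℝ) < 1 / 5000 by norm_num),
    eventually_ge_atTop 2] with T hT hT2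
  have hTr : (0 : ℝ) < T := by positivity
  have hT1 : (1 : ℝ) ≤ T := by exact_mod_cast (by omega : 1 ≤ T)
  rw [div_lt_iff₀ hTr] at hT
  set ℓ := log (T : ℝ) with hℓ
  have hℓ0 : 0 ≤ ℓ := log_natCast_nonneg T
  set N : ℝ := ((sqfreeThree (T ^ 6)).card : ℝ) with hN
  have hN1 := le_card_sqfreeThree hT2
  have hN2 : N ≤ 2 * (T : ℝ) ^ 6 := by
    have h1 := Finset.card_filter_le (Finset.range (T ^ 6 + 1)) fun d => Squarefree d ∧ d % 8 = 3
    rw [Finset.card_range] at h1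
    have h2 : (sqfreeThree (T ^ 6)).card ≤ T ^ 6 + T ^ 6 :=
      h1.trans (Nat.add_le_add_left (Nat.one_le_pow _ _ (by omega)) _)
    have h3 : N ≤ (T : ℝ) ^ 6 + (T : ℝ) ^ 6 := by
      rw [hN]
      exact_mod_cast h2
    linarith
  have h5 : (1 + ℓ) * (T : ℝ) ^ 5 ≤ (T : ℝ) ^ 6 / 5000 := by
    have := mul_le_mul_of_nonneg_right hT.le (show (0 : ℝ) ≤ (T : ℝ) ^ 5 by positivity)
    linarith
  have hT5 : (T : ℝ) ≤ (T : ℝ) ^ 5 := le_self_pow₀ hT1 (by norm_num)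
  have hsum := le_sum_sqfreeThree_sum (E := T) (y := T ^ 6) (K := T ^ 4) (by omega)
    (Nat.le_self_pow (by norm_num) T) (by positivity)
  set S := ∑ d ∈ sqfreeThree (T ^ 6), ∑ k ∈ Finset.range (T ^ 4),
    (jacobiSym (k + 1 : ℕ) d : ℝ) / (k + 1) with hS
  have e1 : (T : ℝ) * (T ^ 4 : ℕ) + (T ^ 6 : ℕ) / T * (1 + log (T ^ 4 : ℕ))
      = 2 * (T : ℝ) ^ 5 + 4 * (ℓ * (T : ℝ) ^ 5) := by
    push_cast
    rw [log_pow, ← hℓ]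
    push_cast
    field_simp
    ring
  rw [e1] at hsum
  have hS1 : (T : ℝ) ^ 6 / 64 ≤ S := by nlinarith
  have hS2 : (T : ℝ) ^ 6 / 256 ≤ S / π := by
    rw [le_div_iff₀ pi_pos]
    have : (T : ℝ) ^ 6 * π ≤ (T : ℝ) ^ 6 * 4 := by
      gcongr
      exact pi_le_four
    linarith
  calc (T : ℝ) ^ 3 / 1000 = ((T : ℝ) ^ 6 / 1000) / (T : ℝ) ^ 3 := by field_simp
    _ ≤ (S / π - N * ((1 + 6 * ℓ) / T)) / (T : ℝ) ^ 3 := by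
        gcongr
        have e2 : N * ((1 + 6 * ℓ) / T) ≤ 2 * (T : ℝ) ^ 6 * ((1 + 6 * ℓ) / T) := by gcongr
        have e3 : 2 * (T : ℝ) ^ 6 * ((1 + 6 * ℓ) / T) = 2 * (T : ℝ) ^ 5 + 12 * (ℓ * (T : ℝ) ^ 5) := by
          field_simp
          ring
        nlinarith [pow_pos hTr 5]
    _ = ∑ d ∈ sqfreeThree (T ^ 6), ((∑ k ∈ Finset.range (T ^ 4),
          (jacobiSym (k + 1 : ℕ) d : ℝ) / (k + 1)) / π - (1 + 6 * ℓ) / T) / (T : ℝ) ^ 3 := by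
        rw [← Finset.sum_div, Finset.sum_sub_distrib, ← Finset.sum_div, Finset.sum_const,
          nsmul_eq_mul]
    _ ≤ _ := by
        refine Finset.sum_le_sum fun d hd => ?_
        obtain ⟨h1, h2, h3⟩ := Finset.mem_filter.1 hd
        rw [Finset.mem_range] at h1
        exact le_jacobiMoment_div h2 (by omega) (by omega) (by omega)

/-! ### Conclusion -/

lemma exists_modulus {y : ℕ} (hy : 3 ≤ y) :
    ∃ M : ℕ, Squarefree M ∧ Odd M ∧ 2 ≤ M ∧ log M ≤ 2 * y ∧ sqfreeThree y ⊆ M.divisors := by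
  obtain ⟨M, hM⟩ := Nat.prime_two.dvd_primorial_iff.2 (show 2 ≤ y by omega)
  have hsq : Squarefree (2 * M) := hM ▸ squarefree_primorial y
  have hM0 : M ≠ 0 := by rintro rfl; simp at hsq
  have hodd : Odd M := by
    rw [← Nat.not_even_iff_odd, even_iff_two_dvd]
    intro h
    exact absurd (Nat.isUnit_iff.1 (hsq 2 (mul_dvd_mul_left 2 h))) (by norm_num)
  have hdvd : ∀ d, Squarefree d → Odd d → d ≤ y → d ∣ M := fun d hd ho hdy => by
    refine Nat.Coprime.dvd_of_dvd_mul_left (Nat.coprime_two_right.2 ho) ?_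
    rw [← hM]
    exact hd.dvd_primorial.trans (primorial_dvd_primorial hdy)
  refine ⟨M, hsq.squarefree_of_dvd (Dvd.intro_left 2 rfl), hodd, ?_, ?_, fun d hd => ?_⟩
  · have := Nat.le_of_dvd (Nat.pos_of_ne_zero hM0)
      (hdvd 3 Nat.prime_three.squarefree (by decide) hy)
    omega
  · have h1 : M ≤ 4 ^ y := by
      have := primorial_le_four_pow y
      omega
    have h2 : log M ≤ log ((4 : ℝ) ^ y) :=
      log_le_log (by positivity) (by exact_mod_cast h1)
    have h3 : log (4 : ℝ) ≤ 2 := by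
      rw [show (4 : ℝ) = 2 ^ 2 by norm_num, log_pow]
      have := log_two_lt_d9
      push_cast
      linarith
    rw [log_pow] at h2
    nlinarith [Nat.cast_nonneg (α := ℝ) y]
  · obtain ⟨h1, h2, h3⟩ := Finset.mem_filter.1 hd
    rw [Finset.mem_range] at h1
    exact Nat.mem_divisors.2 ⟨hdvd d h2 (Nat.odd_iff.2 (by omega)) (by omega), hM0⟩

/-- Large values attained at integers `n ≤ M ^ 4`, where `log M` is of order at most `T ^ 6`,
give an omega result. -/
lemma frequently_of_eventually_exists {g : ℝ → ℝ}
    (h : ∀ᶠ T : ℕ in atTop, ∃ M n : ℕ, 0 < M ∧ log M ≤ 2 * (T ^ 6 : ℕ) ∧ n ≤ M ^ 4 ∧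
      (T : ℝ) ^ 3 / 500 * (M : ℝ) ^ 2 ≤ g n) :
    ∃ c : ℝ, 0 < c ∧ ∃ᶠ x : ℝ in atTop,
      c * (x ^ ((1 : ℝ) / 2) * log x ^ ((1 : ℝ) / 2)) ≤ g x := by
  refine ⟨1 / 1500, by norm_num, frequently_atTop.2 fun B => ?_⟩
  set C : ℝ := ∑ m ∈ Finset.range (⌈B⌉₊ + 1), |g m| with hC
  obtain ⟨T, ⟨M, n, hM, hlogM, hnM, hg⟩, hT⟩ :=
    (h.and (tendsto_natCast_atTop_atTop.eventually_ge_atTop (500 * (C + 1) + 1))).exists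
  have hC0 : 0 ≤ C := Finset.sum_nonneg fun _ _ => abs_nonneg _
  have hT1 : (1 : ℝ) ≤ T := by linarith
  have hM1 : (1 : ℝ) ≤ M := by exact_mod_cast hM
  have hCg : C < g n := by
    have h1 : (T : ℝ) ≤ (T : ℝ) ^ 3 := le_self_pow₀ hT1 (by norm_num)
    have h2 : (T : ℝ) ^ 3 / 500 ≤ (T : ℝ) ^ 3 / 500 * (M : ℝ) ^ 2 :=
      le_mul_of_one_le_right (by positivity) (one_le_pow₀ hM1)
    linarith
  have hn : ⌈B⌉₊ + 1 ≤ n := by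
    by_contra! hlt
    have := Finset.single_le_sum (f := fun m : ℕ => |g m|) (fun _ _ => abs_nonneg _)
      (Finset.mem_range.2 hlt)
    exact absurd (hCg.trans_le ((le_abs_self _).trans this)) (lt_irrefl _)
  have hBn : B ≤ n := (Nat.le_ceil B).trans (Nat.cast_le.2 (by omega))
  have hn1 : (1 : ℝ) ≤ n := by exact_mod_cast (by omega : 1 ≤ n)
  have hnM' : (n : ℝ) ≤ (M : ℝ) ^ 4 := by exact_mod_cast hnM
  refine ⟨n, hBn, ?_⟩
  rw [← sqrt_eq_rpow, ← sqrt_eq_rpow]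
  have h1 : √(n : ℝ) ≤ (M : ℝ) ^ 2 := by
    rw [sqrt_le_left (by positivity), ← pow_mul]
    exact hnM'
  have h2 : √(log n) ≤ 3 * (T : ℝ) ^ 3 := by
    rw [sqrt_le_left (by positivity)]
    have h3 : log n ≤ log ((M : ℝ) ^ 4) := log_le_log (by linarith) hnM'
    rw [log_pow] at h3
    push_cast at h3 hlogM
    have h4 : (3 * (T : ℝ) ^ 3) ^ 2 = 9 * (T : ℝ) ^ 6 := by ring
    have h5 : 0 ≤ (T : ℝ) ^ 6 := by positivity
    linarith
  calc 1 / 1500 * (√(n : ℝ) * √(log n)) ≤ 1 / 1500 * ((M : ℝ) ^ 2 * (3 * (T : ℝ) ^ 3)) := by gcongr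
    _ = (T : ℝ) ^ 3 / 500 * (M : ℝ) ^ 2 := by ring
    _ ≤ g n := hg

lemma eventually_exists_densityDev :
    ∀ᶠ T : ℕ in atTop, ∃ (M : ℕ) (_ : NeZero M), 2 ≤ M ∧ log M ≤ 2 * (T ^ 6 : ℕ) ∧
      (T : ℝ) ^ 3 / 500 ≤ 4 * π / 3 * densityDev M M - 10 ^ 6 ∧
      4 * π / 3 * densityDev M ((M - 1) / 2) + 10 ^ 6 ≤ -((T : ℝ) ^ 3 / 500) := by
  filter_upwards [eventually_le_sum_jacobiMoment_div, eventually_ge_atTop 1000] with T hT hT2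
  obtain ⟨M, hsq, hodd, hM2, hlog, hsub⟩ := exists_modulus (y := T ^ 6)
    ((by omega : 3 ≤ T).trans (Nat.le_self_pow (by norm_num) T))
  have : NeZero M := ⟨by omega⟩
  have hpos : ∀ d ∈ M.divisors, d % 4 = 3 → 0 ≤ jacobiMoment d / d := fun d hd h =>
    div_nonneg (jacobiMoment_nonneg (hsq.squarefree_of_dvd (Nat.dvd_of_mem_divisors hd)) h)
      (Nat.cast_nonneg d)
  have h8 : ∑ d ∈ sqfreeThree (T ^ 6), jacobiMoment d / d
      ≤ ∑ d ∈ M.divisors with d % 8 = 3, jacobiMoment d / d := by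
    refine Finset.sum_le_sum_of_subset_of_nonneg (fun d hd => ?_) fun d hd _ => ?_
    · exact Finset.mem_filter.2 ⟨hsub hd, (Finset.mem_filter.1 hd).2.2⟩
    · obtain ⟨h1, h2⟩ := Finset.mem_filter.1 hd
      exact hpos d h1 (by omega)
  have h4 : ∑ d ∈ M.divisors with d % 8 = 3, jacobiMoment d / d
      ≤ ∑ d ∈ M.divisors with d % 4 = 3, jacobiMoment d / d := by
    refine Finset.sum_le_sum_of_subset_of_nonneg (fun d hd => ?_) fun d hd _ => ?_
    · obtain ⟨h1, h2⟩ := Finset.mem_filter.1 hd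
      exact Finset.mem_filter.2 ⟨h1, by omega⟩
    · obtain ⟨h1, h2⟩ := Finset.mem_filter.1 hd
      exact hpos d h1 h2
  have hT3 : (10 : ℝ) ^ 9 ≤ (T : ℝ) ^ 3 := by
    have h1 : (1000 : ℝ) ≤ T := by exact_mod_cast hT2
    calc (10 : ℝ) ^ 9 = 1000 ^ 3 := by norm_num
      _ ≤ _ := by gcongr
  have hself : (T : ℝ) ^ 3 / 1000 ≤ densityDev M M := by
    rw [densityDev_self M hsq hodd]
    linarith
  have hhalf : densityDev M ((M - 1) / 2) ≤ -((T : ℝ) ^ 3 / 1000) := by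
    rw [densityDev_half M hsq hodd]
    linarith
  have hp : 4 ≤ 4 * π / 3 := by linarith [pi_gt_three]
  refine ⟨M, this, hM2, hlog, ?_, ?_⟩ <;> nlinarith

theorem tsang_omega_pm_sphere :
    (∃ c : ℝ, 0 < c ∧ ∃ᶠ x : ℝ in atTop,
      c * (x ^ ((1 : ℝ) / 2) * Real.log x ^ ((1 : ℝ) / 2)) ≤ latticeP3 x) ∧
    (∃ c : ℝ, 0 < c ∧ ∃ᶠ x : ℝ in atTop,
      latticeP3 x ≤ -(c * (x ^ ((1 : ℝ) / 2) * Real.log x ^ ((1 : ℝ) / 2)))) := by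
  constructor
  · refine frequently_of_eventually_exists ?_
    filter_upwards [eventually_exists_densityDev] with T ⟨M, _, hM2, hlog, h, _⟩
    obtain ⟨n, hn, hP⟩ := exists_latticeP3_ge hM2 le_rfl
    exact ⟨M, n, by omega, hlog, hn, (mul_le_mul_of_nonneg_right h (sq_nonneg _)).trans hP⟩
  · obtain ⟨c, hc, hf⟩ := frequently_of_eventually_exists (g := fun x => -latticeP3 x) (by
      filter_upwards [eventually_exists_densityDev] with T ⟨M, _, hM2, hlog, _, h⟩
      obtain ⟨n, hn, hP⟩ := exists_latticeP3_le hM2 (show (M - 1) / 2 ≤ M by omega)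
      refine ⟨M, n, by omega, hlog, hn, ?_⟩
      have := mul_le_mul_of_nonneg_right h (sq_nonneg (M : ℝ))
      linarith)
    exact ⟨c, hc, hf.mono fun x hx => le_neg_of_le_neg hx⟩
end

section
/- Wills' theorem: Let p ≥ 3 and let K ⊂ ℝ^p be a compact strictly convex body which contains a closed Euclidean ball of radius r > √p / 2. Let G = #(K ∩ ℤ^p) be the number of integer lattice points in K and vol(K) its Lebesgue measure. Then vol(K)·(1 − √p/(2r))^p ≤ G ≤ vol(K)·(1 + √p/(2r))^p. -/
open Real MeasureTheory

/-- The half-open unit cube centred at `v`. -/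
def centredCube {p : ℕ} (v : EuclideanSpace ℝ (Fin p)) : Set (EuclideanSpace ℝ (Fin p)) :=
  {x | ∀ i, x i ∈ Set.Ico (v i - 1 / 2) (v i + 1 / 2)}

/-- The points of `ℝᵖ` with integer coordinates. -/
def integerPoints (p : ℕ) : Set (EuclideanSpace ℝ (Fin p)) :=
  {v | ∀ i : Fin p, ∃ m : ℤ, v i = (m : ℝ)}

theorem countable_integerPoints (p : ℕ) : (integerPoints p).Countable := by
  refine (Set.countable_range fun m : Fin p → ℤ =>
    (WithLp.toLp 2 (fun i => (m i : ℝ)) : EuclideanSpace ℝ (Fin p))).mono ?_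
  intro v hv
  choose m hm using hv
  exact ⟨m, by ext i; simp [hm]⟩

theorem centredCube_eq_preimage {p : ℕ} (v : EuclideanSpace ℝ (Fin p)) :
    centredCube v = (WithLp.ofLp : EuclideanSpace ℝ (Fin p) → Fin p → ℝ) ⁻¹'
      Set.pi Set.univ fun i => Set.Ico (v i - 1 / 2) (v i + 1 / 2) := by
  ext x
  simp [centredCube]

theorem measurableSet_centredCube {p : ℕ} (v : EuclideanSpace ℝ (Fin p)) :
    MeasurableSet (centredCube v) := by
  rw [centredCube_eq_preimage]
  exact (PiLp.volume_preserving_ofLp (Fin p)).measurable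
    (MeasurableSet.univ_pi fun _ => measurableSet_Ico)

theorem volume_centredCube {p : ℕ} (v : EuclideanSpace ℝ (Fin p)) :
    volume (centredCube v) = 1 := by
  rw [centredCube_eq_preimage, (PiLp.volume_preserving_ofLp (Fin p)).measure_preimage
    (MeasurableSet.univ_pi fun _ => measurableSet_Ico).nullMeasurableSet, Real.volume_pi_Ico]
  norm_num

theorem norm_sub_le_of_mem_centredCube {p : ℕ} {v x : EuclideanSpace ℝ (Fin p)}
    (hx : x ∈ centredCube v) : ‖x - v‖ ≤ √p / 2 := by
  have hsum : ∑ i, ‖(x - v) i‖ ^ 2 ≤ (p : ℝ) / 4 := by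
    calc ∑ i, ‖(x - v) i‖ ^ 2 ≤ ∑ _i : Fin p, (1 / 4 : ℝ) := by
          refine Finset.sum_le_sum fun i _ => ?_
          obtain ⟨h₁, h₂⟩ := hx i
          rw [Real.norm_eq_abs, sq_abs, PiLp.sub_apply]
          nlinarith
      _ = (p : ℝ) / 4 := by simp; ring
  rw [EuclideanSpace.norm_eq]
  refine Real.sqrt_le_iff.2 ⟨by positivity, hsum.trans_eq ?_⟩
  rw [div_pow, Real.sq_sqrt (Nat.cast_nonneg p)]
  norm_num

theorem pairwiseDisjoint_centredCube (p : ℕ) :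
    (integerPoints p).PairwiseDisjoint centredCube := by
  intro v hv w hw hvw
  refine Set.disjoint_left.2 fun x hxv hxw => hvw ?_
  ext i
  obtain ⟨m, hm⟩ := hv i
  obtain ⟨n, hn⟩ := hw i
  obtain ⟨h₁, h₂⟩ := hxv i
  obtain ⟨h₃, h₄⟩ := hxw i
  rw [hm] at h₁ h₂
  rw [hn] at h₃ h₄
  have h₅ : m < n + 1 := by
    have : (m : ℝ) < n + 1 := by linarith
    exact_mod_cast this
  have h₆ : n < m + 1 := by
    have : (n : ℝ) < m + 1 := by linarith
    exact_mod_cast this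
  rw [hm, hn, show m = n by omega]

theorem exists_integerPoint_mem_centredCube {p : ℕ} (x : EuclideanSpace ℝ (Fin p)) :
    ∃ v ∈ integerPoints p, x ∈ centredCube v := by
  refine ⟨WithLp.toLp 2 fun i => ((⌊x i + 1 / 2⌋ : ℤ) : ℝ), fun i => ⟨_, rfl⟩, fun i => ?_⟩
  have h₁ := Int.floor_le (x i + 1 / 2)
  have h₂ := Int.lt_floor_add_one (x i + 1 / 2)
  constructor <;> simp only <;> linarith

theorem volume_biUnion_centredCube {p : ℕ} {S : Set (EuclideanSpace ℝ (Fin p))}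
    (hS : S ⊆ integerPoints p) :
    volume (⋃ v ∈ S, centredCube v) = (S.encard : ENNReal) := by
  rw [measure_biUnion ((countable_integerPoints p).mono hS)
    ((pairwiseDisjoint_centredCube p).subset hS) fun v _ => measurableSet_centredCube v]
  simp [volume_centredCube]

section Homothety

variable {E : Type*} [NormedAddCommGroup E] [NormedSpace ℝ E] {K : Set E} {z x y : E} {r t : ℝ}

theorem Convex.mem_homothety_one_add_image (hK : Convex ℝ K) (hz : Metric.closedBall z r ⊆ K)
    (ht : 0 < t) (hx : x ∈ K) (hxy : ‖y - x‖ ≤ t * r) :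
    y ∈ AffineMap.homothety z (1 + t) '' K := by
  have hw : z + t⁻¹ • (y - x) ∈ K := hz <| by
    rw [mem_closedBall_iff_norm, add_sub_cancel_left, norm_smul, norm_inv,
      Real.norm_of_nonneg ht.le, inv_mul_le_iff₀ ht]
    exact hxy
  have ht' : 1 + t ≠ 0 := by positivity
  refine ⟨_, hK hx hw (a := 1 / (1 + t)) (b := t / (1 + t)) (by positivity) (by positivity)
    (by field_simp), ?_⟩
  rw [AffineMap.homothety_apply, vsub_eq_sub, vadd_eq_add]
  match_scalars <;> field_simp <;> ring

theorem Convex.mem_of_norm_sub_le_of_mem_homothety_one_sub_image (hK : Convex ℝ K)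
    (hz : Metric.closedBall z r ⊆ K) (ht : 0 < t) (ht₁ : t ≤ 1)
    (hx : x ∈ AffineMap.homothety z (1 - t) '' K) (hxy : ‖y - x‖ ≤ t * r) : y ∈ K := by
  have hw : z + t⁻¹ • (y - x) ∈ K := hz <| by
    rw [mem_closedBall_iff_norm, add_sub_cancel_left, norm_smul, norm_inv,
      Real.norm_of_nonneg ht.le, inv_mul_le_iff₀ ht]
    exact hxy
  obtain ⟨k, hk, rfl⟩ := hx
  convert hK hk hw (sub_nonneg.2 ht₁) ht.le (by ring) using 1
  rw [AffineMap.homothety_apply, vsub_eq_sub, vadd_eq_add]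
  match_scalars <;> field_simp <;> ring

end Homothety

theorem wills_lattice_point_bounds
    (p : ℕ) (hp : 3 ≤ p)
    (K : Set (EuclideanSpace ℝ (Fin p)))
    (hKcompact : IsCompact K)
    (hKstrict : StrictConvex ℝ K)
    (r : ℝ) (hr : Real.sqrt p / 2 < r)
    (hball : ∃ z : EuclideanSpace ℝ (Fin p), Metric.closedBall z r ⊆ K) :
    (volume K).toReal * (1 - Real.sqrt p / (2 * r)) ^ p ≤
        ({v ∈ K | ∀ i : Fin p, ∃ m : ℤ, v i = (m : ℝ)}.ncard : ℝ) ∧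
      ({v ∈ K | ∀ i : Fin p, ∃ m : ℤ, v i = (m : ℝ)}.ncard : ℝ) ≤
        (volume K).toReal * (1 + Real.sqrt p / (2 * r)) ^ p := by
  obtain ⟨z, hz⟩ := hball
  have hK := hKstrict.convex
  have hp₀ : 0 < √(p : ℝ) := Real.sqrt_pos.2 (by exact_mod_cast (by omega : 0 < p))
  have hr₀ : 0 < r := by linarith
  set t := √(p : ℝ) / (2 * r) with ht
  have ht₀ : 0 < t := by positivity
  have ht₁ : t ≤ 1 := by rw [ht, div_le_one (by positivity)]; linarith
  have htr : t * r = √(p : ℝ) / 2 := by rw [ht]; field_simp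
  set S := {v ∈ K | ∀ i : Fin p, ∃ m : ℤ, v i = (m : ℝ)}
  have hvol := volume_biUnion_centredCube (S := S) fun v hv => hv.2
  have himage (c : ℝ) (hc : 0 ≤ c) : volume (AffineMap.homothety z c '' K) =
      ENNReal.ofReal (c ^ p) * volume K := by
    rw [Measure.addHaar_image_homothety, finrank_euclideanSpace_fin,
      abs_of_nonneg (pow_nonneg hc p)]
  have hupper : (S.encard : ENNReal) ≤ ENNReal.ofReal ((1 + t) ^ p) * volume K := by
    rw [← hvol, ← himage _ (by positivity)]
    refine measure_mono (Set.iUnion₂_subset fun v hv x hx => ?_)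
    exact hK.mem_homothety_one_add_image hz ht₀ hv.1
      (htr ▸ norm_sub_le_of_mem_centredCube hx)
  have hlower : ENNReal.ofReal ((1 - t) ^ p) * volume K ≤ (S.encard : ENNReal) := by
    rw [← hvol, ← himage _ (sub_nonneg.2 ht₁)]
    refine measure_mono fun x hx => ?_
    obtain ⟨v, hv, hxv⟩ := exists_integerPoint_mem_centredCube x
    refine Set.mem_biUnion (x := v) ⟨?_, hv⟩ hxv
    refine hK.mem_of_norm_sub_le_of_mem_homothety_one_sub_image hz ht₀ ht₁ hx ?_
    rw [htr, norm_sub_rev]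
    exact norm_sub_le_of_mem_centredCube hxv
  have hfin : ENNReal.ofReal ((1 + t) ^ p) * volume K ≠ ⊤ :=
    ENNReal.mul_ne_top ENNReal.ofReal_ne_top hKcompact.measure_ne_top
  have hSfin : S.Finite := by
    rw [← Set.encard_ne_top_iff]
    intro h
    rw [h] at hupper
    exact hfin (top_le_iff.1 hupper)
  have hcard : (S.encard : ENNReal).toReal = S.ncard := by
    rw [← hSfin.cast_ncard_eq]
    simp
  have hSne : (S.encard : ENNReal) ≠ ⊤ := ne_top_of_le_ne_top hfin hupper
  constructor
  · have := ENNReal.toReal_mono hSne hlower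
    rwa [hcard, ENNReal.toReal_mul, ENNReal.toReal_ofReal (pow_nonneg (sub_nonneg.2 ht₁) p),
      mul_comm] at this
  · have := ENNReal.toReal_mono hfin hupper
    rwa [hcard, ENNReal.toReal_mul, ENNReal.toReal_ofReal (by positivity), mul_comm] at this
end
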